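/- Fix 1 < p ≤ 2 and an exponent θ = θ(p). Let ρ be an absolutely continuous Borel probability measure on X₁ × X₂ whose Lebesgue density is bounded above and below by strictly positive constants, and let μ₁, ν₁ ∈ P(X₁), μ₂, ν₂ ∈ P(X₂). Then there exists a constant C = C(ρ, X₁×X₂, p, θ) < ∞, independent of μ₁, μ₂, ν₁, ν₂, such that for every q ∈ [1,∞], W_p(S(ρ;μ₁,μ₂), S(ρ;ν₁,ν₂)) ≤ C ( W_q(μ₁,ν₁)^θ + W_q(μ₂,ν₂)^θ ), where S(ρ;μ₁,μ₂) and S(ρ;ν₁,ν₂) are the (unique) shadows of ρ onto Π(μ₁,μ₂) and Π(ν₁,ν₂) respectively. -/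

import Mathlib

open MeasureTheory ProbabilityTheory
open scoped ENNReal

noncomputable section

abbrev Vec (n : ℕ) : Type := Fin n → ℝ

/-- ℓ_p distance on ℝ^n. -/
def lpDist (p : ℝ) {n : ℕ} (x y : Vec n) : ℝ := (∑ i, |x i - y i| ^ p) ^ (1 / p)

/-- product metric d_p on ℝ^{d₁} × ℝ^{d₂}. -/
def prodDist (p : ℝ) {n m : ℕ} (x y : Vec n × Vec m) : ℝ :=
  (lpDist p x.1 y.1 ^ p + lpDist p x.2 y.2 ^ p) ^ (1 / p)

/-- γ is a coupling of α and β. -/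
def IsCoupling {E : Type*} [MeasurableSpace E] (γ : Measure (E × E)) (α β : Measure E) : Prop :=
  IsProbabilityMeasure γ ∧ γ.map Prod.fst = α ∧ γ.map Prod.snd = β

/-- p-Wasserstein distance (p < ∞) w.r.t. a cost/metric c. -/
def Wp {E : Type*} [MeasurableSpace E] (p : ℝ) (c : E → E → ℝ) (α β : Measure E) : ℝ :=
  sInf ((fun γ : Measure (E × E) => (∫ z, c z.1 z.2 ^ p ∂γ) ^ (1 / p)) '' {γ | IsCoupling γ α β})

/-- ∞-Wasserstein distance w.r.t. a cost/metric c. -/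
def Winf {E : Type*} [MeasurableSpace E] (c : E → E → ℝ) (α β : Measure E) : ℝ :=
  sInf ((fun γ : Measure (E × E) => essSup (fun z => c z.1 z.2) γ) '' {γ | IsCoupling γ α β})

/-- q-Wasserstein distance for q ∈ [1,∞]. -/
def Wq {E : Type*} [MeasurableSpace E] (q : ℝ≥0∞) (c : E → E → ℝ) (α β : Measure E) : ℝ :=
  if q = ∞ then Winf c α β else Wp q.toReal c α β

/-- μ is a Borel probability measure concentrated on X. -/
def ProbOn {E : Type*} [MeasurableSpace E] (μ : Measure E) (X : Set E) : Prop :=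
  IsProbabilityMeasure μ ∧ μ Xᶜ = 0

/-- ρ is absolutely continuous with Lebesgue density bounded above and below by strictly
positive constants on X, and vanishing off X. -/
def NiceDensityOn {E : Type*} [MeasureSpace E] (ρ : Measure E) (X : Set E) : Prop :=
  ∃ (f : E → ℝ≥0∞) (c₁ c₂ : ℝ≥0∞), 0 < c₁ ∧ c₂ < ∞ ∧ ρ = volume.withDensity f ∧
    (∀ x ∈ X, c₁ ≤ f x ∧ f x ≤ c₂) ∧ (∀ x ∉ X, f x = 0)

/-- T is an optimal transport map from α to β for W_p w.r.t. cost c. -/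
def IsOptMap {E : Type*} [MeasurableSpace E] (p : ℝ) (c : E → E → ℝ) (α β : Measure E)
    (T : E → E) : Prop :=
  Measurable T ∧ α.map T = β ∧ (∫ x, c x (T x) ^ p ∂α) ^ (1 / p) = Wp p c α β

/-- Π(μ₁, μ₂): couplings of μ₁ and μ₂. -/
def Pi2 {d₁ d₂ : ℕ} (μ₁ : Measure (Vec d₁)) (μ₂ : Measure (Vec d₂)) :
    Set (Measure (Vec d₁ × Vec d₂)) :=
  {π | IsProbabilityMeasure π ∧ π.map Prod.fst = μ₁ ∧ π.map Prod.snd = μ₂}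

/-- S is a shadow of ρ onto Π(μ₁,μ₂) for the p-Wasserstein distance. -/
def IsShadow2 (p : ℝ) {d₁ d₂ : ℕ} (ρ : Measure (Vec d₁ × Vec d₂))
    (μ₁ : Measure (Vec d₁)) (μ₂ : Measure (Vec d₂)) (S : Measure (Vec d₁ × Vec d₂)) : Prop :=
  ∃ (κ₁ : Kernel (Vec d₁) (Vec d₁)) (κ₂ : Kernel (Vec d₂) (Vec d₂)),
    IsMarkovKernel κ₁ ∧ IsMarkovKernel κ₂ ∧
    (∃ γ₁ : Measure (Vec d₁ × Vec d₁),
      (∀ A, MeasurableSet A → γ₁ A = ∫⁻ y, κ₁ y {x | (x, y) ∈ A} ∂(ρ.map Prod.fst)) ∧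
      IsCoupling γ₁ μ₁ (ρ.map Prod.fst) ∧
      (∫ z, lpDist p z.1 z.2 ^ p ∂γ₁) ^ (1 / p) = Wp p (lpDist p) μ₁ (ρ.map Prod.fst)) ∧
    (∃ γ₂ : Measure (Vec d₂ × Vec d₂),
      (∀ A, MeasurableSet A → γ₂ A = ∫⁻ y, κ₂ y {x | (x, y) ∈ A} ∂(ρ.map Prod.snd)) ∧
      IsCoupling γ₂ μ₂ (ρ.map Prod.snd) ∧
      (∫ z, lpDist p z.1 z.2 ^ p ∂γ₂) ^ (1 / p) = Wp p (lpDist p) μ₂ (ρ.map Prod.snd)) ∧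
    (∀ A : Set (Vec d₁ × Vec d₂), MeasurableSet A →
      S A = ∫⁻ y, ((κ₁ y.1).prod (κ₂ y.2)) A ∂ρ)

/-- d_{X,p}: product metric on a K-fold product of Euclidean spaces. -/
def piDist (p : ℝ) {K : ℕ} {d : Fin K → ℕ} (x y : (i : Fin K) → Vec (d i)) : ℝ :=
  (∑ i, lpDist p (x i) (y i) ^ p) ^ (1 / p)

/-- S is a shadow of ρ onto Π(μ₁,…,μ_K) for the p-Wasserstein distance. -/
def IsShadowK (p : ℝ) {K : ℕ} {d : Fin K → ℕ} (ρ : Measure ((i : Fin K) → Vec (d i)))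
    (μ : (i : Fin K) → Measure (Vec (d i))) (S : Measure ((i : Fin K) → Vec (d i))) : Prop :=
  ∃ κ : (i : Fin K) → Kernel (Vec (d i)) (Vec (d i)),
    (∀ i, IsMarkovKernel (κ i)) ∧
    (∀ i, ∃ γ : Measure (Vec (d i) × Vec (d i)),
      (∀ A, MeasurableSet A → γ A = ∫⁻ y, κ i y {x | (x, y) ∈ A} ∂(ρ.map fun z => z i)) ∧
      IsCoupling γ (μ i) (ρ.map fun z => z i) ∧
      (∫ z, lpDist p z.1 z.2 ^ p ∂γ) ^ (1 / p) = Wp p (lpDist p) (μ i) (ρ.map fun z => z i)) ∧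
    (∀ A, MeasurableSet A → S A = ∫⁻ y, Measure.pi (fun i => κ i (y i)) A ∂ρ)



/-! ### Part 1: Prékopa–Leindler at the midpoint -/

lemma bm_one_dim (A B S : Set ℝ) (hA : MeasurableSet A) (hB : MeasurableSet B)
    (hAn : A.Nonempty) (hBn : B.Nonempty)
    (hS : ∀ a ∈ A, ∀ b ∈ B, (a + b) / 2 ∈ S) :
    volume A + volume B ≤ 2 * volume S := by
  have key : ∀ K L : Set ℝ, K ⊆ A → L ⊆ B → IsCompact K → IsCompact L → K.Nonempty → L.Nonempty →
      volume K + volume L ≤ 2 * volume S := by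
    intro K L hKA hLB hK hL hKn hLn
    set k := sSup K
    set l := sInf L
    have hk : k ∈ K := hK.sSup_mem hKn
    have hl : l ∈ L := hL.sInf_mem hLn
    set S1 := AffineMap.homothety l (1 / 2 : ℝ) '' K
    set S2 := AffineMap.homothety k (1 / 2 : ℝ) '' L
    have h1 : volume S1 = ENNReal.ofReal (1 / 2) * volume K := by
      rw [Measure.addHaar_image_homothety]
      simp
    have h2 : volume S2 = ENNReal.ofReal (1 / 2) * volume L := by
      rw [Measure.addHaar_image_homothety]
      simp
    have hsub : S1 ∪ S2 ⊆ S := by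
      rintro x (⟨y, hy, rfl⟩ | ⟨y, hy, rfl⟩)
      · have := hS y (hKA hy) l (hLB hl)
        convert this using 1
        simp [AffineMap.homothety_apply]; ring
      · have := hS k (hKA hk) y (hLB hy)
        convert this using 1
        simp [AffineMap.homothety_apply]; ring
    have hS2m : MeasurableSet S2 := by
      refine (IsCompact.image hL ?_).measurableSet
      exact AffineMap.homothety_continuous _ _
    have hItg : S1 ∩ S2 ⊆ {(k + l) / 2} := by
      rintro x ⟨⟨y, hy, hyx⟩, ⟨z, hz, hzx⟩⟩
      have a1 : y ≤ k := le_csSup hK.bddAbove hy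
      have a2 : l ≤ z := csInf_le hL.bddBelow hz
      simp only [AffineMap.homothety_apply, vsub_eq_sub, smul_eq_mul, vadd_eq_add] at hyx hzx
      simp only [Set.mem_singleton_iff]
      linarith
    have hun : volume (S1 ∪ S2) = volume S1 + volume S2 := by
      apply measure_union₀ hS2m.nullMeasurableSet
      exact measure_mono_null hItg (by simp)
    have h3 : volume S1 + volume S2 ≤ volume S := hun ▸ measure_mono hsub
    have h4 : (2 : ℝ≥0∞) * ENNReal.ofReal (1 / 2) = 1 := by
      rw [show (2 : ℝ≥0∞) = ENNReal.ofReal 2 by simp, ← ENNReal.ofReal_mul (by norm_num)]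
      norm_num
    calc volume K + volume L = 2 * (volume S1 + volume S2) := by
          rw [h1, h2, mul_add, ← mul_assoc, ← mul_assoc, h4, one_mul, one_mul]
      _ ≤ _ := by gcongr
  obtain ⟨a0, ha0⟩ := hAn
  obtain ⟨b0, hb0⟩ := hBn
  have getK : ∀ (A : Set ℝ), MeasurableSet A → ∀ a0 ∈ A, ∀ r < volume A,
      ∃ K ⊆ A, IsCompact K ∧ K.Nonempty ∧ r ≤ volume K := by
    intro A hA a0 ha0 r hr
    obtain ⟨K, hK, hKc, hKr⟩ := hA.exists_lt_isCompact hr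
    refine ⟨K, hK, hKc, ?_, hKr.le⟩
    by_contra hne
    rw [Set.not_nonempty_iff_eq_empty] at hne
    simp [hne] at hKr
  have getK' : ∀ (A : Set ℝ), MeasurableSet A → ∀ a0 ∈ A, ∀ r, (r < volume A ∨ r = 0) →
      ∃ K ⊆ A, IsCompact K ∧ K.Nonempty ∧ r ≤ volume K := by
    intro A hA a0 ha0 r hr
    rcases hr with hr | hr
    · exact getK A hA a0 ha0 r hr
    · exact ⟨{a0}, by simpa using ha0, isCompact_singleton, Set.singleton_nonempty _, by simp [hr]⟩
  have main : ∀ r s, (r < volume A ∨ r = 0) → (s < volume B ∨ s = 0) → r + s ≤ 2 * volume S := by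
    intro r s hr hs
    obtain ⟨K, hK, hKc, hKn, hKr⟩ := getK' A hA a0 ha0 r hr
    obtain ⟨L, hL, hLc, hLn, hLr⟩ := getK' B hB b0 hb0 s hs
    exact (add_le_add hKr hLr).trans (key K L hK hL hKc hLc hKn hLn)
  rcases eq_or_ne (volume A) 0 with hA0 | hA0
  · rcases eq_or_ne (volume B) 0 with hB0 | hB0
    · simp [hA0, hB0]
    · rw [hA0, zero_add]
      refine le_of_forall_lt_imp_le_of_dense fun s hs => ?_
      simpa using main 0 s (Or.inr rfl) (Or.inl hs)
  · rcases eq_or_ne (volume B) 0 with hB0 | hB0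
    · rw [hB0, add_zero]
      refine le_of_forall_lt_imp_le_of_dense fun s hs => ?_
      simpa using main s 0 (Or.inl hs) (Or.inr rfl)
    · have aux : ∀ s < volume B, volume A + s ≤ 2 * volume S := by
        intro s hs
        have hsT : s ≤ 2 * volume S := by simpa using main 0 s (Or.inr rfl) (Or.inl hs)
        have : volume A ≤ 2 * volume S - s := le_of_forall_lt_imp_le_of_dense fun r hr =>
          ENNReal.le_sub_of_add_le_right hs.ne_top (main r s (Or.inl hr) (Or.inl hs))
        calc volume A + s ≤ (2 * volume S - s) + s := by gcongr
          _ = _ := tsub_add_cancel_of_le hsT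
      have hAT : volume A ≤ 2 * volume S := by simpa using aux 0 (pos_iff_ne_zero.2 hB0)
      rcases eq_or_ne (volume A) ∞ with hAi | hAi
      · rw [hAi, top_le_iff] at hAT
        simp [hAT]
      have : volume B ≤ 2 * volume S - volume A := le_of_forall_lt_imp_le_of_dense fun r hr =>
          ENNReal.le_sub_of_add_le_left hAi (aux r hr)
      calc volume A + volume B ≤ volume A + (2 * volume S - volume A) := by gcongr
          _ = _ := add_tsub_cancel_of_le hAT

lemma pl_layer (F G H : ℝ → ℝ) (hF : Measurable F) (hG : Measurable G) (hH : Measurable H)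
    (F0 : ∀ x, 0 ≤ F x) (G0 : ∀ x, 0 ≤ G x) (H0 : ∀ x, 0 ≤ H x)
    (F1 : ∀ x, F x ≤ 1) (G1 : ∀ x, G x ≤ 1)
    (Fs : ∀ t < 1, ∃ x, t < F x) (Gs : ∀ t < 1, ∃ x, t < G x)
    (h : ∀ t x y, 0 ≤ t → t < F x → t < G y → t < H ((x + y) / 2)) :
    (∫⁻ x, ENNReal.ofReal (F x)) + ∫⁻ x, ENNReal.ofReal (G x)
      ≤ 2 * ∫⁻ x, ENNReal.ofReal (H x) := by
  rw [lintegral_eq_lintegral_meas_lt volume (Filter.Eventually.of_forall F0) hF.aemeasurable,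
    lintegral_eq_lintegral_meas_lt volume (Filter.Eventually.of_forall G0) hG.aemeasurable,
    lintegral_eq_lintegral_meas_lt volume (Filter.Eventually.of_forall H0) hH.aemeasurable]
  have mF : Measurable fun t : ℝ => volume {a | t < F a} :=
    Antitone.measurable fun s t hst => measure_mono fun x hx => lt_of_le_of_lt hst hx
  have mH : Measurable fun t : ℝ => volume {a | t < H a} :=
    Antitone.measurable fun s t hst => measure_mono fun x hx => lt_of_le_of_lt hst hx
  rw [← lintegral_add_left mF, ← lintegral_const_mul _ mH]
  refine setLIntegral_mono (by fun_prop) ?_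
  intro t ht
  rcases lt_or_ge t 1 with ht1 | ht1
  · refine bm_one_dim _ _ _ (measurableSet_lt measurable_const hF)
      (measurableSet_lt measurable_const hG) (Fs t ht1) (Gs t ht1) ?_
    intro a ha b hb
    exact h t a b (le_of_lt ht) ha hb
  · have e1 : {a | t < F a} = ∅ := by
      ext x; simpa using (F1 x).trans ht1
    have e2 : {a | t < G a} = ∅ := by
      ext x; simpa using (G1 x).trans ht1
    simp [e1, e2]

lemma ennreal_amgm (u v w : ℝ≥0∞) (h : u + v ≤ 2 * w) : u * v ≤ w ^ 2 := by
  rcases eq_or_ne w ∞ with hw | hw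
  · simp [hw]
  have hfin : u + v ≠ ∞ := ne_top_of_le_ne_top (ENNReal.mul_ne_top (by simp) hw) h
  have hu : u ≠ ∞ := fun h' => hfin (by simp [h'])
  have hv : v ≠ ∞ := fun h' => hfin (by simp [h'])
  lift u to NNReal using hu
  lift v to NNReal using hv
  lift w to NNReal using hw
  norm_cast at h ⊢
  have h' : (u : ℝ) + v ≤ 2 * w := by exact_mod_cast h
  have : (u : ℝ) * v ≤ w ^ 2 := by
    nlinarith [sq_nonneg ((u : ℝ) - v), u.2, v.2, w.2, NNReal.coe_nonneg u, NNReal.coe_nonneg v, NNReal.coe_nonneg w]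
  exact_mod_cast this

/-- The midpoint Prékopa–Leindler property of a measure space. -/
def PLProp (E : Type*) [MeasureSpace E] [AddCommGroup E] [Module ℝ E] : Prop :=
  ∀ f g h : E → ℝ≥0∞, Measurable f → Measurable g → Measurable h →
    (∀ x y, f x * g y ≤ h ((1 / 2 : ℝ) • (x + y)) ^ 2) →
    (∫⁻ x, f x) * (∫⁻ x, g x) ≤ (∫⁻ x, h x) ^ 2

lemma pl_real_bdd (f g h : ℝ → ℝ≥0∞) (hf : Measurable f) (hg : Measurable g) (hh : Measurable h)
    (hfb : (⨆ x, f x) ≠ ∞) (hgb : (⨆ x, g x) ≠ ∞)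
    (H : ∀ x y, f x * g y ≤ h ((1 / 2 : ℝ) • (x + y)) ^ 2) :
    (∫⁻ x, f x) * (∫⁻ x, g x) ≤ (∫⁻ x, h x) ^ 2 := by
  set a := ⨆ x, f x with ha
  set b := ⨆ x, g x with hb
  have hfa : ∀ x, f x ≤ a := fun x => le_iSup f x
  have hgb' : ∀ x, g x ≤ b := fun x => le_iSup g x
  rcases eq_or_ne a 0 with ha0 | ha0
  · have : ∀ x, f x = 0 := fun x => by simpa [ha0] using hfa x
    simp [this]
  rcases eq_or_ne b 0 with hb0 | hb0
  · have : ∀ x, g x = 0 := fun x => by simpa [hb0] using hgb' x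
    simp [this]
  set c := (a * b) ^ (1 / 2 : ℝ) with hc
  have hcc : c ^ 2 = a * b := by
    rw [hc, ← ENNReal.rpow_natCast, ← ENNReal.rpow_mul]; norm_num
  have hab : a * b ≠ ∞ := ENNReal.mul_ne_top hfb hgb
  have hab0 : a * b ≠ 0 := mul_ne_zero ha0 hb0
  have hct : c ≠ ∞ := by
    intro h'; rw [h'] at hcc; simp at hcc; exact hab hcc.symm
  have hc0 : c ≠ 0 := by
    intro h'; rw [h'] at hcc; exact hab0 (by rw [← hcc]; simp)
  have fa1 : ∀ x, f x / a ≤ 1 := fun x => ENNReal.div_le_of_le_mul (by simpa using hfa x)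
  have gb1 : ∀ x, g x / b ≤ 1 := fun x => ENNReal.div_le_of_le_mul (by simpa using hgb' x)
  have fat : ∀ x, f x / a ≠ ∞ := fun x => ne_top_of_le_ne_top ENNReal.one_ne_top (fa1 x)
  have gbt : ∀ x, g x / b ≠ ∞ := fun x => ne_top_of_le_ne_top ENNReal.one_ne_top (gb1 x)
  have key := pl_layer (fun x => (f x / a).toReal) (fun x => (g x / b).toReal)
    (fun x => (min (h x / c) 1).toReal) (by fun_prop) (by fun_prop) (by fun_prop)
    (fun _ => ENNReal.toReal_nonneg) (fun _ => ENNReal.toReal_nonneg)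
    (fun _ => ENNReal.toReal_nonneg)
    (fun x => by simpa using ENNReal.toReal_mono ENNReal.one_ne_top (fa1 x))
    (fun x => by simpa using ENNReal.toReal_mono ENNReal.one_ne_top (gb1 x))
    (by
      intro t ht
      rcases lt_or_ge t 0 with h0 | h0
      · exact ⟨0, h0.trans_le ENNReal.toReal_nonneg⟩
      have : ENNReal.ofReal t * a < ⨆ x, f x := by
        rw [← ha]
        conv_rhs => rw [← one_mul a]
        refine ENNReal.mul_lt_mul_left ha0 hfb ?_
        rw [← ENNReal.ofReal_one]; exact (ENNReal.ofReal_lt_ofReal_iff one_pos).2 ht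
      obtain ⟨x, hx⟩ := lt_iSup_iff.1 this
      refine ⟨x, ?_⟩
      rw [← ENNReal.ofReal_lt_iff_lt_toReal h0 (fat x)]
      exact (ENNReal.lt_div_iff_mul_lt (Or.inl ha0) (Or.inl hfb)).2 hx)
    (by
      intro t ht
      rcases lt_or_ge t 0 with h0 | h0
      · exact ⟨0, h0.trans_le ENNReal.toReal_nonneg⟩
      have : ENNReal.ofReal t * b < ⨆ x, g x := by
        rw [← hb]
        conv_rhs => rw [← one_mul b]
        refine ENNReal.mul_lt_mul_left hb0 hgb ?_
        rw [← ENNReal.ofReal_one]; exact (ENNReal.ofReal_lt_ofReal_iff one_pos).2 ht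
      obtain ⟨x, hx⟩ := lt_iSup_iff.1 this
      refine ⟨x, ?_⟩
      rw [← ENNReal.ofReal_lt_iff_lt_toReal h0 (gbt x)]
      exact (ENNReal.lt_div_iff_mul_lt (Or.inl hb0) (Or.inl hgb)).2 hx)
    (by
      intro t x y h0 hx hy
      have hmt : min (h ((x + y) / 2) / c) 1 ≠ ∞ :=
        ne_top_of_le_ne_top ENNReal.one_ne_top (min_le_right _ _)
      have hx1 : t < 1 := hx.trans_le
        (by simpa using ENNReal.toReal_mono ENNReal.one_ne_top (fa1 x))
      rw [← ENNReal.ofReal_lt_iff_lt_toReal h0 (fat x)] at hx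
      rw [← ENNReal.ofReal_lt_iff_lt_toReal h0 (gbt y)] at hy
      rw [← ENNReal.ofReal_lt_iff_lt_toReal h0 hmt, lt_min_iff]
      constructor
      · have h1 : ENNReal.ofReal t ^ 2 < (h ((x + y) / 2) / c) ^ 2 := by
          calc ENNReal.ofReal t ^ 2 = ENNReal.ofReal t * ENNReal.ofReal t := sq _
            _ < (f x / a) * (g y / b) := ENNReal.mul_lt_mul hx hy
            _ = (f x * g y) / (a * b) := by
              rw [ENNReal.div_eq_inv_mul, ENNReal.div_eq_inv_mul, ENNReal.div_eq_inv_mul,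
                ENNReal.mul_inv (Or.inl ha0) (Or.inl hfb)]
              ring
            _ ≤ (h ((x + y) / 2)) ^ 2 / (a * b) := by
              gcongr
              have := H x y
              rwa [smul_eq_mul, one_div_mul_eq_div] at this
            _ = _ := by
              rw [← hcc, ENNReal.div_eq_inv_mul, ENNReal.div_eq_inv_mul, mul_pow, ENNReal.inv_pow]
        exact (ENNReal.pow_lt_pow_left_iff two_ne_zero).1 h1
      · rw [← ENNReal.ofReal_one]; exact (ENNReal.ofReal_lt_ofReal_iff one_pos).2 hx1)
  have e1 : ∀ x, ENNReal.ofReal ((f x / a).toReal) = a⁻¹ * f x := fun x => by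
    rw [ENNReal.ofReal_toReal (fat x), ENNReal.div_eq_inv_mul]
  have e2 : ∀ x, ENNReal.ofReal ((g x / b).toReal) = b⁻¹ * g x := fun x => by
    rw [ENNReal.ofReal_toReal (gbt x), ENNReal.div_eq_inv_mul]
  have e3 : ∀ x, ENNReal.ofReal ((min (h x / c) 1).toReal) ≤ c⁻¹ * h x := fun x => by
    rw [ENNReal.ofReal_toReal (ne_top_of_le_ne_top ENNReal.one_ne_top (min_le_right _ _)),
      ← ENNReal.div_eq_inv_mul]
    exact min_le_left _ _
  simp only [e1, e2] at key
  have key2 := key.trans (mul_le_mul_right (lintegral_mono e3) 2)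
  rw [lintegral_const_mul _ hf, lintegral_const_mul _ hg, lintegral_const_mul _ hh] at key2
  have k3 := ennreal_amgm _ _ _ key2
  have k4 := mul_le_mul_right k3 (a * b)
  have l1 : a * b * (a⁻¹ * (∫⁻ x, f x) * (b⁻¹ * ∫⁻ x, g x)) = (∫⁻ x, f x) * (∫⁻ x, g x) := by
    rw [show a * b * (a⁻¹ * (∫⁻ x, f x) * (b⁻¹ * ∫⁻ x, g x)) =
      (a * a⁻¹) * (b * b⁻¹) * ((∫⁻ x, f x) * (∫⁻ x, g x)) by ring,
      ENNReal.mul_inv_cancel ha0 hfb, ENNReal.mul_inv_cancel hb0 hgb]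
    simp
  have l2 : a * b * (c⁻¹ * ∫⁻ x, h x) ^ 2 = (∫⁻ x, h x) ^ 2 := by
    rw [← hcc, ← mul_pow, ← mul_assoc, ENNReal.mul_inv_cancel hc0 hct, one_mul]
  rwa [l1, l2] at k4

lemma pl_real : PLProp ℝ := by
  intro f g h hf hg hh H
  have hb : ∀ (f : ℝ → ℝ≥0∞) (n : ℕ), (⨆ x, min (f x) (n : ℝ≥0∞)) ≠ ∞ := by
    intro f n
    exact ne_top_of_le_ne_top (ENNReal.natCast_ne_top n) (iSup_le fun x => min_le_right _ _)
  have hn : ∀ n : ℕ, (∫⁻ x, min (f x) n) * (∫⁻ x, min (g x) n) ≤ (∫⁻ x, h x) ^ 2 := by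
    intro n
    refine pl_real_bdd _ _ h (by fun_prop) (by fun_prop) hh (hb f n) (hb g n) ?_
    intro x y
    exact (mul_le_mul' (min_le_left _ _) (min_le_left _ _)).trans (H x y)
  have hs : ∀ (f : ℝ → ℝ≥0∞), Measurable f → (∫⁻ x, f x) = ⨆ n : ℕ, ∫⁻ x, min (f x) n := by
    intro f hf
    rw [← lintegral_iSup (by fun_prop)]
    · refine lintegral_congr fun x => ?_
      rw [← inf_iSup_eq, ENNReal.iSup_natCast, inf_top_eq]
    · intro m n hmn x
      exact min_le_min_left _ (by exact_mod_cast hmn)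
  rw [hs f hf, hs g hg, ENNReal.iSup_mul]
  refine iSup_le fun i => ?_
  rw [ENNReal.mul_iSup]
  refine iSup_le fun j => le_trans ?_ (hn (max i j))
  refine mul_le_mul' (lintegral_mono fun x => ?_) (lintegral_mono fun x => ?_)
  · exact min_le_min_left _ (by exact_mod_cast le_max_left _ _)
  · exact min_le_min_left _ (by exact_mod_cast le_max_right _ _)

lemma pl_vec (n : ℕ) : PLProp (Vec n) := by
  induction n with
  | zero =>
    intro f g h hf hg hh H
    have hv : (volume : Measure (Vec 0)) = Measure.dirac (fun i => i.elim0) := by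
      rw [volume_pi]; exact Measure.pi_of_empty _ _
    rw [hv, lintegral_dirac, lintegral_dirac, lintegral_dirac]
    convert H _ _ using 3
  | succ n ih =>
    intro f g h hf hg hh H
    set e := MeasurableEquiv.piFinSuccAbove (fun _ : Fin (n + 1) => ℝ) 0
    have he := (volume_preserving_piFinSuccAbove (fun _ : Fin (n + 1) => ℝ) 0).symm
    have hi : ∀ f : Vec (n + 1) → ℝ≥0∞, Measurable f →
        ∫⁻ x, f x = ∫⁻ s : ℝ, ∫⁻ y : Vec n, f (e.symm (s, y)) := by
      intro f hf
      rw [← he.lintegral_comp hf]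
      exact lintegral_prod _ (hf.comp e.symm.measurable).aemeasurable
    rw [hi f hf, hi g hg, hi h hh]
    have hm : ∀ f : Vec (n + 1) → ℝ≥0∞, Measurable f →
        Measurable fun s : ℝ => ∫⁻ y : Vec n, f (e.symm (s, y)) := by
      intro f hf
      exact Measurable.lintegral_prod_right' (hf.comp e.symm.measurable)
    refine pl_real _ _ _ (hm f hf) (hm g hg) (hm h hh) ?_
    intro s t
    refine ih _ _ _ ?_ ?_ ?_ ?_
    · exact hf.comp (e.symm.measurable.comp measurable_prodMk_left)
    · exact hg.comp (e.symm.measurable.comp measurable_prodMk_left)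
    · exact hh.comp (e.symm.measurable.comp measurable_prodMk_left)
    · intro x y
      have := H (e.symm (s, x)) (e.symm (t, y))
      convert this using 3
      ext i
      refine Fin.cases ?_ (fun j => ?_) i
      · simp [e, MeasurableEquiv.piFinSuccAbove]
      · simp [e, MeasurableEquiv.piFinSuccAbove]
        ring

section PartTwo
set_option linter.unusedSectionVars false
open scoped CompactlySupported

/-! ### Part 2: Kantorovich duality on compact spaces -/

section Duality

variable {K₁ K₂ : Type*} [MetricSpace K₁] [CompactSpace K₁] [MeasurableSpace K₁] [BorelSpace K₁]
  [MetricSpace K₂] [CompactSpace K₂] [MeasurableSpace K₂] [BorelSpace K₂]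

/-- values of dual competitors dominating `u` -/
def dualVals (α : Measure K₁) (β : Measure K₂) (u : C(K₁ × K₂, ℝ)) : Set ℝ :=
  {r | ∃ (φ : C(K₁, ℝ)) (ψ : C(K₂, ℝ)), (∀ x y, u (x, y) ≤ φ x + ψ y) ∧
    r = ∫ x, φ x ∂α + ∫ y, ψ y ∂β}

lemma cont_integrable {K : Type*} [MetricSpace K] [CompactSpace K] [MeasurableSpace K]
    [BorelSpace K] (α : Measure K) [IsFiniteMeasure α] (φ : C(K, ℝ)) : Integrable (fun x => φ x) α :=
  φ.continuous.integrable_of_hasCompactSupport (HasCompactSupport.of_compactSpace _)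

lemma dualVals_lower (α : Measure K₁) (β : Measure K₂) [IsProbabilityMeasure α]
    [IsProbabilityMeasure β] (m : ℝ) (u : C(K₁ × K₂, ℝ)) (hm : ∀ z, m ≤ u z)
    {r : ℝ} (hr : r ∈ dualVals α β u) : m ≤ r := by
  obtain ⟨φ, ψ, h, rfl⟩ := hr
  have h1 : ∀ x, m - φ x ≤ ∫ y, ψ y ∂β := by
    intro x
    have := integral_mono (μ := β) (integrable_const (m - φ x)) (cont_integrable β ψ)
      (fun y => by have := h x y; have := hm (x, y); simp only; linarith)
    simpa using this
  have h2 := integral_mono (μ := α) (f := fun x => m - φ x)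
    ((integrable_const m).sub (cont_integrable α φ))
    (integrable_const (∫ y, ψ y ∂β)) h1
  rw [integral_sub (integrable_const m) (cont_integrable α φ)] at h2
  simp at h2
  linarith

lemma dualVals_nonempty (α : Measure K₁) (β : Measure K₂) (u : C(K₁ × K₂, ℝ)) :
    (dualVals α β u).Nonempty :=
  ⟨_, ContinuousMap.const _ ‖u‖, 0, fun x y => by
    simpa using (le_abs_self _).trans (u.norm_coe_le_norm (x, y)), rfl⟩

lemma dualVals_bdd (α : Measure K₁) (β : Measure K₂) [IsProbabilityMeasure α]
    [IsProbabilityMeasure β] (u : C(K₁ × K₂, ℝ)) : BddBelow (dualVals α β u) :=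
  ⟨-‖u‖, fun _ hr => dualVals_lower α β _ u
    (fun z => (abs_le.1 (u.norm_coe_le_norm z)).1) hr⟩

theorem kantorovich (α : Measure K₁) (β : Measure K₂) [IsProbabilityMeasure α]
    [IsProbabilityMeasure β] (c : C(K₁ × K₂, ℝ)) :
    ∃ γ : Measure (K₁ × K₂), IsProbabilityMeasure γ ∧ γ.map Prod.fst = α ∧ γ.map Prod.snd = β ∧
      ∀ η > 0, ∃ (φ : C(K₁, ℝ)) (ψ : C(K₂, ℝ)), (∀ x y, φ x + ψ y ≤ c (x, y)) ∧
        ∫ z, c z ∂γ ≤ ∫ x, φ x ∂α + ∫ y, ψ y ∂β + η := by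
  set N : C(K₁ × K₂, ℝ) → ℝ := fun u => sInf (dualVals α β u) with hN
  have Nle : ∀ u (φ : C(K₁, ℝ)) (ψ : C(K₂, ℝ)), (∀ x y, u (x, y) ≤ φ x + ψ y) →
      N u ≤ ∫ x, φ x ∂α + ∫ y, ψ y ∂β := fun u φ ψ h =>
    csInf_le (dualVals_bdd α β u) ⟨φ, ψ, h, rfl⟩
  have Nex : ∀ u, ∀ η > 0, ∃ (φ : C(K₁, ℝ)) (ψ : C(K₂, ℝ)), (∀ x y, u (x, y) ≤ φ x + ψ y) ∧
      ∫ x, φ x ∂α + ∫ y, ψ y ∂β < N u + η := by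
    intro u η hη
    obtain ⟨r, ⟨φ, ψ, h, rfl⟩, hr⟩ := exists_lt_of_csInf_lt (dualVals_nonempty α β u)
      (show sInf (dualVals α β u) < N u + η by simp [hN, hη])
    exact ⟨φ, ψ, h, hr⟩
  have Nadd : ∀ u v, N (u + v) ≤ N u + N v := by
    intro u v
    refine le_of_forall_pos_le_add fun η hη => ?_
    obtain ⟨φ, ψ, h, hr⟩ := Nex u (η / 2) (by positivity)
    obtain ⟨φ', ψ', h', hr'⟩ := Nex v (η / 2) (by positivity)
    have := Nle (u + v) (φ + φ') (ψ + ψ') (fun x y => by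
      simp only [ContinuousMap.add_apply]; linarith [h x y, h' x y])
    simp only [ContinuousMap.add_apply] at this
    rw [integral_add (cont_integrable α φ) (cont_integrable α φ'),
      integral_add (cont_integrable β ψ) (cont_integrable β ψ')] at this
    linarith
  have Nhom1 : ∀ t : ℝ, 0 < t → ∀ u, N (t • u) ≤ t * N u := by
    intro t ht u
    refine le_of_forall_pos_le_add fun η hη => ?_
    obtain ⟨φ, ψ, h, hr⟩ := Nex u (η / t) (by positivity)
    have := Nle (t • u) (t • φ) (t • ψ) (fun x y => by
      simp only [ContinuousMap.smul_apply, smul_eq_mul]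
      rw [← mul_add]; exact mul_le_mul_of_nonneg_left (h x y) ht.le)
    simp only [ContinuousMap.smul_apply, smul_eq_mul, integral_const_mul] at this
    have h2 := mul_lt_mul_of_pos_left hr ht
    rw [mul_add, mul_add, mul_div_cancel₀ _ ht.ne'] at h2
    linarith
  have Nhom : ∀ t : ℝ, 0 < t → ∀ u, N (t • u) = t * N u := by
    intro t ht u
    refine le_antisymm (Nhom1 t ht u) ?_
    have := Nhom1 t⁻¹ (by positivity) (t • u)
    rw [smul_smul, inv_mul_cancel₀ ht.ne', one_smul] at this
    calc t * N u ≤ t * (t⁻¹ * N (t • u)) := mul_le_mul_of_nonneg_left this ht.le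
      _ = _ := by rw [← mul_assoc, mul_inv_cancel₀ ht.ne', one_mul]
  have N0 : N 0 = 0 := by
    have := Nhom 2 two_pos 0
    rw [smul_zero] at this
    linarith
  set f := LinearPMap.mkSpanSingleton' (σ := RingHom.id ℝ) (-c) (N (-c)) (by
    intro t ht
    rcases smul_eq_zero.1 ht with h | h
    · simp [h]
    · simp [h, N0]) with hf
  obtain ⟨g, hg1, hg2⟩ := exists_extension_of_le_sublinear f N Nhom Nadd (by
    rintro ⟨x, hx⟩
    obtain ⟨t, rfl⟩ := Submodule.mem_span_singleton.1 hx
    refine (LinearPMap.mkSpanSingleton'_apply (σ := RingHom.id ℝ) _ _ _ _ _).le.trans ?_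
    simp only [RingHom.id_apply, smul_eq_mul]
    rcases lt_trichotomy t 0 with ht | ht | ht
    · have h1 := Nhom (-t) (by linarith) (-c)
      have h2 := Nadd (t • (-c)) ((-t) • (-c))
      rw [← add_smul, add_neg_cancel, zero_smul, N0, h1] at h2
      linarith
    · simp [ht, N0]
    · exact (Nhom t ht _).ge)
  have hgc : g (-c) = N (-c) := by
    have hmem : -c ∈ f.domain := Submodule.mem_span_singleton_self _
    have := hg1 ⟨-c, hmem⟩
    refine this.trans ?_
    exact LinearPMap.mkSpanSingleton'_apply_self _ _ _ _
  have gpos : ∀ u : C(K₁ × K₂, ℝ), (∀ z, 0 ≤ u z) → 0 ≤ g u := by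
    intro u hu
    have h1 := hg2 (-u)
    have h2 := Nle (-u) 0 0 (fun x y => by simpa using hu (x, y))
    simp at h1 h2
    linarith
  have gsum : ∀ (u : C(K₁ × K₂, ℝ)) (φ : C(K₁, ℝ)) (ψ : C(K₂, ℝ)), (∀ x y, u (x, y) = φ x + ψ y) →
      g u = ∫ x, φ x ∂α + ∫ y, ψ y ∂β := by
    intro u φ ψ h
    apply le_antisymm
    · exact (hg2 u).trans (Nle u φ ψ fun x y => (h x y).le)
    · have h1 := (hg2 (-u)).trans (Nle (-u) (-φ) (-ψ) fun x y => by simp [h x y])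
      simp only [map_neg, ContinuousMap.neg_apply, integral_neg] at h1
      linarith
  let Λ₀ : C_c(K₁ × K₂, ℝ) →ₗ[ℝ] ℝ :=
    { toFun := fun u => g (u : C(K₁ × K₂, ℝ))
      map_add' := fun u v => by rw [← map_add]; rfl
      map_smul' := fun t u => by rw [← map_smul]; rfl }
  let Λ : C_c(K₁ × K₂, ℝ) →ₚ[ℝ] ℝ := PositiveLinearMap.mk₀ Λ₀ (fun u hu => gpos _ fun z => hu z)
  set γ := RealRMK.rieszMeasure Λ with hγ
  have hItg : ∀ u : C(K₁ × K₂, ℝ), ∫ z, u z ∂γ = g u := by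
    intro u
    exact RealRMK.integral_rieszMeasure Λ (CompactlySupportedContinuousMap.continuousMapEquiv u)
  have hprob : IsProbabilityMeasure γ := by
    have h1 := hItg 1
    rw [gsum 1 1 0 (by simp)] at h1
    simp [measureReal_def] at h1
    constructor
    rw [← ENNReal.toReal_eq_one_iff]; exact h1
  refine ⟨γ, hprob, ?_, ?_, ?_⟩
  · have : IsProbabilityMeasure (γ.map Prod.fst) := Measure.isProbabilityMeasure_map (by fun_prop)
    refine ext_of_forall_integral_eq_of_IsFiniteMeasure fun φ => ?_
    rw [integral_map (by fun_prop) (φ.continuous.aestronglyMeasurable)]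
    have := hItg ⟨fun z => φ z.1, by fun_prop⟩
    rw [gsum _ φ.toContinuousMap 0 (by intro x y; simp)] at this
    simpa using this
  · have : IsProbabilityMeasure (γ.map Prod.snd) := Measure.isProbabilityMeasure_map (by fun_prop)
    refine ext_of_forall_integral_eq_of_IsFiniteMeasure fun φ => ?_
    rw [integral_map (by fun_prop) (φ.continuous.aestronglyMeasurable)]
    have := hItg ⟨fun z => φ z.2, by fun_prop⟩
    rw [gsum _ 0 φ.toContinuousMap (by intro x y; simp)] at this
    simpa using this
  · intro η hη
    obtain ⟨φ, ψ, h, hr⟩ := Nex (-c) η hη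
    refine ⟨-φ, -ψ, fun x y => ?_, ?_⟩
    · have := h x y
      simp only [ContinuousMap.neg_apply] at this ⊢
      linarith
    · rw [hItg c]
      rw [map_neg] at hgc
      simp only [ContinuousMap.neg_apply, integral_neg]
      linarith

end Duality

end PartTwo


/-! ### Part 3: scalar inequalities -/

/-- The function `|t|^(p-2) t`. -/
def sg (p t : ℝ) : ℝ := |t| ^ (p - 2) * t

lemma sg_nonneg_eq {p t : ℝ} (hp1 : 1 < p) (ht : 0 ≤ t) : sg p t = t ^ (p - 1) := by
  unfold sg
  rcases ht.eq_or_lt with h | h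
  · rw [← h, Real.zero_rpow (by linarith)]; simp
  · rw [abs_of_pos h]
    nth_rewrite 2 [← Real.rpow_one t]
    rw [← Real.rpow_add h]; congr 1; ring

lemma sg_neg (p t : ℝ) : sg p (-t) = - sg p t := by
  simp [sg]

lemma abs_sg {p t : ℝ} (hp1 : 1 < p) : |sg p t| = |t| ^ (p - 1) := by
  rcases le_total 0 t with h | h
  · rw [sg_nonneg_eq hp1 h, abs_of_nonneg h, abs_of_nonneg (by positivity)]
  · have h' : 0 ≤ -t := by linarith
    rw [← abs_neg (sg p t), ← sg_neg, sg_nonneg_eq hp1 h', abs_of_nonneg (by positivity),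
      abs_of_nonpos h]

lemma sg_mul_self {p t : ℝ} (hp1 : 1 < p) : sg p t * t = |t| ^ p := by
  have hkey : ∀ s : ℝ, 0 ≤ s → sg p s * s = s ^ p := by
    intro s hs
    rw [sg_nonneg_eq hp1 hs]
    rcases hs.eq_or_lt with h | h
    · rw [← h, Real.zero_rpow (by linarith : p ≠ 0)]; simp
    · nth_rewrite 2 [← Real.rpow_one s]
      rw [← Real.rpow_add h]; congr 1; ring
  rcases le_total 0 t with h | h
  · rw [abs_of_nonneg h]; exact hkey t h
  · have := hkey (-t) (by linarith)
    rw [sg_neg] at this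
    rw [abs_of_nonpos h, ← this]; ring

/-- tangent inequality for `|t|^p` -/
lemma abs_rpow_tangent {p : ℝ} (hp1 : 1 < p) (a b : ℝ) :
    |a| ^ p + p * sg p a * (b - a) ≤ |b| ^ p := by
  have h1 : sg p a * b ≤ |a| ^ (p - 1) * |b| := by
    calc sg p a * b ≤ |sg p a * b| := le_abs_self _
      _ = _ := by rw [abs_mul, abs_sg hp1]
  have h2 : p * (|a| ^ (p - 1) * |b|) ≤ (p - 1) * |a| ^ p + |b| ^ p := by
    rcases eq_or_ne a 0 with h | h
    · rw [h]
      simp only [abs_zero]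
      rw [Real.zero_rpow (by linarith), Real.zero_rpow (by linarith)]
      have : 0 ≤ |b| ^ p := by positivity
      simpa
    · have ha : 0 < |a| := abs_pos.2 h
      have hb := one_add_mul_self_le_rpow_one_add (s := |b| / |a| - 1)
        (by have : 0 ≤ |b| / |a| := by positivity
            linarith) hp1.le
      rw [add_sub_cancel, Real.div_rpow (abs_nonneg _) (abs_nonneg _)] at hb
      have hap : 0 < |a| ^ p := by positivity
      have h3 := mul_le_mul_of_nonneg_left hb hap.le
      rw [mul_div_cancel₀ _ hap.ne'] at h3
      have h4 : |a| ^ (p - 1) = |a| ^ p / |a| := by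
        rw [Real.rpow_sub ha, Real.rpow_one]
      rw [h4]
      have h5 : |a| ^ p * (1 + p * (|b| / |a| - 1)) =
          p * (|a| ^ p / |a| * |b|) - (p - 1) * |a| ^ p := by ring
      linarith
  have h3 := sg_mul_self (t := a) hp1
  have h4 : p * sg p a * (b - a) = p * (sg p a * b) - p * (sg p a * a) := by ring
  rw [h4, h3]
  have h5 : p * (sg p a * b) ≤ p * (|a| ^ (p - 1) * |b|) :=
    mul_le_mul_of_nonneg_left h1 (by linarith)
  linarith

lemma sg_holder {p : ℝ} (hp1 : 1 < p) (hp2 : p ≤ 2) (a b : ℝ) :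
    |sg p a - sg p b| ≤ 2 * |a - b| ^ (p - 1) := by
  have hr0 : 0 ≤ p - 1 := by linarith
  have hr1 : p - 1 ≤ 1 := by linarith
  -- both nonneg
  have c1 : ∀ a b : ℝ, 0 ≤ b → b ≤ a → |sg p a - sg p b| ≤ 2 * |a - b| ^ (p - 1) := by
    intro a b hb hab
    rw [sg_nonneg_eq hp1 hb, sg_nonneg_eq hp1 (hb.trans hab), abs_of_nonneg (sub_nonneg.2 hab),
      abs_of_nonneg (sub_nonneg.2 (Real.rpow_le_rpow hb hab hr0))]
    have := Real.rpow_add_le_add_rpow hb (sub_nonneg.2 hab) hr0 hr1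
    rw [add_sub_cancel] at this
    have h3 : 0 ≤ (a - b) ^ (p - 1) := Real.rpow_nonneg (sub_nonneg.2 hab) _
    linarith
  have c2 : ∀ a b : ℝ, 0 ≤ a → b ≤ 0 → |sg p a - sg p b| ≤ 2 * |a - b| ^ (p - 1) := by
    intro a b ha hb
    have e : sg p b = - (-b) ^ (p - 1) := by
      rw [← sg_nonneg_eq hp1 (by linarith : 0 ≤ -b), sg_neg]; ring
    rw [e, sg_nonneg_eq hp1 ha, abs_of_nonneg (by linarith : 0 ≤ a - b)]
    have h1 : a ^ (p - 1) ≤ (a - b) ^ (p - 1) := Real.rpow_le_rpow ha (by linarith) hr0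
    have h2 : (-b) ^ (p - 1) ≤ (a - b) ^ (p - 1) :=
      Real.rpow_le_rpow (by linarith) (by linarith) hr0
    have h3 : 0 ≤ a ^ (p - 1) := by positivity
    have h4 : 0 ≤ (-b) ^ (p - 1) := Real.rpow_nonneg (by linarith) _
    rw [abs_of_nonneg (by linarith)]
    linarith
  have c3 : ∀ a b : ℝ, b ≤ a → |sg p a - sg p b| ≤ 2 * |a - b| ^ (p - 1) := by
    intro a b hab
    rcases le_total 0 b with hb | hb
    · exact c1 a b hb hab
    · rcases le_total 0 a with ha | ha
      · exact c2 a b ha hb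
      · have := c1 (-b) (-a) (by linarith) (by linarith)
        rw [sg_neg, sg_neg] at this
        convert this using 2
        · ring_nf
        · ring_nf
  rcases le_total b a with h | h
  · exact c3 a b h
  · rw [abs_sub_comm, abs_sub_comm a b]; exact c3 b a h

lemma abs_rpow_upper {p : ℝ} (hp1 : 1 < p) (hp2 : p ≤ 2) (t h : ℝ) :
    |t + h| ^ p ≤ |t| ^ p + p * sg p t * h + 4 * |h| ^ p := by
  have h1 := abs_rpow_tangent hp1 (t + h) t
  have h2 := sg_holder hp1 hp2 (t + h) t
  rw [add_sub_cancel_left] at h2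
  have h3 : (sg p (t + h) - sg p t) * h ≤ 2 * |h| ^ p := by
    calc (sg p (t + h) - sg p t) * h ≤ |(sg p (t + h) - sg p t) * h| := le_abs_self _
      _ = |sg p (t + h) - sg p t| * |h| := abs_mul _ _
      _ ≤ 2 * |h| ^ (p - 1) * |h| := by gcongr
      _ = 2 * |h| ^ p := by
        rcases eq_or_ne h 0 with h0 | h0
        · rw [h0]; simp [Real.zero_rpow (by linarith : p ≠ 0)]
        · rw [Real.rpow_sub (abs_pos.2 h0), Real.rpow_one]
          have : |h| ≠ 0 := abs_ne_zero.2 h0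
          field_simp
  have h4 : 0 ≤ |h| ^ p := by positivity
  nlinarith

lemma abs_rpow_lip {p B : ℝ} (hp1 : 1 < p) {a b : ℝ} (ha : |a| ≤ B) (hb : |b| ≤ B) :
    |(|a| ^ p - |b| ^ p)| ≤ p * B ^ (p - 1) * |a - b| := by
  have key : ∀ a b : ℝ, |a| ≤ B → |a| ^ p - |b| ^ p ≤ p * B ^ (p - 1) * |a - b| := by
    intro a b ha
    have h1 := abs_rpow_tangent hp1 a b
    have h2 : sg p a * (a - b) ≤ B ^ (p - 1) * |a - b| := by
      calc sg p a * (a - b) ≤ |sg p a * (a - b)| := le_abs_self _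
        _ = |a| ^ (p - 1) * |a - b| := by rw [abs_mul, abs_sg hp1]
        _ ≤ _ := by
          gcongr
    nlinarith
  rw [abs_le]
  constructor
  · have := key b a hb
    rw [abs_sub_comm] at this; linarith
  · exact key a b ha

lemma sg_lower {p B : ℝ} (hp1 : 1 < p) (hp2 : p ≤ 2) (hB : 0 < B) {a b : ℝ}
    (ha : |a| ≤ B) (hb : |b| ≤ B) :
    |a - b| ≤ B ^ (2 - p) / (p - 1) * |sg p a - sg p b| := by
  have hr0 : 0 < p - 1 := by linarith
  have hr1 : p - 1 ≤ 1 := by linarith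
  -- it suffices: (p-1) B^(p-2) (a-b) ≤ sg a - sg b for b ≤ a
  have hpow : ∀ x : ℝ, 0 < x → x ≤ B → B ^ (p - 2) ≤ x ^ (p - 2) := by
    intro x hx hxB
    exact Real.rpow_le_rpow_of_nonpos hx hxB (by linarith)
  have hx1 : ∀ x : ℝ, 0 < x → x ^ (p - 1) = x ^ (p - 2) * x := by
    intro x hx
    nth_rewrite 3 [← Real.rpow_one x]
    rw [← Real.rpow_add hx]; congr 1; ring
  have c1 : ∀ a b : ℝ, 0 ≤ b → b ≤ a → a ≤ B →
      (p - 1) * B ^ (p - 2) * (a - b) ≤ sg p a - sg p b := by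
    intro a b hb hab haB
    rcases (hb.trans hab).eq_or_lt with h0 | h0
    · have : b = 0 := by linarith
      simp [← h0, this]
    have h1 := rpow_one_add_le_one_add_mul_self (s := b / a - 1)
      (by have : 0 ≤ b / a := by positivity
          linarith) hr0.le hr1
    rw [add_sub_cancel, Real.div_rpow hb h0.le] at h1
    have hap : 0 < a ^ (p - 1) := by positivity
    have h2 := mul_le_mul_of_nonneg_left h1 hap.le
    rw [mul_div_cancel₀ _ hap.ne'] at h2
    rw [sg_nonneg_eq hp1 hb, sg_nonneg_eq hp1 h0.le]
    have h3 : a ^ (p - 1) * (1 + (p - 1) * (b / a - 1))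
        = a ^ (p - 1) - (p - 1) * a ^ (p - 2) * (a - b) := by
      rw [hx1 a h0]; field_simp; ring
    have h4 : (p - 1) * B ^ (p - 2) * (a - b) ≤ (p - 1) * a ^ (p - 2) * (a - b) := by
      have := hpow a h0 haB
      have hab' : 0 ≤ a - b := by linarith
      gcongr
    linarith
  have c2 : ∀ a : ℝ, 0 ≤ a → a ≤ B → (p - 1) * B ^ (p - 2) * a ≤ sg p a := by
    intro a ha haB
    have := c1 a 0 le_rfl ha haB
    have h0 : sg p 0 = 0 := by simp [sg]
    rw [h0] at this; simpa using this
  have c3 : ∀ a b : ℝ, |a| ≤ B → |b| ≤ B → b ≤ a →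
      (p - 1) * B ^ (p - 2) * (a - b) ≤ sg p a - sg p b := by
    intro a b ha hb hab
    rw [abs_le] at ha hb
    rcases le_total 0 b with h | h
    · exact c1 a b h hab ha.2
    · rcases le_total 0 a with h' | h'
      · have e1 := c2 a h' ha.2
        have e2 := c2 (-b) (by linarith) (by linarith)
        rw [sg_neg] at e2
        linarith
      · have := c1 (-b) (-a) (by linarith) (by linarith) (by linarith)
        rw [sg_neg, sg_neg] at this
        linarith
  have c4 : (p - 1) * B ^ (p - 2) * |a - b| ≤ |sg p a - sg p b| := by
    rcases le_total b a with h | h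
    · rw [abs_of_nonneg (sub_nonneg.2 h)]
      exact (c3 a b ha hb h).trans (le_abs_self _)
    · rw [abs_sub_comm, abs_sub_comm (sg p a), abs_of_nonneg (sub_nonneg.2 h)]
      exact (c3 b a hb ha h).trans (le_abs_self _)
  have hBB : B ^ (2 - p) * B ^ (p - 2) = 1 := by
    rw [← Real.rpow_add hB]; simp
  have hB2 : 0 < B ^ (2 - p) := by positivity
  calc |a - b| = B ^ (2 - p) / (p - 1) * ((p - 1) * B ^ (p - 2) * |a - b|) := by
        field_simp
        rw [mul_assoc, hBB, mul_one]
    _ ≤ _ := by gcongr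

/-- regularised power -/
def rg (p ε t : ℝ) : ℝ := (t ^ 2 + ε ^ 2) ^ (p / 2)

lemma abs_rpow_eq_sq {p t : ℝ} : |t| ^ p = (t ^ 2) ^ (p / 2) := by
  rw [← sq_abs, ← Real.rpow_natCast, ← Real.rpow_mul (abs_nonneg t)]
  congr 1
  push_cast; ring

lemma le_rg {p ε t : ℝ} (hp : 0 < p) : |t| ^ p ≤ rg p ε t := by
  rw [abs_rpow_eq_sq, rg]
  gcongr
  nlinarith [sq_nonneg ε]

lemma rg_le {p ε t : ℝ} (hp : 0 < p) (hp2 : p ≤ 2) (hε : 0 ≤ ε) : rg p ε t ≤ |t| ^ p + ε ^ p := by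
  have := Real.rpow_add_le_add_rpow (sq_nonneg t) (sq_nonneg ε) (p := p / 2) (by linarith)
    (by linarith)
  rw [rg]
  refine this.trans ?_
  rw [← abs_rpow_eq_sq, ← abs_rpow_eq_sq, abs_of_nonneg hε]

lemma rg_semiconcave {p ε : ℝ} (hp : 0 < p) (hp2 : p ≤ 2) (hε : 0 < ε) (a b : ℝ) :
    (rg p ε a + rg p ε b) / 2 ≤ rg p ε ((a + b) / 2) + ε ^ (p - 2) * ((a - b) / 2) ^ 2 := by
  set m := (a + b) / 2 with hm
  set s := m ^ 2 + ε ^ 2 with hs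
  have hs0 : 0 < s := by positivity
  set D := (p / 2) * s ^ (p / 2 - 1) with hD
  have tan : ∀ x : ℝ, 0 ≤ x → x ^ (p / 2) ≤ s ^ (p / 2) + D * (x - s) := by
    intro x hx
    have h1 := rpow_one_add_le_one_add_mul_self (s := x / s - 1) (p := p / 2)
      (by have : 0 ≤ x / s := by positivity
          linarith) (by linarith) (by linarith)
    rw [add_sub_cancel, Real.div_rpow hx hs0.le] at h1
    have hap : 0 < s ^ (p / 2) := by positivity
    have h2 := mul_le_mul_of_nonneg_left h1 hap.le
    rw [mul_div_cancel₀ _ hap.ne'] at h2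
    refine h2.trans (le_of_eq ?_)
    rw [hD, Real.rpow_sub hs0, Real.rpow_one]
    field_simp
  have ha := tan (a ^ 2 + ε ^ 2) (by positivity)
  have hb := tan (b ^ 2 + ε ^ 2) (by positivity)
  have hDle : D ≤ ε ^ (p - 2) := by
    have h1 : s ^ (p / 2 - 1) ≤ (ε ^ 2) ^ (p / 2 - 1) :=
      Real.rpow_le_rpow_of_nonpos (by positivity) (by rw [hs]; nlinarith [sq_nonneg m])
        (by linarith)
    have h2 : (ε ^ 2) ^ (p / 2 - 1) = ε ^ (p - 2) := by
      rw [← Real.rpow_natCast, ← Real.rpow_mul hε.le]; congr 1; push_cast; ring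
    rw [h2] at h1
    have h3 : 0 < s ^ (p / 2 - 1) := by positivity
    rw [hD]; nlinarith
  have hmm : (a ^ 2 + ε ^ 2 - s) + (b ^ 2 + ε ^ 2 - s) = 2 * ((a - b) / 2) ^ 2 := by
    rw [hs, hm]; ring
  have hfin : D * ((a - b) / 2) ^ 2 ≤ ε ^ (p - 2) * ((a - b) / 2) ^ 2 := by gcongr
  simp only [rg]
  rw [← hs]
  have hsum : D * (a ^ 2 + ε ^ 2 - s) + D * (b ^ 2 + ε ^ 2 - s) = D * (2 * ((a - b) / 2) ^ 2) := by
    rw [← mul_add, hmm]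
  linarith


/-! ### Part 4: variance estimate from Prekopa-Leindler -/

lemma pl_compact {d : ℕ} {X : Set (Vec d)} (hX : IsCompact X) (hcv : Convex ℝ X)
    {u0 u1 um : Vec d → ℝ} (h0 : Continuous u0) (h1 : Continuous u1) (hm : Continuous um)
    (hmid : ∀ x ∈ X, ∀ y ∈ X, (u0 x + u1 y) / 2 ≤ um ((1 / 2 : ℝ) • (x + y))) :
    (∫ x in X, Real.exp (u0 x)) * (∫ x in X, Real.exp (u1 x)) ≤
      (∫ x in X, Real.exp (um x)) ^ 2 := by
  have hXm : MeasurableSet X := hX.measurableSet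
  have conv : ∀ u : Vec d → ℝ, Continuous u →
      ENNReal.ofReal (∫ x in X, Real.exp (u x)) =
        ∫⁻ x, X.indicator (fun x => ENNReal.ofReal (Real.exp (u x))) x := by
    intro u hu
    rw [lintegral_indicator hXm, ofReal_integral_eq_lintegral_ofReal]
    · exact (Real.continuous_exp.comp hu).continuousOn.integrableOn_compact hX
    · exact Filter.Eventually.of_forall fun x => (Real.exp_pos _).le
  have meas : ∀ u : Vec d → ℝ, Continuous u →
      Measurable (X.indicator (fun x => ENNReal.ofReal (Real.exp (u x)))) := by
    intro u hu
    exact Measurable.indicator (by fun_prop) hXm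
  have key := pl_vec d _ _ _ (meas u0 h0) (meas u1 h1) (meas um hm) (by
    intro x y
    by_cases hx : x ∈ X
    · by_cases hy : y ∈ X
      · have hxy : (1 / 2 : ℝ) • (x + y) ∈ X := by
          rw [smul_add]
          exact hcv hx hy (by norm_num) (by norm_num) (by norm_num)
        rw [Set.indicator_of_mem hx, Set.indicator_of_mem hy, Set.indicator_of_mem hxy,
          ← ENNReal.ofReal_mul (Real.exp_pos _).le, ← ENNReal.ofReal_pow (Real.exp_pos _).le]
        apply ENNReal.ofReal_le_ofReal
        rw [← Real.exp_add, ← Real.exp_nat_mul]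
        apply Real.exp_le_exp.2
        have := hmid x hx y hy
        push_cast
        linarith
      · simp [hy]
    · simp [hx])
  have nn : ∀ u : Vec d → ℝ, 0 ≤ ∫ x in X, Real.exp (u x) := fun u =>
    integral_nonneg fun x => (Real.exp_pos _).le
  rw [← conv u0 h0, ← conv u1 h1, ← conv um hm, ← ENNReal.ofReal_mul (nn _),
    ← ENNReal.ofReal_pow (nn _)] at key
  exact (ENNReal.ofReal_le_ofReal_iff (by positivity)).1 key

lemma exp_sub_sq_lower {a b m : ℝ} (ha : m ≤ a) (hb : m ≤ b) :
    Real.exp m ^ 2 * (a - b) ^ 2 ≤ (Real.exp a - Real.exp b) ^ 2 := by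
  have key : ∀ a b : ℝ, m ≤ b → b ≤ a → Real.exp m * (a - b) ≤ Real.exp a - Real.exp b := by
    intro a b hb hab
    have h1 : Real.exp a = Real.exp b * Real.exp (a - b) := by rw [← Real.exp_add]; congr 1; ring
    have h2 := Real.add_one_le_exp (a - b)
    have h3 : Real.exp m ≤ Real.exp b := Real.exp_le_exp.2 hb
    have h4 : 0 ≤ a - b := by linarith
    calc Real.exp m * (a - b) ≤ Real.exp b * (a - b) := by gcongr
      _ ≤ Real.exp b * (Real.exp (a - b) - 1) := mul_le_mul_of_nonneg_left (by linarith) (Real.exp_pos b).le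
      _ = _ := by rw [h1]; ring
  have hm := Real.exp_pos m
  rw [← mul_pow]
  rcases le_total b a with h | h
  · exact pow_le_pow_left₀ (mul_nonneg hm.le (by linarith)) (key a b hb h) 2
  · have := pow_le_pow_left₀ (mul_nonneg hm.le (by linarith)) (key b a ha h) 2
    nlinarith

lemma variance_lemma {d : ℕ} {X : Set (Vec d)} (hX : IsCompact X) (hcv : Convex ℝ X)
    (hV : 0 < volume.real X) {M : ℝ}
    {u0 u1 um : Vec d → ℝ} (h0 : Continuous u0) (h1 : Continuous u1) (hm : Continuous um)
    (b0 : ∀ x ∈ X, |u0 x| ≤ M) (b1 : ∀ x ∈ X, |u1 x| ≤ M) (bm : ∀ x ∈ X, |um x| ≤ M)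
    (hmid : ∀ x ∈ X, ∀ y ∈ X, (u0 x + u1 y) / 2 ≤ um ((1 / 2 : ℝ) • (x + y))) :
    ∃ k : ℝ, ∫ x in X, (u0 x - u1 x - k) ^ 2 ≤
      8 * Real.exp (4 * M) * ∫ x in X, (um x - (u0 x + u1 x) / 2) := by
  have hXm : MeasurableSet X := hX.measurableSet
  have hItg : ∀ f : Vec d → ℝ, Continuous f → IntegrableOn f X := fun f hf =>
    hf.continuousOn.integrableOn_compact hX
  have hXf : volume X ≠ ∞ := hX.measure_lt_top.ne
  set V := volume.real X with hVdef
  have bounds : ∀ u : Vec d → ℝ, Continuous u → (∀ x ∈ X, |u x| ≤ M) →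
      Real.exp (-M) * V ≤ ∫ x in X, Real.exp (u x) ∧
        ∫ x in X, Real.exp (u x) ≤ Real.exp M * V := by
    intro u hu hb
    have hc : ∀ c : ℝ, ∫ x in X, c = c * V := by
      intro c; rw [setIntegral_const, smul_eq_mul, mul_comm]
    rw [← hc, ← hc]
    constructor
    · apply setIntegral_mono_on (hItg _ continuous_const) (hItg _ (by fun_prop)) hXm
      intro x hx
      exact Real.exp_le_exp.2 (abs_le.1 (hb x hx)).1
    · apply setIntegral_mono_on (hItg _ (by fun_prop)) (hItg _ continuous_const) hXm
      intro x hx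
      exact Real.exp_le_exp.2 (abs_le.1 (hb x hx)).2
  obtain ⟨l0, r0⟩ := bounds u0 h0 b0
  obtain ⟨l1, r1⟩ := bounds u1 h1 b1
  have hpl := pl_compact hX hcv h0 h1 hm hmid
  set A0 := ∫ x in X, Real.exp (u0 x) with hA0
  set A1 := ∫ x in X, Real.exp (u1 x) with hA1
  set Am := ∫ x in X, Real.exp (um x) with hAm
  have hA0p : 0 < A0 := lt_of_lt_of_le (by positivity) l0
  have hA1p : 0 < A1 := lt_of_lt_of_le (by positivity) l1
  have hAm0 : 0 ≤ Am := integral_nonneg fun x => (Real.exp_pos _).le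
  set G := Real.exp ((Real.log A0 + Real.log A1) / 2) with hG
  have hGp : 0 < G := Real.exp_pos _
  have hG2 : G ^ 2 = A0 * A1 := by
    rw [hG, ← Real.exp_nat_mul]
    push_cast
    rw [mul_div_cancel₀ _ (by norm_num : (2 : ℝ) ≠ 0), Real.exp_add, Real.exp_log hA0p,
      Real.exp_log hA1p]
  have hGAm : G ≤ Am := by
    apply le_of_sq_le_sq _ hAm0
    rw [hG2]; exact hpl
  have hGlow : Real.exp (-M) * V ≤ G := by
    apply le_of_sq_le_sq _ hGp.le
    rw [hG2, sq]
    gcongr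
  set a : Vec d → ℝ := fun x => (u0 x - Real.log A0) / 2 with ha
  set b : Vec d → ℝ := fun x => (u1 x - Real.log A1) / 2 with hb
  have hac : Continuous a := by rw [ha]; fun_prop
  have hbc : Continuous b := by rw [hb]; fun_prop
  have ea : ∀ x, Real.exp (a x) ^ 2 = Real.exp (u0 x) * A0⁻¹ := by
    intro x
    rw [← Real.exp_nat_mul, ha]
    push_cast
    rw [mul_div_cancel₀ _ (by norm_num : (2 : ℝ) ≠ 0), Real.exp_sub, Real.exp_log hA0p]
    rfl
  have eb : ∀ x, Real.exp (b x) ^ 2 = Real.exp (u1 x) * A1⁻¹ := by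
    intro x
    rw [← Real.exp_nat_mul, hb]
    push_cast
    rw [mul_div_cancel₀ _ (by norm_num : (2 : ℝ) ≠ 0), Real.exp_sub, Real.exp_log hA1p]
    rfl
  have eab : ∀ x, Real.exp (a x) * Real.exp (b x) = Real.exp ((u0 x + u1 x) / 2) * G⁻¹ := by
    intro x
    rw [← Real.exp_add, hG, ← Real.exp_neg, ← Real.exp_add]
    congr 1
    simp only [ha, hb]; ring
  have hsq : ∫ x in X, (Real.exp (a x) - Real.exp (b x)) ^ 2 =
      2 - 2 * G⁻¹ * ∫ x in X, Real.exp ((u0 x + u1 x) / 2) := by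
    have e1 : ∀ x, (Real.exp (a x) - Real.exp (b x)) ^ 2 =
        Real.exp (u0 x) * A0⁻¹ + Real.exp (u1 x) * A1⁻¹
          - 2 * G⁻¹ * Real.exp ((u0 x + u1 x) / 2) := by
      intro x
      rw [← ea, ← eb]
      have := eab x
      linear_combination (-2) * this
    simp_rw [e1]
    rw [integral_sub, integral_add, integral_mul_const, integral_mul_const, integral_const_mul,
      mul_inv_cancel₀ hA0p.ne', mul_inv_cancel₀ hA1p.ne']
    · ring
    · exact hItg _ (by fun_prop)
    · exact hItg _ (by fun_prop)
    · exact hItg _ (by fun_prop)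
    · exact hItg _ (by fun_prop)
  have hup : ∫ x in X, (Real.exp (a x) - Real.exp (b x)) ^ 2 ≤
      2 * G⁻¹ * (Real.exp M * ∫ x in X, (um x - (u0 x + u1 x) / 2)) := by
    have h2 : Am - ∫ x in X, Real.exp ((u0 x + u1 x) / 2) ≤
        Real.exp M * ∫ x in X, (um x - (u0 x + u1 x) / 2) := by
      rw [hAm, ← integral_sub (hItg _ (by fun_prop)) (hItg _ (by fun_prop)), ← integral_const_mul]
      apply setIntegral_mono_on (hItg _ (by fun_prop)) (hItg _ (by fun_prop)) hXm
      intro x hx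
      have hs := hmid x hx x hx
      rw [← two_smul ℝ x, smul_smul] at hs
      norm_num at hs
      have hMx := (abs_le.1 (bm x hx)).2
      have t1 := Real.add_one_le_exp ((u0 x + u1 x) / 2 - um x)
      have t2 : Real.exp ((u0 x + u1 x) / 2) =
          Real.exp (um x) * Real.exp ((u0 x + u1 x) / 2 - um x) := by
        rw [← Real.exp_add]; congr 1; ring
      rw [t2]
      have t3 : Real.exp (um x) ≤ Real.exp M := Real.exp_le_exp.2 hMx
      have t4 := Real.exp_pos (um x)
      have t5 : 0 ≤ um x - (u0 x + u1 x) / 2 := by linarith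
      calc Real.exp (um x) - Real.exp (um x) * Real.exp ((u0 x + u1 x) / 2 - um x)
          = Real.exp (um x) * (1 - Real.exp ((u0 x + u1 x) / 2 - um x)) := by ring
        _ ≤ Real.exp (um x) * (um x - (u0 x + u1 x) / 2) :=
            mul_le_mul_of_nonneg_left (by linarith) t4.le
        _ ≤ _ := by gcongr
    rw [hsq]
    have h3 : 2 ≤ 2 * G⁻¹ * Am := by
      have : 1 ≤ G⁻¹ * Am := by
        rw [inv_mul_eq_div, le_div_iff₀ hGp]; linarith
      linarith
    calc 2 - 2 * G⁻¹ * ∫ x in X, Real.exp ((u0 x + u1 x) / 2)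
        ≤ 2 * G⁻¹ * (Am - ∫ x in X, Real.exp ((u0 x + u1 x) / 2)) := by linarith
      _ ≤ _ := by gcongr
  set I := ∫ x in X, (um x - (u0 x + u1 x) / 2) with hI
  have hI0 : 0 ≤ I := by
    apply setIntegral_nonneg hXm
    intro x hx
    have hs := hmid x hx x hx
    rw [← two_smul ℝ x, smul_smul] at hs
    norm_num at hs
    linarith
  -- lower bound
  set m := -M - Real.log V / 2 with hmdef
  have hlogu : ∀ A : ℝ, 0 < A → A ≤ Real.exp M * V → Real.log A ≤ M + Real.log V := by
    intro A hA hAl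
    have := Real.log_le_log hA hAl
    rwa [Real.log_mul (Real.exp_pos _).ne' hV.ne', Real.log_exp] at this
  have hL0 := hlogu A0 hA0p r0
  have hL1 := hlogu A1 hA1p r1
  have hexpm : Real.exp m ^ 2 = Real.exp (-(2 * M)) * V⁻¹ := by
    rw [← Real.exp_nat_mul, hmdef]
    have : ((2 : ℕ) : ℝ) * (-M - Real.log V / 2) = -(2 * M) - Real.log V := by push_cast; ring
    rw [this, Real.exp_sub, Real.exp_log hV]; rfl
  refine ⟨Real.log A0 - Real.log A1, ?_⟩
  have hlow : Real.exp m ^ 2 / 4 * ∫ x in X, (u0 x - u1 x - (Real.log A0 - Real.log A1)) ^ 2 ≤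
      ∫ x in X, (Real.exp (a x) - Real.exp (b x)) ^ 2 := by
    rw [← integral_const_mul]
    apply setIntegral_mono_on (hItg _ (by fun_prop)) (hItg _ (by fun_prop)) hXm
    intro x hx
    have q0 := (abs_le.1 (b0 x hx)).1
    have q1 := (abs_le.1 (b1 x hx)).1
    have := exp_sub_sq_lower (a := a x) (b := b x) (m := m) (by simp only [ha, hmdef]; linarith)
      (by simp only [hb, hmdef]; linarith)
    refine le_trans (le_of_eq ?_) this
    simp only [ha, hb]; ring
  have hfin := hlow.trans hup
  rw [hexpm] at hfin
  have hGinv : G⁻¹ ≤ Real.exp M * V⁻¹ := by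
    have := inv_anti₀ (by positivity) hGlow
    rwa [mul_inv, Real.exp_neg, inv_inv] at this
  set J := ∫ x in X, (u0 x - u1 x - (Real.log A0 - Real.log A1)) ^ 2 with hJ
  have hfin2 : Real.exp (-(2 * M)) * V⁻¹ / 4 * J ≤ 2 * (Real.exp M * V⁻¹) * (Real.exp M * I) :=
    hfin.trans (by gcongr)
  have e1 : Real.exp (-(2 * M)) * Real.exp (2 * M) = 1 := by rw [← Real.exp_add]; simp
  have e2 : Real.exp M * Real.exp M = Real.exp (2 * M) := by rw [← Real.exp_add]; congr 1; ring
  have e3 : Real.exp (2 * M) * Real.exp (2 * M) = Real.exp (4 * M) := by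
    rw [← Real.exp_add]; congr 1; ring
  have hmul := mul_le_mul_of_nonneg_left hfin2 (by positivity : 0 ≤ 4 * Real.exp (2 * M) * V)
  have el : 4 * Real.exp (2 * M) * V * (Real.exp (-(2 * M)) * V⁻¹ / 4 * J) = J := by
    calc _ = (Real.exp (-(2 * M)) * Real.exp (2 * M)) * (V * V⁻¹) * J := by ring
      _ = J := by rw [e1, mul_inv_cancel₀ hV.ne']; ring
  have er : 4 * Real.exp (2 * M) * V * (2 * (Real.exp M * V⁻¹) * (Real.exp M * I)) =
      8 * Real.exp (4 * M) * I := by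
    calc _ = 8 * (Real.exp (2 * M) * (Real.exp M * Real.exp M)) * (V * V⁻¹) * I := by ring
      _ = _ := by rw [e2, e3, mul_inv_cancel₀ hV.ne']; ring
  rw [el, er] at hmul
  exact hmul


/-! ### Part 5: costs, c-transforms, potentials -/

/-- regularised cost -/
def cst (p ε : ℝ) {d : ℕ} (x y : Vec d) : ℝ := ∑ i, rg p ε (x i - y i)

lemma rg_zero (p t : ℝ) : rg p 0 t = |t| ^ p := by
  rw [abs_rpow_eq_sq, rg]; simp

lemma rg_continuous {p : ℝ} (hp : 0 < p) (ε : ℝ) : Continuous (rg p ε) := by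
  unfold rg
  exact (by fun_prop : Continuous fun t : ℝ => t ^ 2 + ε ^ 2).rpow_const
    (fun x => Or.inr (by linarith))

lemma cst_cont {p : ℝ} (hp : 0 < p) (ε : ℝ) {d : ℕ} {Z : Type*} [TopologicalSpace Z]
    {f g : Z → Vec d} (hf : Continuous f) (hg : Continuous g) :
    Continuous fun z => cst p ε (f z) (g z) := by
  unfold cst
  refine continuous_finsetSum _ fun i _ => ?_
  exact (rg_continuous hp ε).comp (((continuous_apply i).comp hf).sub ((continuous_apply i).comp hg))

attribute [irreducible] cst

lemma cst_comm (p ε : ℝ) {d : ℕ} (x y : Vec d) : cst p ε x y = cst p ε y x := by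
  unfold cst rg
  refine Finset.sum_congr rfl fun i _ => ?_
  congr 1; ring

lemma lpDist_rpow {p : ℝ} (hp : 0 < p) {d : ℕ} (x y : Vec d) :
    lpDist p x y ^ p = cst p 0 x y := by
  unfold lpDist cst
  rw [← Real.rpow_mul (Finset.sum_nonneg fun i _ => by positivity), one_div,
    inv_mul_cancel₀ hp.ne', Real.rpow_one]
  exact Finset.sum_congr rfl fun i _ => (rg_zero p _).symm

lemma lpDist_eq {p : ℝ} {d : ℕ} (x y : Vec d) :
    lpDist p x y = (cst p 0 x y) ^ (1 / p) := by
  unfold lpDist cst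
  congr 1
  exact Finset.sum_congr rfl fun i _ => (rg_zero p _).symm

lemma cst_nonneg {p ε : ℝ} {d : ℕ} (x y : Vec d) : 0 ≤ cst p ε x y := by
  unfold cst
  exact Finset.sum_nonneg fun i _ => by unfold rg; positivity

lemma lpDist_nonneg {p : ℝ} {d : ℕ} (x y : Vec d) : 0 ≤ lpDist p x y := by
  rw [lpDist_eq]; exact Real.rpow_nonneg (cst_nonneg _ _) _

lemma abs_le_lpDist {p : ℝ} (hp : 0 < p) {d : ℕ} (x y : Vec d) (i : Fin d) :
    |x i - y i| ≤ lpDist p x y := by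
  have h : |x i - y i| ^ p ≤ lpDist p x y ^ p := by
    rw [lpDist_rpow hp, ← rg_zero, cst]
    exact Finset.single_le_sum (f := fun i => rg p 0 (x i - y i))
      (fun j _ => by unfold rg; positivity) (Finset.mem_univ i)
  exact (Real.rpow_le_rpow_iff (abs_nonneg _) (lpDist_nonneg _ _) hp).1 h

/-- c-transform over a compact set -/
def ctr {d : ℕ} {K : Type*} (k : Vec d → K → ℝ) (ψ : K → ℝ) (x : Vec d) : ℝ :=
  sInf ((fun y => k x y - ψ y) '' Set.univ)

section ctr
set_option linter.unusedSectionVars false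
variable {d : ℕ} {K : Type*} [TopologicalSpace K] [CompactSpace K] [Nonempty K]
  {k : Vec d → K → ℝ} {ψ : K → ℝ}

lemma ctr_continuous (hk : Continuous (fun z : Vec d × K => k z.1 z.2)) (hψ : Continuous ψ) :
    Continuous (ctr k ψ) := by
  unfold ctr
  apply IsCompact.continuous_sInf isCompact_univ
  exact hk.sub (hψ.comp continuous_snd)

lemma ctr_exists (hk : Continuous (fun z : Vec d × K => k z.1 z.2)) (hψ : Continuous ψ)
    (x : Vec d) : ∃ y, ctr k ψ x = k x y - ψ y ∧ ∀ y', ctr k ψ x + ψ y' ≤ k x y' := by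
  have hc : Continuous fun y => k x y - ψ y :=
    (hk.comp (by fun_prop : Continuous fun y : K => (x, y))).sub hψ
  obtain ⟨y, -, h1, h2⟩ := (isCompact_univ (X := K)).exists_sInf_image_eq_and_le
    Set.univ_nonempty hc.continuousOn
  refine ⟨y, h1, fun y' => ?_⟩
  have := h2 y' (Set.mem_univ _)
  unfold ctr
  rw [h1]; linarith

lemma ctr_le (hk : Continuous (fun z : Vec d × K => k z.1 z.2)) (hψ : Continuous ψ)
    (x : Vec d) (y : K) : ctr k ψ x + ψ y ≤ k x y := by
  obtain ⟨_, _, h⟩ := ctr_exists hk hψ x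
  exact h y

lemma le_ctr (hk : Continuous (fun z : Vec d × K => k z.1 z.2)) (hψ : Continuous ψ)
    {x : Vec d} {a : ℝ} (h : ∀ y, a + ψ y ≤ k x y) : a ≤ ctr k ψ x := by
  obtain ⟨y, hy, _⟩ := ctr_exists hk hψ x
  have := h y
  linarith

end ctr

/-- Lipschitz estimate for the cost. -/
lemma cst_lip {p R : ℝ} (hp1 : 1 < p) {d : ℕ} {X : Set (Vec d)}
    (hR : ∀ x ∈ X, ∀ y ∈ X, ∀ i, |x i - y i| ≤ R) {x x' y : Vec d} (hx : x ∈ X) (hx' : x' ∈ X)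
    (hy : y ∈ X) : cst p 0 x y ≤ cst p 0 x' y + p * R ^ (p - 1) * ∑ i, |x i - x' i| := by
  unfold cst
  rw [Finset.mul_sum, ← Finset.sum_add_distrib]
  apply Finset.sum_le_sum
  intro i _
  rw [rg_zero, rg_zero]
  have h := (abs_le.1 (abs_rpow_lip hp1 (hR x hx y hy i) (hR x' hx' y hy i))).2
  have e : x i - y i - (x' i - y i) = x i - x' i := by ring
  rw [e] at h
  linarith

lemma cst_le {p R : ℝ} (hp : 0 < p) {d : ℕ} {X : Set (Vec d)}
    (hR : ∀ x ∈ X, ∀ y ∈ X, ∀ i, |x i - y i| ≤ R) {x y : Vec d} (hx : x ∈ X)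
    (hy : y ∈ X) : cst p 0 x y ≤ d * R ^ p := by
  unfold cst
  calc ∑ i, rg p 0 (x i - y i) ≤ ∑ i : Fin d, R ^ p := by
        apply Finset.sum_le_sum
        intro i _
        rw [rg_zero]
        exact Real.rpow_le_rpow (abs_nonneg _) (hR x hx y hy i) hp.le
    _ = _ := by simp

/-- the cost restricted in second variable to `X` -/
def cX (p ε : ℝ) {d : ℕ} (X : Set (Vec d)) (x : Vec d) (y : X) : ℝ := cst p ε x y

lemma cX_continuous {p : ℝ} (hp : 0 < p) (ε : ℝ) {d : ℕ} (X : Set (Vec d)) :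
    Continuous fun z : Vec d × X => cX p ε X z.1 z.2 :=
  cst_cont hp ε continuous_fst (continuous_subtype_val.comp continuous_snd)

/-- bound for the potentials -/
def Mb (p R : ℝ) (d : ℕ) : ℝ := d * R ^ p + p * R ^ (p - 1) * (d * R)

/-- a pair of good Kantorovich potentials -/
structure Pot (p R : ℝ) {d : ℕ} (X : Set (Vec d)) (φ ψ : Vec d → ℝ) : Prop where
  cφ : Continuous φ
  cψ : Continuous ψ
  eq : φ = ctr (cX p 0 X) (fun y : X => ψ y)
  le : ∀ x, ∀ y ∈ X, φ x + ψ y ≤ cst p 0 x y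
  lψ : ∀ y ∈ X, ∀ y' ∈ X, ψ y - ψ y' ≤ p * R ^ (p - 1) * ∑ i, |y i - y' i|
  lφ : ∀ y ∈ X, ∀ y' ∈ X, φ y - φ y' ≤ p * R ^ (p - 1) * ∑ i, |y i - y' i|
  bψ : ∀ y ∈ X, |ψ y| ≤ Mb p R d
  bφ : ∀ y ∈ X, |φ y| ≤ Mb p R d

lemma sum_abs_le {R : ℝ} {d : ℕ} {X : Set (Vec d)}
    (hR : ∀ x ∈ X, ∀ y ∈ X, ∀ i, |x i - y i| ≤ R) {x y : Vec d} (hx : x ∈ X)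
    (hy : y ∈ X) : ∑ i, |x i - y i| ≤ d * R := by
  calc ∑ i, |x i - y i| ≤ ∑ i : Fin d, R := Finset.sum_le_sum fun i _ => hR x hx y hy i
    _ = _ := by simp

lemma ctr_lip {p R : ℝ} (hp1 : 1 < p) {d : ℕ} {X : Set (Vec d)} [Nonempty X] [CompactSpace X]
    (hR : ∀ x ∈ X, ∀ y ∈ X, ∀ i, |x i - y i| ≤ R) {ψ : X → ℝ} (hψ : Continuous ψ)
    {x x' : Vec d} (hx : x ∈ X) (hx' : x' ∈ X) :
    ctr (cX p 0 X) ψ x - ctr (cX p 0 X) ψ x' ≤ p * R ^ (p - 1) * ∑ i, |x i - x' i| := by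
  have hk := cX_continuous (by linarith : 0 < p) 0 X
  obtain ⟨y, hy, _⟩ := ctr_exists hk hψ x'
  have h1 := ctr_le hk hψ x y
  have h2 := cst_lip hp1 hR hx hx' y.2
  unfold cX at *
  linarith

/-- From any admissible pair build a good one that is at least as good (up to a constant). -/
lemma exists_pot {p R : ℝ} (hp1 : 1 < p) (hR0 : 0 < R) {d : ℕ} {X : Set (Vec d)} (hXc : IsCompact X)
    (hXn : X.Nonempty)
    (hR : ∀ x ∈ X, ∀ y ∈ X, ∀ i, |x i - y i| ≤ R) {φ0 ψ0 : X → ℝ} (hφ : Continuous φ0)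
    (h : ∀ x y : X, φ0 x + ψ0 y ≤ cst p 0 (x : Vec d) y) :
    ∃ φ ψ : Vec d → ℝ, ∃ k : ℝ, Pot p R X φ ψ ∧ (∀ x : X, φ0 x - k ≤ φ x) ∧
      (∀ y : X, ψ0 y + k ≤ ψ y) := by
  have hp : 0 < p := by linarith
  have : Nonempty X := hXn.to_subtype
  have : CompactSpace X := isCompact_iff_compactSpace.1 hXc
  have hk := cX_continuous hp 0 X
  obtain ⟨x0, hx0⟩ := hXn
  set ψ1 := ctr (cX p 0 X) φ0 with hψ1
  have cψ1 : Continuous ψ1 := ctr_continuous hk hφ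
  set k := - ψ1 x0 with hkdef
  set ψ : Vec d → ℝ := fun y => ψ1 y + k with hψ
  have cψ : Continuous ψ := by rw [hψ]; fun_prop
  have cψ' : Continuous fun y : X => ψ y := by fun_prop
  set φ := ctr (cX p 0 X) (fun y : X => ψ y) with hφdef
  have cφ : Continuous φ := ctr_continuous hk cψ'
  have hRp : 0 ≤ p * R ^ (p - 1) := by positivity
  have lψ : ∀ y ∈ X, ∀ y' ∈ X, ψ y - ψ y' ≤ p * R ^ (p - 1) * ∑ i, |y i - y' i| := by
    intro y hy y' hy'
    have := ctr_lip hp1 hR hφ hy hy'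
    simp only [hψ, hψ1]; linarith
  have lφ : ∀ y ∈ X, ∀ y' ∈ X, φ y - φ y' ≤ p * R ^ (p - 1) * ∑ i, |y i - y' i| := by
    intro y hy y' hy'
    exact ctr_lip hp1 hR cψ' hy hy'
  have bψ' : ∀ y ∈ X, |ψ y| ≤ p * R ^ (p - 1) * (d * R) := by
    intro y hy
    have h0 : ψ x0 = 0 := by simp [hψ, hkdef]
    have h1 := lψ y hy x0 hx0
    have h2 := lψ x0 hx0 y hy
    have h3 := mul_le_mul_of_nonneg_left (sum_abs_le hR hy hx0) hRp
    have h4 := mul_le_mul_of_nonneg_left (sum_abs_le hR hx0 hy) hRp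
    rw [abs_le]; constructor <;> linarith
  have hdR : 0 ≤ d * R ^ p := by positivity
  refine ⟨φ, ψ, k, ⟨cφ, cψ, rfl, ?_, lψ, lφ, ?_, ?_⟩, ?_, ?_⟩
  · intro x y hy
    exact ctr_le hk cψ' x ⟨y, hy⟩
  · intro y hy
    have := bψ' y hy
    unfold Mb; linarith
  · intro x hx
    unfold Mb
    obtain ⟨y, hy, _⟩ := ctr_exists hk cψ' x
    have h1 : φ x = cst p 0 x y - ψ y := hy
    have h2 := cst_nonneg (p := p) (ε := 0) x (y : Vec d)
    have h3 := cst_le hp hR hx y.2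
    have h4 := abs_le.1 (bψ' y y.2)
    rw [h1, abs_le]; constructor <;> linarith
  · intro x
    apply le_ctr hk cψ'
    intro y
    have := ctr_le hk hφ (y : Vec d) x
    have e := cst_comm p 0 (y : Vec d) x
    simp only [hψ, hψ1]
    unfold cX at *
    linarith
  · intro y
    have : ψ0 y ≤ ψ1 y := by
      apply le_ctr hk hφ
      intro x
      have := h x y
      unfold cX
      rw [cst_comm]; linarith
    simp only [hψ]; linarith

lemma int_of_cont {E : Type*} [TopologicalSpace E] [T2Space E] [MeasurableSpace E] [BorelSpace E]
    {μ : Measure E} {X : Set E} (hX : IsCompact X) [IsFiniteMeasure μ]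
    (h : μ Xᶜ = 0) {f : E → ℝ} (hf : ContinuousOn f X) : Integrable f μ := by
  have : μ.restrict X = μ := Measure.restrict_eq_self_of_ae_mem (by
    rw [ae_iff]; exact h)
  rw [← this]
  exact hf.integrableOn_compact' hX hX.measurableSet

lemma coupling_conc {E : Type*} [MeasurableSpace E] {γ : Measure (E × E)} {α β : Measure E}
    (h : IsCoupling γ α β) {X : Set E} (hX : MeasurableSet X) (hα : α Xᶜ = 0) (hβ : β Xᶜ = 0) :
    γ (X ×ˢ X)ᶜ = 0 := by
  have h1 : γ (Prod.fst ⁻¹' Xᶜ) = 0 := by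
    rw [← Measure.map_apply measurable_fst hX.compl, h.2.1]; exact hα
  have h2 : γ (Prod.snd ⁻¹' Xᶜ) = 0 := by
    rw [← Measure.map_apply measurable_snd hX.compl, h.2.2]; exact hβ
  refine measure_mono_null ?_ (measure_union_null h1 h2)
  intro z hz
  simp only [Set.mem_compl_iff, Set.mem_prod, not_and_or] at hz
  exact hz

lemma coupling_int {d : ℕ} {γ : Measure (Vec d × Vec d)} {α β : Measure (Vec d)} 
    (h : IsCoupling γ α β) {X : Set (Vec d)} (hX : IsCompact X) (hα : ProbOn α X)
    (hβ : ProbOn β X) {f : Vec d × Vec d → ℝ} (hf : Continuous f) : Integrable f γ := by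
  have := h.1
  exact int_of_cont (hX.prod hX) (coupling_conc h hX.measurableSet hα.2 hβ.2) hf.continuousOn

lemma coupling_fst {d : ℕ} {γ : Measure (Vec d × Vec d)} {α β : Measure (Vec d)} 
    (h : IsCoupling γ α β) {f : Vec d → ℝ} (hf : Continuous f) :
    ∫ z, f z.1 ∂γ = ∫ x, f x ∂α := by
  rw [← h.2.1, integral_map measurable_fst.aemeasurable hf.aestronglyMeasurable]

lemma coupling_snd {d : ℕ} {γ : Measure (Vec d × Vec d)} {α β : Measure (Vec d)} 
    (h : IsCoupling γ α β) {f : Vec d → ℝ} (hf : Continuous f) :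
    ∫ z, f z.2 ∂γ = ∫ x, f x ∂β := by
  rw [← h.2.2, integral_map measurable_snd.aemeasurable hf.aestronglyMeasurable]

/-- integral of the slack -/
lemma slack_int {p : ℝ} (hp1 : 1 < p) {d : ℕ} {X : Set (Vec d)} (hXc : IsCompact X)
    {μ ρ : Measure (Vec d)} (hμ : ProbOn μ X) (hρ : ProbOn ρ X) {γ : Measure (Vec d × Vec d)}
    (hγ : IsCoupling γ μ ρ) {φ ψ : Vec d → ℝ} (cφ : Continuous φ) (cψ : Continuous ψ) :
    ∫ z, (cst p 0 z.2 z.1 - φ z.2 - ψ z.1) ∂γ =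
      ∫ z, cst p 0 z.2 z.1 ∂γ - ∫ x, φ x ∂ρ - ∫ y, ψ y ∂μ := by
  have hc : Continuous fun z : Vec d × Vec d => cst p 0 z.2 z.1 :=
    cst_cont (by linarith : 0 < p) 0 continuous_snd continuous_fst
  have h1 : Continuous fun z : Vec d × Vec d => φ z.2 := cφ.comp continuous_snd
  have h2 : Continuous fun z : Vec d × Vec d => ψ z.1 := cψ.comp continuous_fst
  rw [integral_sub, integral_sub, coupling_fst hγ cψ, coupling_snd hγ cφ]
  · exact coupling_int hγ hXc hμ hρ hc
  · exact coupling_int hγ hXc hμ hρ h1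
  · exact coupling_int hγ hXc hμ hρ (hc.sub h1)
  · exact coupling_int hγ hXc hμ hρ h2

lemma weak_duality {p : ℝ} (hp1 : 1 < p) {d : ℕ} {X : Set (Vec d)} (hXc : IsCompact X)
    {μ ρ : Measure (Vec d)} (hμ : ProbOn μ X) (hρ : ProbOn ρ X) {γ : Measure (Vec d × Vec d)}
    (hγ : IsCoupling γ μ ρ) {φ ψ : Vec d → ℝ} (cφ : Continuous φ) (cψ : Continuous ψ)
    (hle : ∀ x, ∀ y ∈ X, φ x + ψ y ≤ cst p 0 x y) :
    ∫ x, φ x ∂ρ + ∫ y, ψ y ∂μ ≤ ∫ z, cst p 0 z.2 z.1 ∂γ := by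
  have h := slack_int hp1 hXc hμ hρ hγ cφ cψ
  have h2 : 0 ≤ ∫ z, (cst p 0 z.2 z.1 - φ z.2 - ψ z.1) ∂γ := by
    apply integral_nonneg_of_ae
    have := coupling_conc hγ hXc.measurableSet hμ.2 hρ.2
    have h3 : ∀ᵐ z ∂γ, z ∈ X ×ˢ X := by rw [ae_iff]; exact this
    filter_upwards [h3] with z hz
    have := hle z.2 z.1 hz.1
    simp only [Pi.zero_apply]
    linarith
  linarith

lemma exists_opt {p R : ℝ} (hp1 : 1 < p) (hR0 : 0 < R) {d : ℕ} {X : Set (Vec d)}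
    (hXc : IsCompact X) 
    (hR : ∀ x ∈ X, ∀ y ∈ X, ∀ i, |x i - y i| ≤ R)
    {μ ρ : Measure (Vec d)} (hμ : ProbOn μ X) (hρ : ProbOn ρ X) :
    ∃ γ : Measure (Vec d × Vec d), IsCoupling γ μ ρ ∧ ∀ η > 0, ∃ φ ψ : Vec d → ℝ,
      Pot p R X φ ψ ∧ ∫ z, cst p 0 z.2 z.1 ∂γ ≤ ∫ x, φ x ∂ρ + ∫ y, ψ y ∂μ + η := by
  have hp : 0 < p := by linarith
  have hXm := hXc.measurableSet
  have hXn : X.Nonempty := by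
    by_contra hne
    rw [Set.not_nonempty_iff_eq_empty] at hne
    have h1 := hμ.2
    rw [hne, Set.compl_empty] at h1
    have := hμ.1
    simp at h1
  have : CompactSpace X := isCompact_iff_compactSpace.1 hXc
  have emb : MeasurableEmbedding (Subtype.val : X → Vec d) := MeasurableEmbedding.subtype_coe hXm
  have mapback : ∀ α : Measure (Vec d), ProbOn α X → (α.comap (Subtype.val : X → Vec d)).map
      (Subtype.val : X → Vec d) = α := by
    intro α hα
    rw [emb.map_comap, Subtype.range_coe]
    exact Measure.restrict_eq_self_of_ae_mem (by rw [ae_iff]; exact hα.2)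
  have isP : ∀ α : Measure (Vec d), ProbOn α X →
      IsProbabilityMeasure (α.comap (Subtype.val : X → Vec d)) := by
    intro α hα
    constructor
    have := congrArg (fun m => m Set.univ) (mapback α hα)
    rw [Measure.map_apply measurable_subtype_coe MeasurableSet.univ, Set.preimage_univ] at this
    rw [this]; have := hα.1; exact measure_univ
  set α := μ.comap (Subtype.val : X → Vec d) with hα
  set β := ρ.comap (Subtype.val : X → Vec d) with hβ
  have := isP μ hμ
  have := isP ρ hρ
  have cc : Continuous fun z : X × X => cst p 0 (z.1 : Vec d) z.2 :=
    cst_cont hp 0 (continuous_subtype_val.comp continuous_fst)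
      (continuous_subtype_val.comp continuous_snd)
  obtain ⟨γ0, hγp, hγ1, hγ2, hd⟩ := kantorovich α β ⟨_, cc⟩
  set e : X × X → Vec d × Vec d := fun z => ((z.1 : Vec d), (z.2 : Vec d)) with he
  have hem : Measurable e := by rw [he]; fun_prop
  refine ⟨γ0.map e, ⟨Measure.isProbabilityMeasure_map hem.aemeasurable, ?_, ?_⟩, ?_⟩
  · rw [Measure.map_map measurable_fst hem]
    have : Prod.fst ∘ e = (Subtype.val : X → Vec d) ∘ Prod.fst := rfl
    rw [this, ← Measure.map_map measurable_subtype_coe measurable_fst, hγ1]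
    exact mapback μ hμ
  · rw [Measure.map_map measurable_snd hem]
    have : Prod.snd ∘ e = (Subtype.val : X → Vec d) ∘ Prod.snd := rfl
    rw [this, ← Measure.map_map measurable_subtype_coe measurable_snd, hγ2]
    exact mapback ρ hρ
  · intro η hη
    obtain ⟨ψ0, φ0, hle, hItg⟩ := hd η hη
    obtain ⟨φ, ψ, k, hP, h1, h2⟩ := exists_pot (φ0 := φ0) (ψ0 := ψ0) hp1 hR0 hXc hXn hR
      φ0.continuous (by
        intro x y
        have := hle y x
        simp only [ContinuousMap.coe_mk] at this
        rw [cst_comm]; linarith)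
    refine ⟨φ, ψ, hP, ?_⟩
    have hsw : Continuous fun z : Vec d × Vec d => cst p 0 z.2 z.1 :=
      cst_cont hp 0 continuous_snd continuous_fst
    rw [integral_map hem.aemeasurable hsw.aestronglyMeasurable]
    have e1 : ∫ z, cst p 0 (e z).2 (e z).1 ∂γ0 = ∫ z, (⟨_, cc⟩ : C(X × X, ℝ)) z ∂γ0 := by
      refine integral_congr_ae (Filter.Eventually.of_forall fun z => ?_)
      exact cst_comm _ _ _ _
    rw [e1]
    have e2 : ∫ x, φ x ∂ρ = ∫ x : X, φ x ∂β := by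
      conv_lhs => rw [← mapback ρ hρ]
      rw [integral_map measurable_subtype_coe.aemeasurable hP.cφ.aestronglyMeasurable]
    have e3 : ∫ x, ψ x ∂μ = ∫ x : X, ψ x ∂α := by
      conv_lhs => rw [← mapback μ hμ]
      rw [integral_map measurable_subtype_coe.aemeasurable hP.cψ.aestronglyMeasurable]
    rw [e2, e3]
    have i1 : Integrable (fun x : X => φ x) β :=
      int_of_cont isCompact_univ (by simp) (hP.cφ.comp continuous_subtype_val).continuousOn
    have i2 : Integrable (fun x : X => ψ x) α :=
      int_of_cont isCompact_univ (by simp) (hP.cψ.comp continuous_subtype_val).continuousOn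
    have i3 : Integrable φ0 β :=
      int_of_cont isCompact_univ (by simp) φ0.continuous.continuousOn
    have i4 : Integrable ψ0 α :=
      int_of_cont isCompact_univ (by simp) ψ0.continuous.continuousOn
    have m1 : ∫ x, (φ0 x - k) ∂β ≤ ∫ x : X, φ x ∂β :=
      integral_mono (i3.sub (integrable_const k)) i1 h1
    have m2 : ∫ x, (ψ0 x + k) ∂α ≤ ∫ x : X, ψ x ∂α :=
      integral_mono (i4.add (integrable_const k)) i2 h2
    rw [integral_sub i3 (integrable_const k)] at m1
    rw [integral_add i4 (integrable_const k)] at m2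
    simp only [integral_const, probReal_univ, one_smul] at m1 m2
    linarith


/-! ### Part 6: L2 estimate for the difference of potentials -/

lemma cst_mono_eps {p ε : ℝ} (hp : 0 < p) {d : ℕ} (x y : Vec d) : cst p 0 x y ≤ cst p ε x y := by
  unfold cst
  exact Finset.sum_le_sum fun i _ => by rw [rg_zero]; exact le_rg hp

lemma cst_eps_le {p ε : ℝ} (hp : 0 < p) (hp2 : p ≤ 2) (hε : 0 ≤ ε) {d : ℕ} (x y : Vec d) :
    cst p ε x y ≤ cst p 0 x y + d * ε ^ p := by
  unfold cst
  have : (d : ℝ) * ε ^ p = ∑ i : Fin d, ε ^ p := by simp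
  rw [this, ← Finset.sum_add_distrib]
  exact Finset.sum_le_sum fun i _ => by rw [rg_zero]; exact rg_le hp hp2 hε

lemma cst_semiconcave {p ε : ℝ} (hp : 0 < p) (hp2 : p ≤ 2) (hε : 0 < ε) {d : ℕ}
    (x x' y : Vec d) :
    (cst p ε x y + cst p ε x' y) / 2 ≤ cst p ε ((1 / 2 : ℝ) • (x + x')) y +
      ε ^ (p - 2) * ∑ i, ((x i - x' i) / 2) ^ 2 := by
  unfold cst
  rw [← Finset.sum_add_distrib, Finset.sum_div, Finset.mul_sum, ← Finset.sum_add_distrib]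
  refine Finset.sum_le_sum fun i _ => ?_
  have h := rg_semiconcave hp hp2 hε (x i - y i) (x' i - y i)
  have e1 : (x i - y i + (x' i - y i)) / 2 = ((1 / 2 : ℝ) • (x + x')) i - y i := by
    simp; ring
  have e2 : x i - y i - (x' i - y i) = x i - x' i := by ring
  rw [e1, e2] at h
  exact h

section
set_option linter.unusedSectionVars false
variable {p ε : ℝ} {d : ℕ} {X : Set (Vec d)} [Nonempty X] [CompactSpace X]

lemma ctr_eps_bounds (hp : 0 < p) (hp2 : p ≤ 2) (hε : 0 ≤ ε) {ψ : X → ℝ} (hψ : Continuous ψ)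
    (x : Vec d) : ctr (cX p 0 X) ψ x ≤ ctr (cX p ε X) ψ x ∧
      ctr (cX p ε X) ψ x ≤ ctr (cX p 0 X) ψ x + d * ε ^ p := by
  have k0 := cX_continuous hp 0 X
  have kε := cX_continuous hp ε X
  constructor
  · apply le_ctr kε hψ
    intro y
    exact (ctr_le k0 hψ x y).trans (cst_mono_eps hp _ _)
  · have : ctr (cX p ε X) ψ x - d * ε ^ p ≤ ctr (cX p 0 X) ψ x := by
      apply le_ctr k0 hψ
      intro y
      have h1 := ctr_le kε hψ x y
      have h2 := cst_eps_le hp hp2 hε x (y : Vec d)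
      unfold cX at *
      linarith
    linarith

lemma ctr_abs_le {R M : ℝ} (hp : 0 < p) (hp2 : p ≤ 2) (hε : 0 ≤ ε) (hε1 : ε ≤ 1) 
    (hR : ∀ x ∈ X, ∀ y ∈ X, ∀ i, |x i - y i| ≤ R) {ψ : X → ℝ} (hψ : Continuous ψ)
    (hb : ∀ y, |ψ y| ≤ M) {x : Vec d} (hx : x ∈ X) :
    |ctr (cX p ε X) ψ x| ≤ M + d * R ^ p + d := by
  obtain ⟨y, hy, -⟩ := ctr_exists (cX_continuous hp ε X) hψ x
  rw [hy]
  unfold cX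
  have h1 := cst_nonneg (p := p) (ε := ε) x (y : Vec d)
  have h2 := cst_eps_le hp hp2 hε x (y : Vec d)
  have h3 := cst_le hp hR hx y.2
  have h4 := abs_le.1 (hb y)
  have h5 : (d : ℝ) * ε ^ p ≤ d := by
    have : ε ^ p ≤ 1 := Real.rpow_le_one hε hε1 hp.le
    have hd : (0 : ℝ) ≤ d := by positivity
    nlinarith
  have h6 : 0 ≤ (d : ℝ) := by positivity
  rw [abs_le]; constructor <;> linarith

lemma ctr_mid (hp : 0 < p) (hp2 : p ≤ 2) (hε : 0 < ε) {ψ0 ψ1 : X → ℝ} (h0 : Continuous ψ0)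
    (h1 : Continuous ψ1) (x x' : Vec d) :
    (ctr (cX p ε X) ψ0 x + ctr (cX p ε X) ψ1 x') / 2 ≤
      ctr (cX p ε X) (fun y => (ψ0 y + ψ1 y) / 2) ((1 / 2 : ℝ) • (x + x')) +
        ε ^ (p - 2) * ∑ i, ((x i - x' i) / 2) ^ 2 := by
  have k := cX_continuous hp ε X
  obtain ⟨y, hy, -⟩ := ctr_exists k (by fun_prop : Continuous fun y => (ψ0 y + ψ1 y) / 2)
    ((1 / 2 : ℝ) • (x + x'))
  rw [hy]
  have e0 := ctr_le k h0 x y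
  have e1 := ctr_le k h1 x' y
  have e2 := cst_semiconcave hp hp2 hε x x' (y : Vec d)
  unfold cX at *
  linarith

end

/-- the gap estimate -/
lemma gap_le {p R δ η : ℝ} (hp1 : 1 < p) (hR0 : 0 < R) {d : ℕ} {X : Set (Vec d)}
    (hXc : IsCompact X) [Nonempty X] [CompactSpace X]
    {μ ν ρ : Measure (Vec d)} (hμ : ProbOn μ X) (hν : ProbOn ν X) (hρ : ProbOn ρ X)
    {γ0 γ1 ζ : Measure (Vec d × Vec d)}
    (hγ0 : IsCoupling γ0 μ ρ) (hγ1 : IsCoupling γ1 ν ρ) (hζ : IsCoupling ζ μ ν)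
    {φ0 ψ0 φ1 ψ1 : Vec d → ℝ} (P0 : Pot p R X φ0 ψ0) (P1 : Pot p R X φ1 ψ1)
    (s0 : ∫ z, (cst p 0 z.2 z.1 - φ0 z.2 - ψ0 z.1) ∂γ0 ≤ η)
    (s1 : ∫ z, (cst p 0 z.2 z.1 - φ1 z.2 - ψ1 z.1) ∂γ1 ≤ η)
    (hδ : ∫ z, lpDist p z.1 z.2 ∂ζ ≤ δ) :
    ∫ x, ctr (cX p 0 X) (fun y : X => (ψ0 y + ψ1 y) / 2) x ∂ρ ≤
      (∫ x, φ0 x ∂ρ + ∫ x, φ1 x ∂ρ) / 2 + η + p * R ^ (p - 1) * d * δ := by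
  have hp : 0 < p := by linarith
  have := hμ.1
  have := hν.1
  have := hρ.1
  have c0 := P0.cψ
  have c1 := P1.cψ
  set ψm : Vec d → ℝ := fun y => (ψ0 y + ψ1 y) / 2 with hψm
  have cm : Continuous ψm := by rw [hψm]; fun_prop
  have cm' : Continuous fun y : X => (ψ0 y + ψ1 y) / 2 := by fun_prop
  set φm := ctr (cX p 0 X) (fun y : X => (ψ0 y + ψ1 y) / 2) with hφm
  have cφm : Continuous φm := ctr_continuous (cX_continuous hp 0 X) cm'
  have hle : ∀ x, ∀ y ∈ X, φm x + ψm y ≤ cst p 0 x y := fun x y hy =>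
    ctr_le (cX_continuous hp 0 X) cm' x ⟨y, hy⟩
  have w0 := weak_duality hp1 hXc hμ hρ hγ0 cφm cm hle
  have w1 := weak_duality hp1 hXc hν hρ hγ1 cφm cm hle
  rw [slack_int hp1 hXc hμ hρ hγ0 P0.cφ P0.cψ] at s0
  rw [slack_int hp1 hXc hν hρ hγ1 P1.cφ P1.cψ] at s1
  have iμ : ∀ f : Vec d → ℝ, Continuous f → Integrable f μ := fun f hf =>
    int_of_cont hXc hμ.2 hf.continuousOn
  have iν : ∀ f : Vec d → ℝ, Continuous f → Integrable f ν := fun f hf =>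
    int_of_cont hXc hν.2 hf.continuousOn
  have m0 : ∫ y, ψm y ∂μ = (∫ y, ψ0 y ∂μ + ∫ y, ψ1 y ∂μ) / 2 := by
    simp only [hψm]
    rw [integral_div, integral_add (iμ _ c0) (iμ _ c1)]
  have m1 : ∫ y, ψm y ∂ν = (∫ y, ψ0 y ∂ν + ∫ y, ψ1 y ∂ν) / 2 := by
    simp only [hψm]
    rw [integral_div, integral_add (iν _ c0) (iν _ c1)]
  have cl : Continuous fun z : Vec d × Vec d => lpDist p z.1 z.2 := by
    simp_rw [lpDist_eq]
    exact (cst_cont hp 0 continuous_fst continuous_snd).rpow_const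
      (fun x => Or.inr (by positivity))
  have lip : ∀ φ ψ : Vec d → ℝ, Pot p R X φ ψ →
      |∫ y, ψ y ∂μ - ∫ y, ψ y ∂ν| ≤ p * R ^ (p - 1) * d * δ := by
    intro φ ψ P
    have hRp : 0 ≤ p * R ^ (p - 1) := by positivity
    have j1 : Integrable (fun z : Vec d × Vec d => ψ z.1) ζ :=
      coupling_int hζ hXc hμ hν (P.cψ.comp continuous_fst)
    have j2 : Integrable (fun z : Vec d × Vec d => ψ z.2) ζ :=
      coupling_int hζ hXc hμ hν (P.cψ.comp continuous_snd)
    rw [← coupling_fst hζ P.cψ, ← coupling_snd hζ P.cψ, ← integral_sub j1 j2]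
    refine (abs_integral_le_integral_abs).trans ?_
    calc ∫ z, |ψ z.1 - ψ z.2| ∂ζ ≤ ∫ z, p * R ^ (p - 1) * d * lpDist p z.1 z.2 ∂ζ := by
          apply integral_mono_ae
          · exact coupling_int hζ hXc hμ hν
              ((P.cψ.comp continuous_fst).sub (P.cψ.comp continuous_snd)).abs
          · exact coupling_int hζ hXc hμ hν (continuous_const.mul cl)
          · have h3 : ∀ᵐ z ∂ζ, z ∈ X ×ˢ X := by
              rw [ae_iff]; exact coupling_conc hζ hXc.measurableSet hμ.2 hν.2
            filter_upwards [h3] with z hz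
            have hs : ∀ x y : Vec d, ∑ i, |x i - y i| ≤ d * lpDist p x y := by
              intro x y
              calc ∑ i, |x i - y i| ≤ ∑ i : Fin d, lpDist p x y :=
                    Finset.sum_le_sum fun i _ => abs_le_lpDist hp x y i
                _ = _ := by simp
            have q1 := (P.lψ z.1 hz.1 z.2 hz.2).trans (mul_le_mul_of_nonneg_left (hs z.1 z.2) hRp)
            have hcomm : ∑ i, |z.2 i - z.1 i| = ∑ i, |z.1 i - z.2 i| :=
              Finset.sum_congr rfl fun i _ => abs_sub_comm _ _
            have q2 := (P.lψ z.2 hz.2 z.1 hz.1)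
            rw [hcomm] at q2
            have q3 := q2.trans (mul_le_mul_of_nonneg_left (hs z.1 z.2) hRp)
            rw [abs_le]; constructor <;> linarith
      _ = p * R ^ (p - 1) * d * ∫ z, lpDist p z.1 z.2 ∂ζ := integral_const_mul _ _
      _ ≤ _ := by gcongr
  have l0 := abs_le.1 (lip φ0 ψ0 P0)
  have l1 := abs_le.1 (lip φ1 ψ1 P1)
  rw [m0] at w0
  rw [m1] at w1
  linarith [l0.1, l0.2, l1.1, l1.2]

set_option maxHeartbeats 2000000 in
lemma pot_L2_eps {p R : ℝ} (hp1 : 1 < p) (hp2 : p ≤ 2) (hR0 : 0 < R) {d : ℕ} {X : Set (Vec d)}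
    (hXc : IsCompact X) (hcv : Convex ℝ X) (hV : 0 < volume.real X)
    (hR : ∀ x ∈ X, ∀ y ∈ X, ∀ i, |x i - y i| ≤ R)
    {ρ : Measure (Vec d)} (hρ : ProbOn ρ X) {c : ℝ} (hc : 0 < c)
    (hlow : ENNReal.ofReal c • volume.restrict X ≤ ρ) :
    ∃ C : ℝ, 0 ≤ C ∧ ∀ δ η ε : ℝ, 0 ≤ δ → 0 ≤ η → 0 < ε → ε ≤ 1 → ∀ μ ν : Measure (Vec d),
      ProbOn μ X → ProbOn ν X → ∀ γ0 γ1 ζ : Measure (Vec d × Vec d),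
      IsCoupling γ0 μ ρ → IsCoupling γ1 ν ρ → IsCoupling ζ μ ν → ∀ φ0 ψ0 φ1 ψ1 : Vec d → ℝ,
      Pot p R X φ0 ψ0 → Pot p R X φ1 ψ1 → 
      ∫ z, (cst p 0 z.2 z.1 - φ0 z.2 - ψ0 z.1) ∂γ0 ≤ η →
      ∫ z, (cst p 0 z.2 z.1 - φ1 z.2 - ψ1 z.1) ∂γ1 ≤ η →
      ∫ z, lpDist p z.1 z.2 ∂ζ ≤ δ →
      ∃ k : ℝ, ∫ x in X, (φ0 x - φ1 x - k) ^ 2 ≤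
        C * (ε ^ (p - 2) * (δ + η + ε ^ p) + (ε ^ p) ^ 2) := by
  have hp : 0 < p := by linarith
  have hXm := hXc.measurableSet
  have hItg : ∀ f : Vec d → ℝ, Continuous f → IntegrableOn f X := fun f hf =>
    hf.continuousOn.integrableOn_compact hXc
  have hXn : X.Nonempty := by
    by_contra hne
    rw [Set.not_nonempty_iff_eq_empty] at hne
    simp [hne] at hV
  have : Nonempty X := hXn.to_subtype
  have : CompactSpace X := isCompact_iff_compactSpace.1 hXc
  obtain ⟨Q, hQ⟩ := hXc.exists_bound_of_continuousOn
    (f := fun x : Vec d => ∑ i, (x i) ^ 2) (by fun_prop)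
  set M := Mb p R d + d * R ^ p + d + Q with hM
  set V := volume.real X with hVdef
  set L := p * R ^ (p - 1) * d with hL
  have hL0 : 0 ≤ L := by positivity
  refine ⟨16 * Real.exp (4 * M) / c * (1 + L + d) + 2 * V * d ^ 2, by positivity, ?_⟩
  intro δ η ε hδ0 hη0 hε hε1 μ ν hμ hν γ0 γ1 ζ hγ0 hγ1 hζ φ0 ψ0 φ1 ψ1 P0 P1 s0 s1 hδ
  have hgap := gap_le hp1 hR0 hXc hμ hν hρ hγ0 hγ1 hζ P0 P1 s0 s1 hδ
  have c0 : Continuous fun y : X => ψ0 y := P0.cψ.comp continuous_subtype_val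
  have c1 : Continuous fun y : X => ψ1 y := P1.cψ.comp continuous_subtype_val
  have cm : Continuous fun y : X => (ψ0 y + ψ1 y) / 2 := (c0.add c1).div_const 2
  have kε := cX_continuous hp ε X
  have k0 := cX_continuous hp 0 X
  set f0 := ctr (cX p ε X) (fun y : X => ψ0 y) with hf0
  set f1 := ctr (cX p ε X) (fun y : X => ψ1 y) with hf1
  set fm := ctr (cX p ε X) (fun y : X => (ψ0 y + ψ1 y) / 2) with hfm
  have cf0 : Continuous f0 := ctr_continuous kε c0
  have cf1 : Continuous f1 := ctr_continuous kε c1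
  have cfm : Continuous fm := ctr_continuous kε cm
  have n0 : ∀ x, φ0 x ≤ f0 x ∧ f0 x ≤ φ0 x + d * ε ^ p := by
    intro x; have := ctr_eps_bounds hp hp2 hε.le c0 x
    rw [P0.eq]; exact this
  have n1 : ∀ x, φ1 x ≤ f1 x ∧ f1 x ≤ φ1 x + d * ε ^ p := by
    intro x; have := ctr_eps_bounds hp hp2 hε.le c1 x
    rw [P1.eq]; exact this
  set gm := ctr (cX p 0 X) (fun y : X => (ψ0 y + ψ1 y) / 2) with hgm
  have cgm : Continuous gm := ctr_continuous k0 cm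
  have nm : ∀ x, fm x ≤ gm x + d * ε ^ p := fun x => (ctr_eps_bounds hp hp2 hε.le cm x).2
  set l := ε ^ (2 - p) with hl
  have hl0 : 0 < l := by positivity
  have hl1 : l ≤ 1 := Real.rpow_le_one hε.le hε1 (by linarith)
  have hll : l * ε ^ (p - 2) = 1 := by
    rw [hl, ← Real.rpow_add hε]; simp
  -- the functions u
  set q : Vec d → ℝ := fun x => ∑ i, (x i) ^ 2 with hq
  have cq : Continuous q := by rw [hq]; fun_prop
  have ub : ∀ ψ : X → ℝ, Continuous ψ → (∀ y, |ψ y| ≤ Mb p R d) → ∀ x ∈ X,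
      |l * ctr (cX p ε X) ψ x - q x| ≤ M := by
    intro ψ hψ hb x hx
    have h1 := ctr_abs_le hp hp2 hε.le hε1 hR hψ hb hx
    have h2 := hQ x hx
    rw [Real.norm_eq_abs] at h2
    have h3 : |l * ctr (cX p ε X) ψ x| ≤ |ctr (cX p ε X) ψ x| := by
      rw [abs_mul, abs_of_pos hl0]
      exact mul_le_of_le_one_left (abs_nonneg _) hl1
    calc _ ≤ |l * ctr (cX p ε X) ψ x| + |q x| := abs_sub _ _
      _ ≤ M := by rw [hM]; linarith
  have hmid : ∀ x ∈ X, ∀ y ∈ X, ((l * f0 x - q x) + (l * f1 y - q y)) / 2 ≤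
      l * fm ((1 / 2 : ℝ) • (x + y)) - q ((1 / 2 : ℝ) • (x + y)) := by
    intro x _ y _
    have h := mul_le_mul_of_nonneg_left (ctr_mid hp hp2 hε c0 c1 x y) hl0.le
    rw [mul_add, ← mul_assoc l (ε ^ (p - 2)), hll, one_mul] at h
    have e : (q x + q y) / 2 - ∑ i, ((x i - y i) / 2) ^ 2 = q ((1 / 2 : ℝ) • (x + y)) := by
      simp only [hq]
      rw [← Finset.sum_add_distrib, Finset.sum_div, ← Finset.sum_sub_distrib]
      refine Finset.sum_congr rfl fun i _ => ?_
      simp; ring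
    have e2 : l * ((f0 x + f1 y) / 2) = (l * f0 x + l * f1 y) / 2 := by ring
    rw [← hf0, ← hf1, ← hfm, e2] at h
    linarith
  obtain ⟨k, hk⟩ := variance_lemma hXc hcv hV (M := M)
    (by fun_prop : Continuous fun x => l * f0 x - q x)
    (by fun_prop : Continuous fun x => l * f1 x - q x)
    (by fun_prop : Continuous fun x => l * fm x - q x)
    (ub _ c0 fun y => P0.bψ y y.2) (ub _ c1 fun y => P1.bψ y y.2)
    (ub _ cm fun y => by
      have h0 := abs_le.1 (P0.bψ y y.2)
      have h1 := abs_le.1 (P1.bψ y y.2)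
      rw [abs_le]; constructor <;> linarith) hmid
  set gapf : Vec d → ℝ := fun x => fm x - (f0 x + f1 x) / 2 with hgapf
  have cgap : Continuous gapf := by rw [hgapf]; fun_prop
  have gap0 : ∀ x ∈ X, 0 ≤ gapf x := by
    intro x hx
    have h := ctr_mid hp hp2 hε c0 c1 x x
    rw [← two_smul ℝ x, smul_smul] at h
    norm_num at h
    simp only [hgapf]
    linarith
  have := hρ.1
  have iρ : ∀ f : Vec d → ℝ, Continuous f → Integrable f ρ := fun f hf =>
    int_of_cont hXc hρ.2 hf.continuousOn
  -- transfer to Lebesgue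
  have htr : c * ∫ x in X, gapf x ≤ ∫ x, gapf x ∂ρ := by
    have h1 : ∫ x, gapf x ∂(ENNReal.ofReal c • volume.restrict X) ≤ ∫ x, gapf x ∂ρ := by
      apply integral_mono_measure hlow _ (iρ _ cgap)
      have : ∀ᵐ x ∂ρ, x ∈ X := by rw [ae_iff]; exact hρ.2
      filter_upwards [this] with x hx using gap0 x hx
    rwa [integral_smul_measure, ENNReal.toReal_ofReal hc.le, smul_eq_mul] at h1
  have hρgap : ∫ x, gapf x ∂ρ ≤ η + L * δ + d * ε ^ p := by
    have h1 : ∫ x, gapf x ∂ρ ≤ ∫ x, (gm x + d * ε ^ p - (φ0 x + φ1 x) / 2) ∂ρ := by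
      have := P0.cφ
      have := P1.cφ
      apply integral_mono (iρ _ cgap) (iρ _ (by fun_prop))
      intro x
      have := (n0 x).1
      have := (n1 x).1
      have := nm x
      simp only [hgapf]; linarith
    have h2 : ∫ x, (gm x + d * ε ^ p - (φ0 x + φ1 x) / 2) ∂ρ =
        ∫ x, gm x ∂ρ + d * ε ^ p - (∫ x, φ0 x ∂ρ + ∫ x, φ1 x ∂ρ) / 2 := by
      rw [integral_sub, integral_add, integral_div, integral_add (iρ _ P0.cφ) (iρ _ P1.cφ)]
      · simp
      · exact iρ _ cgm
      · exact integrable_const _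
      · exact (iρ _ cgm).add (integrable_const _)
      · exact ((iρ _ P0.cφ).add (iρ _ P1.cφ)).div_const 2
    rw [h2] at h1
    linarith
  have hVgap : ∫ x in X, gapf x ≤ (η + L * δ + d * ε ^ p) / c := by
    rw [le_div_iff₀ hc]; linarith
  have hk' : ∫ x in X, (f0 x - f1 x - k / l) ^ 2 ≤
      8 * Real.exp (4 * M) * ε ^ (p - 2) * ∫ x in X, gapf x := by
    have e1 : ∀ x, (l * f0 x - q x - (l * f1 x - q x) - k) ^ 2 =
        l ^ 2 * (f0 x - f1 x - k / l) ^ 2 := by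
      intro x
      rw [← mul_pow]; congr 1; field_simp; ring
    have e2 : ∀ x, l * fm x - q x - (l * f0 x - q x + (l * f1 x - q x)) / 2 = l * gapf x := by
      intro x; simp only [hgapf]; ring
    simp_rw [e1, e2] at hk
    rw [integral_const_mul, integral_const_mul] at hk
    have hinv : ε ^ (p - 2) = l⁻¹ := eq_inv_of_mul_eq_one_right hll
    rw [hinv]
    have h3 := mul_le_mul_of_nonneg_left hk (by positivity : 0 ≤ (l⁻¹) ^ 2)
    have h4 : (l⁻¹) ^ 2 * (l ^ 2 * ∫ x in X, (f0 x - f1 x - k / l) ^ 2) =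
        ∫ x in X, (f0 x - f1 x - k / l) ^ 2 := by field_simp
    have h5 : (l⁻¹) ^ 2 * (8 * Real.exp (4 * M) * (l * ∫ x in X, gapf x)) =
        8 * Real.exp (4 * M) * l⁻¹ * ∫ x in X, gapf x := by field_simp
    rw [h4, h5] at h3
    exact h3
  refine ⟨k / l, ?_⟩
  have hst : ∫ x in X, (φ0 x - φ1 x - k / l) ^ 2 ≤
      ∫ x in X, (2 * (f0 x - f1 x - k / l) ^ 2 + 2 * (d * ε ^ p) ^ 2) := by
    have := P0.cφ
    have := P1.cφ
    apply setIntegral_mono_on (hItg _ (by fun_prop)) (hItg _ (by fun_prop)) hXm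
    intro x hx
    have a0 := n0 x
    have a1 := n1 x
    set t := (φ0 x - φ1 x) - (f0 x - f1 x) with ht
    have ht2 : t ^ 2 ≤ (d * ε ^ p) ^ 2 := by
      apply sq_le_sq'
      · linarith [a0.1, a0.2, a1.1, a1.2]
      · linarith [a0.1, a0.2, a1.1, a1.2]
    have e : φ0 x - φ1 x - k / l = (f0 x - f1 x - k / l) + t := by rw [ht]; ring
    rw [e]
    nlinarith [sq_nonneg ((f0 x - f1 x - k / l) - t)]
  rw [integral_add (hItg _ (by fun_prop)) (hItg _ (by fun_prop)), integral_const_mul,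
    setIntegral_const, smul_eq_mul] at hst
  refine hst.trans ?_
  set E := Real.exp (4 * M) with hE
  have hE0 : 0 < E := Real.exp_pos _
  set Λ := ε ^ (p - 2) with hΛ
  have hΛ0 : 0 < Λ := by positivity
  set t := ε ^ p with ht
  have ht0 : 0 < t := by positivity
  have hd0 : (0 : ℝ) ≤ d := by positivity
  have f1' : 2 * ∫ x in X, (f0 x - f1 x - k / l) ^ 2 ≤
      16 * E * Λ * ((η + L * δ + d * t) / c) := by
    have := hk'.trans (mul_le_mul_of_nonneg_left hVgap (by positivity))
    linarith
  have f2 : η + L * δ + d * t ≤ (1 + L + d) * (δ + η + t) := by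
    nlinarith [mul_nonneg hL0 hη0, mul_nonneg hL0 ht0.le, mul_nonneg hd0 hδ0, mul_nonneg hd0 hη0]
  have f3 : 16 * E * Λ * ((η + L * δ + d * t) / c) ≤
      16 * E / c * (1 + L + d) * (Λ * (δ + η + t)) := by
    calc 16 * E * Λ * ((η + L * δ + d * t) / c) ≤
        16 * E * Λ * (((1 + L + d) * (δ + η + t)) / c) := by gcongr
      _ = _ := by ring
  have f4 : 0 ≤ 2 * V * d ^ 2 * (Λ * (δ + η + t)) := by positivity
  have f5 : 0 ≤ 16 * E / c * (1 + L + d) * t ^ 2 := by positivity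
  have f6 : V * (2 * (d * t) ^ 2) = 2 * V * d ^ 2 * t ^ 2 := by ring
  calc _ ≤ 16 * E / c * (1 + L + d) * (Λ * (δ + η + t)) + 2 * V * d ^ 2 * t ^ 2 := by
        linarith
    _ ≤ _ := by
      linarith

/-- L2 estimate with optimised regularisation. -/
lemma pot_L2 {p R : ℝ} (hp1 : 1 < p) (hp2 : p ≤ 2) (hR0 : 0 < R) {d : ℕ} {X : Set (Vec d)}
    (hXc : IsCompact X) (hcv : Convex ℝ X) (hV : 0 < volume.real X)
    (hR : ∀ x ∈ X, ∀ y ∈ X, ∀ i, |x i - y i| ≤ R)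
    {ρ : Measure (Vec d)} (hρ : ProbOn ρ X) {c : ℝ} (hc : 0 < c)
    (hlow : ENNReal.ofReal c • volume.restrict X ≤ ρ) :
    ∃ C : ℝ, 0 ≤ C ∧ ∀ δ η : ℝ, 0 < δ → δ ≤ 1 → 0 ≤ η → η ≤ δ → ∀ μ ν : Measure (Vec d),
      ProbOn μ X → ProbOn ν X → ∀ γ0 γ1 ζ : Measure (Vec d × Vec d),
      IsCoupling γ0 μ ρ → IsCoupling γ1 ν ρ → IsCoupling ζ μ ν → ∀ φ0 ψ0 φ1 ψ1 : Vec d → ℝ,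
      Pot p R X φ0 ψ0 → Pot p R X φ1 ψ1 → 
      ∫ z, (cst p 0 z.2 z.1 - φ0 z.2 - ψ0 z.1) ∂γ0 ≤ η →
      ∫ z, (cst p 0 z.2 z.1 - φ1 z.2 - ψ1 z.1) ∂γ1 ≤ η →
      ∫ z, lpDist p z.1 z.2 ∂ζ ≤ δ →
      ∃ k : ℝ, ∫ x in X, (φ0 x - φ1 x - k) ^ 2 ≤ C * δ ^ ((2 * p - 2) / p) := by
  obtain ⟨C, hC, H⟩ := pot_L2_eps hp1 hp2 hR0 hXc hcv hV hR hρ hc hlow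
  have hp : 0 < p := by linarith
  refine ⟨C * 4, by positivity, ?_⟩
  intro δ η hδ0 hδ1 hη0 hηδ μ ν hμ hν γ0 γ1 ζ hγ0 hγ1 hζ φ0 ψ0 φ1 ψ1 P0 P1 s0 s1 hδ
  obtain ⟨k, hk⟩ := H δ η (δ ^ (1 / p)) hδ0.le hη0 (by positivity)
    (Real.rpow_le_one hδ0.le hδ1 (by positivity)) μ ν hμ hν γ0 γ1 ζ hγ0 hγ1 hζ φ0 ψ0 φ1 ψ1
    P0 P1 s0 s1 hδ
  refine ⟨k, hk.trans ?_⟩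
  have e1 : (δ ^ (1 / p)) ^ p = δ := by
    rw [← Real.rpow_mul hδ0.le, one_div, inv_mul_cancel₀ hp.ne', Real.rpow_one]
  have e2 : (δ ^ (1 / p)) ^ (p - 2) * δ = δ ^ ((2 * p - 2) / p) := by
    rw [← Real.rpow_mul hδ0.le]
    nth_rewrite 2 [← Real.rpow_one δ]
    rw [← Real.rpow_add hδ0]
    congr 1; field_simp; ring
  have e3 : δ ^ 2 ≤ δ ^ ((2 * p - 2) / p) := by
    rw [← Real.rpow_natCast]
    apply Real.rpow_le_rpow_of_exponent_ge hδ0 hδ1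
    rw [div_le_iff₀ hp]; push_cast; linarith
  rw [e1, mul_assoc]
  apply mul_le_mul_of_nonneg_left _ hC
  have h4 : 0 < (δ ^ (1 / p)) ^ (p - 2) := by positivity
  calc _ ≤ (δ ^ (1 / p)) ^ (p - 2) * (3 * δ) + δ ^ 2 := by gcongr; linarith
    _ = 3 * ((δ ^ (1 / p)) ^ (p - 2) * δ) + δ ^ 2 := by ring
    _ ≤ _ := by rw [e2]; linarith


/-! ### Part 7: boundary layers and finite differences -/

lemma boundary_layer {d : ℕ} {X : Set (Vec d)} (hXc : IsCompact X) (hcv : Convex ℝ X)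
    (hV : 0 < volume.real X) :
    ∃ Cb : ℝ, 0 ≤ Cb ∧ ∀ v : Vec d, volume.real {x | x ∈ X ∧ x + v ∉ X} ≤ Cb * ‖v‖ := by
  have hXf : volume X ≠ ∞ := hXc.measure_lt_top.ne
  have hItg : (interior X).Nonempty := by
    by_contra hne
    rw [Set.not_nonempty_iff_eq_empty] at hne
    have h1 := hcv.addHaar_frontier volume
    rw [frontier, hne, Set.sdiff_empty, hXc.isClosed.closure_eq] at h1
    simp [measureReal_def, h1] at hV
  obtain ⟨x0, hx0⟩ := hItg
  obtain ⟨r, hr, hball⟩ := Metric.isOpen_iff.1 isOpen_interior x0 hx0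
  set V := volume.real X with hVdef
  set r' := r / 2 with hr'
  have hr'0 : 0 < r' := by positivity
  have hb : ∀ u : Vec d, ‖u‖ ≤ r' → x0 + u ∈ X := by
    intro u hu
    apply interior_subset
    apply hball
    rw [Metric.mem_ball, dist_eq_norm, add_sub_cancel_left]
    linarith
  refine ⟨(d + 1) * V / r', by positivity, fun v => ?_⟩
  have hsubX : {x | x ∈ X ∧ x + v ∉ X} ⊆ X := fun x hx => hx.1
  rcases le_or_gt r' ‖v‖ with hv | hv
  · calc volume.real {x | x ∈ X ∧ x + v ∉ X} ≤ V := measureReal_mono hsubX hXf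
      _ ≤ (d + 1) * V / r' * ‖v‖ := by
        rw [div_mul_eq_mul_div, le_div_iff₀ hr'0]
        have hd : (0 : ℝ) ≤ d := by positivity
        have : V * r' ≤ V * ‖v‖ := by gcongr
        nlinarith [mul_nonneg (mul_nonneg hd hV.le) (norm_nonneg v)]
  · set t := ‖v‖ / r' with ht
    have ht0 : 0 ≤ t := by positivity
    have ht1 : t < 1 := by rw [ht, div_lt_one hr'0]; exact hv
    set Y := AffineMap.homothety x0 (1 - t) '' X with hY
    have hYX : Y ⊆ X ∩ {x | x + v ∈ X} := by
      rintro _ ⟨z, hz, rfl⟩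
      have key : ∀ u : Vec d, ‖u‖ ≤ r' → (1 - t) • z + t • (x0 + u) ∈ X := fun u hu =>
        hcv hz (hb u hu) (by linarith) ht0 (by ring)
      have e : AffineMap.homothety x0 (1 - t) z = (1 - t) • z + t • x0 := by
        rw [AffineMap.homothety_apply]
        simp only [vsub_eq_sub, vadd_eq_add]
        module
      rw [e]
      refine ⟨by simpa using key 0 (by simpa using hr'0.le), ?_⟩
      rcases eq_or_ne v 0 with h0 | h0
      · simpa [h0] using key 0 (by simpa using hr'0.le)
      · have htp : 0 < t := by
          have := norm_pos_iff.2 h0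
          positivity
        have := key (t⁻¹ • v) (by
          rw [norm_smul, Real.norm_eq_abs, abs_of_pos (by positivity), ht]
          have := norm_pos_iff.2 h0
          apply le_of_eq; field_simp)
        rw [smul_add, smul_smul, mul_inv_cancel₀ htp.ne', one_smul, ← add_assoc] at this
        exact this
    have hYm : MeasurableSet Y := by
      apply IsCompact.measurableSet
      apply hXc.image
      exact AffineMap.homothety_continuous x0 (1 - t)
    have hYv : volume.real Y = (1 - t) ^ d * V := by
      rw [measureReal_def, hY, Measure.addHaar_image_homothety, ENNReal.toReal_mul,
        ENNReal.toReal_ofReal (abs_nonneg _), abs_of_nonneg (by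
          apply pow_nonneg; linarith)]
      simp [hVdef, measureReal_def]
    have hsub : {x | x ∈ X ∧ x + v ∉ X} ⊆ X \ Y := by
      intro x hx
      refine ⟨hx.1, fun hxY => hx.2 (hYX hxY).2⟩
    calc volume.real {x | x ∈ X ∧ x + v ∉ X} ≤ volume.real (X \ Y) :=
          measureReal_mono hsub (measure_ne_top_of_subset Set.sdiff_subset hXf)
      _ = V - (1 - t) ^ d * V := by
          rw [measureReal_sdiff (fun x hx => (hYX hx).1) hYm hXf, hYv]
      _ ≤ (d + 1) * V / r' * ‖v‖ := by
          have hbern := one_add_mul_le_pow (a := -t) (by linarith) d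
          have e : (d + 1) * V / r' * ‖v‖ = (d + 1) * V * t := by rw [ht]; ring
          rw [e, ← sub_eq_add_neg] at *
          have := mul_le_mul_of_nonneg_right hbern hV.le
          nlinarith [mul_nonneg hV.le ht0]

lemma cst_shift {p : ℝ} (hp1 : 1 < p) (hp2 : p ≤ 2) {d : ℕ} (x y : Vec d) (i : Fin d) (h : ℝ) :
    cst p 0 (x + Pi.single i h) y ≤ cst p 0 x y + p * sg p (x i - y i) * h + 4 * |h| ^ p := by
  unfold cst
  have e : ∀ j, rg p 0 ((x + Pi.single i h : Vec d) j - y j) ≤ rg p 0 (x j - y j) +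
      (if j = i then p * sg p (x i - y i) * h + 4 * |h| ^ p else 0) := by
    intro j
    by_cases hj : j = i
    · subst hj
      simp only [rg_zero, if_true, Pi.add_apply, Pi.single_eq_same]
      have := abs_rpow_upper hp1 hp2 (x j - y j) h
      have e : x j + h - y j = x j - y j + h := by ring
      rw [e]; linarith
    · simp [hj]
  calc _ ≤ _ := Finset.sum_le_sum fun j _ => e j
    _ = _ := by rw [Finset.sum_add_distrib]; simp; ring

/-- one-sided finite difference bound at a contact point with slack -/
lemma contact_bound {p R : ℝ} (hp1 : 1 < p) (hp2 : p ≤ 2) {d : ℕ} {X : Set (Vec d)}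
    {φ ψ : Vec d → ℝ} (P : Pot p R X φ ψ) (x : Vec d) {y : Vec d} (hy : y ∈ X) (i : Fin d) (h : ℝ) :
    φ (x + Pi.single i h) - φ x ≤ p * sg p (x i - y i) * h + 4 * |h| ^ p +
      (cst p 0 x y - φ x - ψ y) := by
  have h1 := P.le (x + Pi.single i h) y hy
  have h2 := cst_shift hp1 hp2 x y i h
  linarith

/-- second difference -/
def sd {d : ℕ} (φ : Vec d → ℝ) (v x : Vec d) : ℝ := 2 * φ x - φ (x + v) - φ (x - v)

lemma single_sub {d : ℕ} (x : Vec d) (i : Fin d) (h : ℝ) :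
    x - Pi.single i h = x + Pi.single i (-h) := by
  rw [Pi.single_neg, sub_eq_add_neg]

lemma sd_lower {p R h : ℝ} (hp1 : 1 < p) (hp2 : p ≤ 2) (hh : 0 ≤ h) {d : ℕ} {X : Set (Vec d)}
    [Nonempty X] [CompactSpace X]
    {φ ψ : Vec d → ℝ} (P : Pot p R X φ ψ) (x : Vec d) (i : Fin d) :
    0 ≤ sd φ (Pi.single i h) x + 8 * h ^ p := by
  have hp : 0 < p := by linarith
  obtain ⟨y, hy, -⟩ := ctr_exists (cX_continuous hp 0 X)
    (P.cψ.comp continuous_subtype_val : Continuous fun y : X => ψ y) x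
  have h0 : φ x = cst p 0 x y - ψ y := by rw [P.eq]; exact hy
  have h1 := contact_bound hp1 hp2 P x y.2 i h
  have h2 := contact_bound hp1 hp2 P x y.2 i (-h)
  rw [abs_neg] at h2
  rw [abs_of_nonneg hh] at h1 h2
  unfold sd
  rw [single_sub]
  linarith

lemma fd_pointwise {p R h : ℝ} (hp1 : 1 < p) (hp2 : p ≤ 2) (hh : 0 ≤ h) {d : ℕ}
    {X : Set (Vec d)} [Nonempty X] [CompactSpace X]
    {φ0 ψ0 φ1 ψ1 : Vec d → ℝ} (P0 : Pot p R X φ0 ψ0) (P1 : Pot p R X φ1 ψ1) (x : Vec d)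
    {y0 y1 : Vec d} (hy0 : y0 ∈ X) (hy1 : y1 ∈ X) (i : Fin d) :
    p * h * |sg p (x i - y0 i) - sg p (x i - y1 i)| ≤
      |(φ0 x - φ1 x) - (φ0 (x - Pi.single i h) - φ1 (x - Pi.single i h))| +
      (sd φ0 (Pi.single i h) x + 8 * h ^ p) + (sd φ1 (Pi.single i h) x + 8 * h ^ p) + 8 * h ^ p +
      ((cst p 0 x y0 - φ0 x - ψ0 y0) + (cst p 0 x y1 - φ1 x - ψ1 y1)) := by
  have a0 := contact_bound hp1 hp2 P0 x hy0 i h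
  have b0 := contact_bound hp1 hp2 P0 x hy0 i (-h)
  have a1 := contact_bound hp1 hp2 P1 x hy1 i h
  have b1 := contact_bound hp1 hp2 P1 x hy1 i (-h)
  have d0 := sd_lower hp1 hp2 hh P0 x i
  have d1 := sd_lower hp1 hp2 hh P1 x i
  rw [abs_neg] at b0 b1
  rw [← single_sub] at b0 b1
  rw [abs_of_nonneg hh] at a0 b0 a1 b1
  have hph : 0 ≤ p * h := by positivity
  rw [← abs_of_nonneg hph, ← abs_mul]
  have g1 := le_abs_self ((φ0 x - φ1 x) - (φ0 (x - Pi.single i h) - φ1 (x - Pi.single i h)))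
  have g2 := neg_abs_le ((φ0 x - φ1 x) - (φ0 (x - Pi.single i h) - φ1 (x - Pi.single i h)))
  have e : p * h * (sg p (x i - y0 i) - sg p (x i - y1 i)) =
    p * sg p (x i - y0 i) * h - p * sg p (x i - y1 i) * h := by ring
  have hhp : 0 ≤ h ^ p := by positivity
  unfold sd at *
  rw [abs_le, e]
  constructor <;> linarith

/-- translation of a set integral -/
lemma setInt_translate {d : ℕ} {G : Set (Vec d)} (hG : MeasurableSet G) (f : Vec d → ℝ)
    (v : Vec d) : ∫ x in G, f (x + v) = ∫ x in {x | x - v ∈ G}, f x := by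
  have hG' : MeasurableSet {x : Vec d | x - v ∈ G} := measurable_sub_const v hG
  rw [← integral_indicator hG, ← integral_indicator hG',
    ← integral_add_right_eq_self (fun x => Set.indicator {x | x - v ∈ G} f x) v]
  congr 1
  ext x
  have hm : (x + v ∈ {x : Vec d | x - v ∈ G}) ↔ x ∈ G := by
    show x + v - v ∈ G ↔ _
    rw [add_sub_cancel_right]
  by_cases hx : x ∈ G
  · rw [Set.indicator_of_mem hx, Set.indicator_of_mem (hm.2 hx)]
  · rw [Set.indicator_of_notMem hx, Set.indicator_of_notMem (fun h => hx (hm.1 h))]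

lemma setInt_diff_le {d : ℕ} {A B : Set (Vec d)} (hA : MeasurableSet A) (hB : MeasurableSet B)
    {g : Vec d → ℝ} (iA : IntegrableOn g A) (iB : IntegrableOn g B) {K a b : ℝ}
    (hK : 0 ≤ K) (bA : ∀ x ∈ A, |g x| ≤ K) (bB : ∀ x ∈ B, |g x| ≤ K)
    (fA : volume (A \ B) < ∞) (fB : volume (B \ A) < ∞)
    (ha : volume.real (A \ B) ≤ a) (hb : volume.real (B \ A) ≤ b) :
    (∫ x in A, g x) - ∫ x in B, g x ≤ K * (a + b) := by
  have e1 := integral_inter_add_sdiff hB iA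
  have e2 := integral_inter_add_sdiff hA iB
  rw [Set.inter_comm] at e2
  have n1 := norm_setIntegral_le_of_norm_le_const (f := g) (C := K) fA
    (fun x hx => bA x hx.1)
  have n2 := norm_setIntegral_le_of_norm_le_const (f := g) (C := K) fB
    (fun x hx => bB x hx.1)
  rw [Real.norm_eq_abs, abs_le] at n1 n2
  have m1 := mul_le_mul_of_nonneg_left ha hK
  have m2 := mul_le_mul_of_nonneg_left hb hK
  linarith [n1.2, n2.1]

/-- good set -/
def gset {d : ℕ} (X : Set (Vec d)) (v : Vec d) : Set (Vec d) := {x | x ∈ X ∧ x + v ∈ X ∧ x - v ∈ X}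

lemma gset_meas {d : ℕ} {X : Set (Vec d)} (hX : MeasurableSet X) (v : Vec d) :
    MeasurableSet (gset X v) := by
  unfold gset
  exact hX.inter ((measurable_add_const v hX).inter (measurable_sub_const v hX))

lemma sd_integral {d : ℕ} {X : Set (Vec d)} (hXc : IsCompact X) {Cb : ℝ} 
    (hCb : ∀ v : Vec d, volume.real {x | x ∈ X ∧ x + v ∉ X} ≤ Cb * ‖v‖)
    {φ : Vec d → ℝ} (cφ : Continuous φ) {K : ℝ} (hK : 0 ≤ K) (v : Vec d)
    (hlip : ∀ x ∈ X, x + v ∈ X → |φ (x + v) - φ x| ≤ K) :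
    ∫ x in gset X v, sd φ v x ≤ K * (Cb * ‖v‖ * 3) := by
  have hXm := hXc.measurableSet
  have hG := gset_meas hXm v
  have hXf : volume X < ∞ := hXc.measure_lt_top
  set g : Vec d → ℝ := fun x => φ x - φ (x - v) with hg
  have cg : Continuous g := by rw [hg]; fun_prop
  have iX : IntegrableOn g X := cg.continuousOn.integrableOn_compact hXc
  have GX : gset X v ⊆ X := fun x hx => hx.1
  set G' : Set (Vec d) := {x | x - v ∈ gset X v} with hG'
  have hG'm : MeasurableSet G' := measurable_sub_const v hG
  have G'X : G' ⊆ X := by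
    intro x hx
    have := hx.2.1
    simpa using this
  have e1 : ∫ x in gset X v, sd φ v x = (∫ x in gset X v, g x) - ∫ x in G', g x := by
    rw [← setInt_translate hG g v, ← integral_sub (iX.mono_set GX)]
    · congr 1
      ext x
      simp only [sd, hg, add_sub_cancel_right]; ring
    · have : Continuous fun x => g (x + v) := by fun_prop
      exact (this.continuousOn.integrableOn_compact hXc).mono_set GX
  rw [e1]
  have hfin : ∀ S : Set (Vec d), S ⊆ X → volume S < ∞ := fun S hS => (measure_mono hS).trans_lt hXf
  refine (setInt_diff_le (a := 2 * (Cb * ‖v‖)) (b := Cb * ‖v‖) hG hG'm (iX.mono_set GX)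
    (iX.mono_set G'X) hK ?_ ?_ (hfin _ (Set.sdiff_subset.trans GX))
    (hfin _ (Set.sdiff_subset.trans G'X)) ?_ ?_).trans (le_of_eq (by ring))
  · intro x hx
    have := hlip (x - v) hx.2.2 (by simpa using hx.1)
    simpa [hg] using this
  · intro x hx
    have := hlip (x - v) hx.1 (by simpa using hx.2.1)
    simpa [hg] using this
  · have h1 := hCb (-(2 • v))
    rw [norm_neg, two_smul] at h1
    have h2 : ‖v + v‖ ≤ 2 * ‖v‖ := (norm_add_le v v).trans (by linarith)
    have hCb0 : 0 ≤ Cb * ‖v‖ := le_trans measureReal_nonneg (hCb v)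
    have h3 : Cb * ‖v + v‖ = 2 * (Cb * ‖v‖) := by
      rw [← two_smul ℝ v, norm_smul]; norm_num; ring
    rw [h3] at h1
    refine le_trans (measureReal_mono ?_ (hfin _ fun x hx => hx.1).ne) h1
    rintro x ⟨hx, hx'⟩
    refine ⟨hx.1, fun hc => hx' ⟨hx.2.2, by simpa using hx.1, ?_⟩⟩
    have : x + -(v + v) = x - v - v := by abel
    rwa [this] at hc
  · refine le_trans (measureReal_mono ?_ (hfin _ fun x hx => hx.1).ne) (hCb v)
    rintro x ⟨hx, hx'⟩
    refine ⟨G'X hx, fun hc => hx' ⟨G'X hx, hc, hx.1⟩⟩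


/-! ### Part 8: gradient step -/

/-- majorant at good points -/
def qh {d : ℕ} (p R h k : ℝ) (φ0 φ1 : Vec d → ℝ) (v x : Vec d) : ℝ :=
  2 * ((φ0 x - φ1 x - k) ^ 2 + (φ0 (x - v) - φ1 (x - v) - k) ^ 2) +
    (2 * (p * R ^ (p - 1)) + 8) * h * ((sd φ0 v x + 8 * h ^ p) + (sd φ1 v x + 8 * h ^ p)) +
    64 * (h ^ p) ^ 2

lemma sum_abs_single {d : ℕ} (x : Vec d) (i : Fin d) {h : ℝ} (hh : 0 ≤ h) :
    ∑ j, |x j - (x + Pi.single i h : Vec d) j| = h ∧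
    ∑ j, |x j - (x - Pi.single i h : Vec d) j| = h := by
  constructor
  · rw [Finset.sum_eq_single i]
    · simp [abs_of_nonneg hh]
    · intro j _ hj; simp [hj]
    · simp
  · rw [Finset.sum_eq_single i]
    · simp [abs_of_nonneg hh]
    · intro j _ hj; simp [hj]
    · simp

lemma sd_upper {p R h : ℝ} (hp1 : 1 < p) (hh : 0 < h) (hh1 : h ≤ 1) {d : ℕ}
    {X : Set (Vec d)} {φ ψ : Vec d → ℝ} (P : Pot p R X φ ψ) (i : Fin d) {x : Vec d}
    (hx : x ∈ gset X (Pi.single i h)) :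
    sd φ (Pi.single i h) x + 8 * h ^ p ≤ (2 * (p * R ^ (p - 1)) + 8) * h := by
  have h1 := P.lφ x hx.1 _ hx.2.1
  have h2 := P.lφ x hx.1 _ hx.2.2
  rw [(sum_abs_single x i hh.le).1] at h1
  rw [(sum_abs_single x i hh.le).2] at h2
  have h3 : h ^ p ≤ h := by
    nth_rewrite 2 [← Real.rpow_one h]
    exact Real.rpow_le_rpow_of_exponent_ge hh hh1 hp1.le
  unfold sd
  linarith

lemma sq_five (a b c d e : ℝ) :
    (a + b + c + d + e) ^ 2 ≤ 5 * (a ^ 2 + b ^ 2 + c ^ 2 + d ^ 2 + e ^ 2) := by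
  nlinarith [sq_nonneg (a - b), sq_nonneg (a - c), sq_nonneg (a - d), sq_nonneg (a - e),
    sq_nonneg (b - c), sq_nonneg (b - d), sq_nonneg (b - e), sq_nonneg (c - d),
    sq_nonneg (c - e), sq_nonneg (d - e)]

/-- bound for slack -/
def Ms (p R : ℝ) (d : ℕ) : ℝ := d * R ^ p + 2 * Mb p R d

lemma slack_bound {p R : ℝ} (hp1 : 1 < p) {d : ℕ}
    {X : Set (Vec d)} (hR : ∀ x ∈ X, ∀ y ∈ X, ∀ i, |x i - y i| ≤ R)
    {φ ψ : Vec d → ℝ} (P : Pot p R X φ ψ) {x y : Vec d} (hx : x ∈ X) (hy : y ∈ X) :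
    0 ≤ cst p 0 x y - φ x - ψ y ∧ cst p 0 x y - φ x - ψ y ≤ Ms p R d := by
  have h1 := P.le x y hy
  have h2 := cst_le (by linarith : 0 < p) hR hx hy
  have h3 := neg_le_of_abs_le (P.bφ x hx)
  have h4 := neg_le_of_abs_le (P.bψ y hy)
  unfold Ms
  constructor <;> linarith

lemma qh_nonneg {p R h k : ℝ} (hp1 : 1 < p) (hp2 : p ≤ 2) (hR0 : 0 < R) (hh : 0 < h) {d : ℕ}
    {X : Set (Vec d)} [Nonempty X] [CompactSpace X]
    {φ0 ψ0 φ1 ψ1 : Vec d → ℝ} (P0 : Pot p R X φ0 ψ0) (P1 : Pot p R X φ1 ψ1) (x : Vec d)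
    (i : Fin d) : 0 ≤ qh p R h k φ0 φ1 (Pi.single i h) x := by
  have d0 := sd_lower hp1 hp2 hh.le P0 x i
  have d1 := sd_lower hp1 hp2 hh.le P1 x i
  unfold qh
  positivity

lemma grad_pointwise {p R h : ℝ} (k : ℝ) (hp1 : 1 < p) (hp2 : p ≤ 2) (hR0 : 0 < R) (hh : 0 < h)
    (hh1 : h ≤ 1) {d : ℕ} {X : Set (Vec d)} [Nonempty X] [CompactSpace X]
    (hR : ∀ x ∈ X, ∀ y ∈ X, ∀ i, |x i - y i| ≤ R)
    {φ0 ψ0 φ1 ψ1 : Vec d → ℝ} (P0 : Pot p R X φ0 ψ0) (P1 : Pot p R X φ1 ψ1) (i : Fin d)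
    {x : Vec d} (hx : x ∈ gset X (Pi.single i h))
    {y0 y1 : Vec d} (hy0 : y0 ∈ X) (hy1 : y1 ∈ X) :
    h ^ 2 * (y0 i - y1 i) ^ 2 ≤ 5 * (R ^ (2 - p) / (p - 1) / p) ^ 2 *
      (qh p R h k φ0 φ1 (Pi.single i h) x + 2 * Ms p R d *
        ((cst p 0 x y0 - φ0 x - ψ0 y0) + (cst p 0 x y1 - φ1 x - ψ1 y1))) := by
  have hp : 0 < p := by linarith
  have hp' : 0 < p - 1 := by linarith
  set Kc := R ^ (2 - p) / (p - 1) with hKc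
  have hKc0 : 0 < Kc := by positivity
  have hfd := fd_pointwise hp1 hp2 hh.le P0 P1 x hy0 hy1 i
  have hs := sg_lower hp1 hp2 hR0 (hR x hx.1 y0 hy0 i) (hR x hx.1 y1 hy1 i)
  have d0 := sd_lower hp1 hp2 hh.le P0 x i
  have d1 := sd_lower hp1 hp2 hh.le P1 x i
  have u0 := sd_upper hp1 hh hh1 P0 i hx
  have u1 := sd_upper hp1 hh hh1 P1 i hx
  obtain ⟨s0, t0⟩ := slack_bound hp1 hR P0 hx.1 hy0
  obtain ⟨s1, t1⟩ := slack_bound hp1 hR P1 hx.1 hy1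
  set T := |sg p (x i - y0 i) - sg p (x i - y1 i)| with hT
  have hT0 : 0 ≤ T := abs_nonneg _
  unfold qh
  set D0 := sd φ0 (Pi.single i h) x + 8 * h ^ p
  set D1 := sd φ1 (Pi.single i h) x + 8 * h ^ p
  set σ0 := cst p 0 x y0 - φ0 x - ψ0 y0
  set σ1 := cst p 0 x y1 - φ1 x - ψ1 y1
  set A := 2 * (p * R ^ (p - 1)) + 8
  set a := φ0 x - φ1 x
  set b := φ0 (x - Pi.single i h) - φ1 (x - Pi.single i h)
  have e1 : |y0 i - y1 i| ≤ Kc * T := by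
    have e : x i - y0 i - (x i - y1 i) = -(y0 i - y1 i) := by ring
    rw [e, abs_neg] at hs
    exact hs
  have e2 : h ^ 2 * (y0 i - y1 i) ^ 2 ≤ (Kc / p) ^ 2 * (p * h * T) ^ 2 := by
    have : (Kc / p) ^ 2 * (p * h * T) ^ 2 = h ^ 2 * (Kc * T) ^ 2 := by field_simp
    rw [this, ← sq_abs (y0 i - y1 i)]
    gcongr
  refine e2.trans ?_
  have e3 : (p * h * T) ^ 2 ≤ (|a - b| + D0 + D1 + 8 * h ^ p + (σ0 + σ1)) ^ 2 := by
    gcongr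
  have e4 := sq_five (|a - b|) D0 D1 (8 * h ^ p) (σ0 + σ1)
  have e5 : |a - b| ^ 2 ≤ 2 * ((a - k) ^ 2 + (b - k) ^ 2) := by
    rw [sq_abs]; nlinarith [sq_nonneg ((a - k) + (b - k))]
  have e6 : D0 ^ 2 ≤ A * h * D0 := by rw [sq]; gcongr
  have e7 : D1 ^ 2 ≤ A * h * D1 := by rw [sq]; gcongr
  have e8 : (σ0 + σ1) ^ 2 ≤ 2 * Ms p R d * (σ0 + σ1) := by
    rw [sq]; apply mul_le_mul_of_nonneg_right <;> linarith
  have e9 : (8 * h ^ p) ^ 2 = 64 * (h ^ p) ^ 2 := by ring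
  rw [mul_comm 5, mul_assoc (_ ^ 2) 5]
  refine mul_le_mul_of_nonneg_left ?_ (sq_nonneg (Kc / p))
  rw [mul_add (A * h)]
  linarith

lemma qh_cont {d : ℕ} {p R h k : ℝ} {φ0 φ1 : Vec d → ℝ} (c0 : Continuous φ0) (c1 : Continuous φ1)
    (v : Vec d) : Continuous (qh p R h k φ0 φ1 v) := by
  unfold qh sd
  fun_prop

lemma qh_integral {p R h k N Cb : ℝ} (hp1 : 1 < p) (hp2 : p ≤ 2) (hR0 : 0 < R) (hh : 0 < h)
    (hh1 : h ≤ 1) {d : ℕ} {X : Set (Vec d)} (hXc : IsCompact X) 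
    (hCb0 : 0 ≤ Cb) (hCb : ∀ v : Vec d, volume.real {x | x ∈ X ∧ x + v ∉ X} ≤ Cb * ‖v‖)
    {φ0 ψ0 φ1 ψ1 : Vec d → ℝ} (P0 : Pot p R X φ0 ψ0) (P1 : Pot p R X φ1 ψ1) (i : Fin d)
    (hN : ∫ x in X, (φ0 x - φ1 x - k) ^ 2 ≤ N) :
    ∫ x in gset X (Pi.single i h), qh p R h k φ0 φ1 (Pi.single i h) x ≤
      (4 + (2 * (p * R ^ (p - 1)) + 8) * 2 * (3 * (p * R ^ (p - 1)) * Cb + 8 * volume.real X)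
        + 64 * volume.real X) * (N + h ^ (p + 1)) := by
  have hp : 0 < p := by linarith
  have hXm := hXc.measurableSet
  set v : Vec d := Pi.single i h with hv
  set G := gset X v with hG
  have hGm : MeasurableSet G := gset_meas hXm v
  have GX : G ⊆ X := fun x hx => hx.1
  set L := p * R ^ (p - 1) with hL
  have hL0 : 0 < L := by positivity
  set A := 2 * L + 8 with hA
  set V := volume.real X with hV
  have hV0 : 0 ≤ V := measureReal_nonneg
  have hItg : ∀ f : Vec d → ℝ, Continuous f → IntegrableOn f G := fun f hf =>
    (hf.continuousOn.integrableOn_compact hXc).mono_set GX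
  have hItgX : ∀ f : Vec d → ℝ, Continuous f → IntegrableOn f X := fun f hf =>
    (hf.continuousOn.integrableOn_compact hXc)
  have c0 := P0.cφ
  have c1 := P1.cφ
  have hnv : ‖v‖ = h := by
    rw [hv, Pi.norm_single, Real.norm_eq_abs, abs_of_pos hh]
  have hVG : volume.real G ≤ V := measureReal_mono GX hXc.measure_lt_top.ne
  have cw : Continuous fun x => (φ0 x - φ1 x - k) ^ 2 := by fun_prop
  have cw' : Continuous fun x => (φ0 (x - v) - φ1 (x - v) - k) ^ 2 := by fun_prop
  have I1 : ∫ x in G, (φ0 x - φ1 x - k) ^ 2 ≤ N :=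
    (setIntegral_mono_set (hItgX _ cw) (Filter.Eventually.of_forall fun x => sq_nonneg _)
      (Filter.Eventually.of_forall GX)).trans hN
  have I2 : ∫ x in G, (φ0 (x - v) - φ1 (x - v) - k) ^ 2 ≤ N := by
    have := setInt_translate hGm (fun x => (φ0 x - φ1 x - k) ^ 2) (-v)
    simp only [← sub_eq_add_neg, sub_neg_eq_add] at this
    rw [this]
    refine (setIntegral_mono_set (hItgX _ cw) (Filter.Eventually.of_forall fun x => sq_nonneg _)
      (Filter.Eventually.of_forall ?_)).trans hN
    intro x hx
    have h2 : x + v - v ∈ X := hx.2.2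
    rwa [add_sub_cancel_right] at h2
  have J : ∀ φ ψ : Vec d → ℝ, Pot p R X φ ψ →
      ∫ x in G, (sd φ v x + 8 * h ^ p) ≤ L * h * (Cb * h * 3) + 8 * h ^ p * V := by
    intro φ ψ P
    have cφ := P.cφ
    have csd : Continuous fun x => sd φ v x := by unfold sd; fun_prop
    rw [integral_add (hItg _ csd) (hItg _ continuous_const)]
    have h1 := sd_integral hXc hCb P.cφ (K := L * h) (by positivity) v (by
      intro x hx hx'
      have a1 := P.lφ x hx _ hx'
      have a2 := P.lφ _ hx' x hx
      have e : ∑ j, |(x + v) j - x j| = h := by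
        rw [← (sum_abs_single x i hh.le).1]
        exact Finset.sum_congr rfl fun j _ => abs_sub_comm _ _
      rw [e] at a2
      rw [(sum_abs_single x i hh.le).1] at a1
      rw [abs_le]
      constructor <;> linarith)
    rw [hnv] at h1
    have h2 : ∫ x in G, 8 * h ^ p ≤ 8 * h ^ p * V := by
      rw [setIntegral_const, smul_eq_mul, mul_comm]
      gcongr
    exact add_le_add h1 h2
  have J0 := J φ0 ψ0 P0
  have J1 := J φ1 ψ1 P1
  have cs : ∀ φ : Vec d → ℝ, Continuous φ → Continuous fun x => sd φ v x + 8 * h ^ p := by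
    intro φ hφ; unfold sd; fun_prop
  have eq : ∫ x in G, qh p R h k φ0 φ1 v x = 2 * ((∫ x in G, (φ0 x - φ1 x - k) ^ 2) +
      ∫ x in G, (φ0 (x - v) - φ1 (x - v) - k) ^ 2) + A * h * ((∫ x in G, (sd φ0 v x + 8 * h ^ p)) +
      ∫ x in G, (sd φ1 v x + 8 * h ^ p)) + 64 * (h ^ p) ^ 2 * volume.real G := by
    unfold qh
    rw [integral_add, integral_add, integral_const_mul, integral_const_mul, integral_add,
      integral_add, setIntegral_const, smul_eq_mul, mul_comm (volume.real G)]
    · exact hItg _ (cs φ0 c0)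
    · exact hItg _ (cs φ1 c1)
    · exact hItg _ cw
    · exact hItg _ cw'
    · exact hItg _ ((cw.add cw').const_mul 2)
    · exact hItg _ (((cs φ0 c0).add (cs φ1 c1)).const_mul _)
    · exact hItg _ (((cw.add cw').const_mul 2).add (((cs φ0 c0).add (cs φ1 c1)).const_mul _))
    · exact hItg _ continuous_const
  rw [eq]
  have hH : h ^ (p + 1) = h * h ^ p := by
    rw [Real.rpow_add hh, Real.rpow_one, mul_comm]
  have hpp : h ^ p ≤ h := by
    nth_rewrite 2 [← Real.rpow_one h]
    exact Real.rpow_le_rpow_of_exponent_ge hh hh1 hp1.le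
  have hhp : 0 < h ^ p := by positivity
  set H := h ^ (p + 1) with hHd
  have hH0 : 0 < H := by positivity
  have hN0 : 0 ≤ N := le_trans (integral_nonneg fun x => sq_nonneg _) I1
  have q1 : (h ^ p) ^ 2 ≤ H := by rw [hH, sq]; gcongr
  have q2 : h * (h * h) ≤ H := by
    rw [hH]
    have : h * h ≤ h ^ p := by
      rw [← sq, ← Real.rpow_natCast]
      exact Real.rpow_le_rpow_of_exponent_ge hh hh1 (by push_cast; exact hp2)
    gcongr
  have r1 : A * h * ((∫ x in G, (sd φ0 v x + 8 * h ^ p)) + ∫ x in G, (sd φ1 v x + 8 * h ^ p)) ≤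
      A * 2 * (3 * L * Cb + 8 * V) * H := by
    calc _ ≤ A * h * ((L * h * (Cb * h * 3) + 8 * h ^ p * V) + 
          (L * h * (Cb * h * 3) + 8 * h ^ p * V)) := by gcongr
      _ = A * 2 * (3 * L * Cb * (h * (h * h)) + 8 * V * (h * h ^ p)) := by ring
      _ ≤ A * 2 * (3 * L * Cb * H + 8 * V * H) := by rw [← hH]; gcongr
      _ = _ := by ring
  have r2 : 64 * (h ^ p) ^ 2 * volume.real G ≤ 64 * V * H := by
    calc _ ≤ 64 * H * V := by gcongr
      _ = _ := by ring
  have r3 : 0 ≤ A * 2 * (3 * L * Cb + 8 * V) * N := by positivity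
  have r4 : 0 ≤ 64 * V * N := by positivity
  nlinarith


/-! ### Part 9: gradient step, integrated -/

lemma bad_measure {d : ℕ} {X : Set (Vec d)} (hXc : IsCompact X) {Cb : ℝ}
    (hCb : ∀ v : Vec d, volume.real {x | x ∈ X ∧ x + v ∉ X} ≤ Cb * ‖v‖) (v : Vec d) :
    volume.real (X \ gset X v) ≤ 2 * (Cb * ‖v‖) := by
  have h1 := hCb v
  have h2 := hCb (-v)
  rw [norm_neg] at h2
  have hf : ∀ S : Set (Vec d), S ⊆ X → volume S ≠ ∞ := fun S hS =>
    ((measure_mono hS).trans_lt hXc.measure_lt_top).ne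
  calc volume.real (X \ gset X v)
      ≤ volume.real ({x | x ∈ X ∧ x + v ∉ X} ∪ {x | x ∈ X ∧ x + -v ∉ X}) := by
        refine measureReal_mono ?_ (hf _ ?_)
        · rintro x ⟨hx, hx'⟩
          by_cases h3 : x + v ∈ X
          · right
            refine ⟨hx, fun h4 => hx' ⟨hx, h3, ?_⟩⟩
            rwa [sub_eq_add_neg]
          · left; exact ⟨hx, h3⟩
        · rintro x (hx | hx)
          · exact hx.1
          · exact hx.1
    _ ≤ _ := measureReal_union_le _ _
    _ ≤ _ := by linarith

lemma grad_step {p R : ℝ} (hp1 : 1 < p) (hp2 : p ≤ 2) (hR0 : 0 < R) {d : ℕ} {X : Set (Vec d)}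
    (hXc : IsCompact X) (hcv : Convex ℝ X) (hV : 0 < volume.real X)
    (hR : ∀ x ∈ X, ∀ y ∈ X, ∀ i, |x i - y i| ≤ R)
    {ρ : Measure (Vec d)} (hρ : ProbOn ρ X) {c : ℝ} (hc : 0 ≤ c)
    (hup : ρ ≤ ENNReal.ofReal c • volume.restrict X) :
    ∃ C : ℝ, 0 ≤ C ∧ ∀ h N η k : ℝ, 0 < h → h ≤ 1 →
      ∀ Γ : Measure (Vec d × (Vec d × Vec d)), IsProbabilityMeasure Γ → Γ.map Prod.fst = ρ →
      Γ (X ×ˢ (X ×ˢ X))ᶜ = 0 → ∀ φ0 ψ0 φ1 ψ1 : Vec d → ℝ,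
      Pot p R X φ0 ψ0 → Pot p R X φ1 ψ1 →
      ∫ t, (cst p 0 t.1 t.2.1 - φ0 t.1 - ψ0 t.2.1) ∂Γ ≤ η →
      ∫ t, (cst p 0 t.1 t.2.2 - φ1 t.1 - ψ1 t.2.2) ∂Γ ≤ η →
      ∫ x in X, (φ0 x - φ1 x - k) ^ 2 ≤ N →
      ∀ i, h ^ 2 * ∫ t, (t.2.1 i - t.2.2 i) ^ 2 ∂Γ ≤ C * (N + h ^ (p + 1) + η) := by
  have hp : 0 < p := by linarith
  have hXm := hXc.measurableSet
  have hXn : X.Nonempty := by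
    by_contra hne
    rw [Set.not_nonempty_iff_eq_empty] at hne
    simp [hne] at hV
  have : Nonempty X := hXn.to_subtype
  have : CompactSpace X := isCompact_iff_compactSpace.1 hXc
  obtain ⟨Cb, hCb0, hCb⟩ := boundary_layer hXc hcv hV
  set Cq := 4 + (2 * (p * R ^ (p - 1)) + 8) * 2 * (3 * (p * R ^ (p - 1)) * Cb + 8 * volume.real X)
        + 64 * volume.real X with hCq
  have hCq0 : 0 ≤ Cq := by positivity
  have hp' : 0 < p - 1 := by linarith
  set K5 := 5 * (R ^ (2 - p) / (p - 1) / p) ^ 2 with hK5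
  have hK50 : 0 ≤ K5 := by positivity
  have hMs0 : 0 ≤ Ms p R d := by unfold Ms Mb; positivity
  refine ⟨R ^ 2 * (c * (2 * Cb)) + K5 * (c * Cq) + K5 * (2 * Ms p R d * 2), by positivity, ?_⟩
  intro h N η k hh hh1 Γ hΓ hΓρ hΓX φ0 ψ0 φ1 ψ1 P0 P1 hs0 hs1 hN i
  set v : Vec d := Pi.single i h with hv
  have hnv : ‖v‖ = h := by
    rw [hv, Pi.norm_single, Real.norm_eq_abs, abs_of_pos hh]
  set G := gset X v with hG
  have hGm : MeasurableSet G := gset_meas hXm v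
  have GX : G ⊆ X := fun x hx => hx.1
  have hcomp : IsCompact (X ×ˢ (X ×ˢ X)) := hXc.prod (hXc.prod hXc)
  have hItg : ∀ f : Vec d × (Vec d × Vec d) → ℝ, Continuous f → Integrable f Γ := fun f hf =>
    int_of_cont hcomp hΓX hf.continuousOn
  have hρP : IsProbabilityMeasure ρ := hρ.1
  have cφ0 := P0.cφ
  have cφ1 := P1.cφ
  have cψ0 := P0.cψ
  have cψ1 := P1.cψ
  set σ0 : Vec d × (Vec d × Vec d) → ℝ := fun t => cst p 0 t.1 t.2.1 - φ0 t.1 - ψ0 t.2.1 with hσ0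
  set σ1 : Vec d × (Vec d × Vec d) → ℝ := fun t => cst p 0 t.1 t.2.2 - φ1 t.1 - ψ1 t.2.2 with hσ1
  have iσ0 : Integrable σ0 Γ := by
    apply hItg
    have := cst_cont hp 0 (continuous_fst : Continuous fun t : Vec d × (Vec d × Vec d) => t.1)
      (by fun_prop : Continuous fun t : Vec d × (Vec d × Vec d) => t.2.1)
    rw [hσ0]; fun_prop
  have iσ1 : Integrable σ1 Γ := by
    apply hItg
    have := cst_cont hp 0 (continuous_fst : Continuous fun t : Vec d × (Vec d × Vec d) => t.1)
      (by fun_prop : Continuous fun t : Vec d × (Vec d × Vec d) => t.2.2)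
    rw [hσ1]; fun_prop
  set q := qh p R h k φ0 φ1 v with hq
  have cq : Continuous q := qh_cont cφ0 cφ1 v
  have iq : Integrable (G.indicator q) ρ :=
    (int_of_cont hXc hρ.2 cq.continuousOn).indicator hGm
  have ib : Integrable ((X \ G).indicator (fun _ => (1 : ℝ))) ρ :=
    (integrable_const 1).indicator (hXm.diff hGm)
  have iq' : Integrable (fun t => G.indicator q t.1) Γ := by
    rw [← hΓρ] at iq
    exact iq.comp_measurable measurable_fst
  have ib' : Integrable (fun t => (X \ G).indicator (fun _ => (1 : ℝ)) t.1) Γ := by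
    rw [← hΓρ] at ib
    exact ib.comp_measurable measurable_fst
  have eq' : ∫ t, G.indicator q t.1 ∂Γ = ∫ x in G, q x ∂ρ := by
    rw [← integral_indicator hGm]
    conv_rhs => rw [← hΓρ]
    rw [integral_map measurable_fst.aemeasurable]
    rw [hΓρ]; exact iq.aestronglyMeasurable
  have eb' : ∫ t, (X \ G).indicator (fun _ => (1 : ℝ)) t.1 ∂Γ = ρ.real (X \ G) := by
    rw [← integral_indicator_one (hXm.diff hGm)]
    conv_rhs => rw [← hΓρ]
    rw [integral_map measurable_fst.aemeasurable]
    · rfl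
    · rw [hΓρ]; exact ib.aestronglyMeasurable
  have hb : ρ.real (X \ G) ≤ c * (2 * (Cb * h)) := by
    have h1 := bad_measure hXc hCb v
    rw [hnv] at h1
    have h2 : ρ (X \ G) ≤ ENNReal.ofReal c * volume (X \ G) := by
      have := hup (X \ G)
      rw [Measure.smul_apply, Measure.restrict_apply (hXm.diff hGm), smul_eq_mul,
        Set.inter_eq_left.2 Set.sdiff_subset] at this
      exact this
    have hf : volume (X \ G) ≠ ∞ :=
      ((measure_mono Set.sdiff_subset).trans_lt hXc.measure_lt_top).ne
    have h3 := ENNReal.toReal_mono (ENNReal.mul_ne_top ENNReal.ofReal_ne_top hf) h2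
    rw [ENNReal.toReal_mul, ENNReal.toReal_ofReal hc] at h3
    exact h3.trans (mul_le_mul_of_nonneg_left h1 hc)
  have hqi : ∫ x in G, q x ∂ρ ≤ c * (Cq * (N + h ^ (p + 1))) := by
    have h1 := qh_integral hp1 hp2 hR0 hh hh1 hXc hCb0 hCb P0 P1 i hN
    have h2 : ∫ x in G, q x ∂ρ ≤ ∫ x in G, q x ∂(ENNReal.ofReal c • volume.restrict X) := by
      apply integral_mono_measure (Measure.restrict_mono le_rfl hup)
      · exact Filter.Eventually.of_forall fun x => qh_nonneg hp1 hp2 hR0 hh P0 P1 x i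
      · apply Integrable.integrableOn
        exact ((cq.continuousOn.integrableOn_compact hXc).smul_measure ENNReal.ofReal_ne_top)
    rw [Measure.restrict_smul, integral_smul_measure, ENNReal.toReal_ofReal hc, smul_eq_mul,
      Measure.restrict_restrict hGm, Set.inter_eq_left.2 GX] at h2
    exact h2.trans (mul_le_mul_of_nonneg_left h1 hc)
  have hae : ∀ᵐ t ∂Γ, t ∈ X ×ˢ (X ×ˢ X) := by rw [ae_iff]; exact hΓX
  have hmain : ∫ t, h ^ 2 * (t.2.1 i - t.2.2 i) ^ 2 ∂Γ ≤
      ∫ t, (h ^ 2 * R ^ 2 * (X \ G).indicator (fun _ => (1 : ℝ)) t.1 + K5 * G.indicator q t.1 +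
        K5 * (2 * Ms p R d) * (σ0 t + σ1 t)) ∂Γ := by
    apply integral_mono_ae
    · exact hItg _ (by fun_prop)
    · exact ((ib'.const_mul _).add (iq'.const_mul _)).add ((iσ0.add iσ1).const_mul _)
    · filter_upwards [hae] with t ht
      obtain ⟨hx, hy0, hy1⟩ := ht
      have s0 := (slack_bound hp1 hR P0 hx hy0).1
      have s1 := (slack_bound hp1 hR P1 hx hy1).1
      have s0' : 0 ≤ σ0 t := s0
      have s1' : 0 ≤ σ1 t := s1
      by_cases hg : t.1 ∈ G
      · have h1 : t.1 ∉ X \ G := fun h => h.2 hg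
        rw [Set.indicator_of_mem hg, Set.indicator_of_notMem h1]
        have := grad_pointwise k hp1 hp2 hR0 hh hh1 hR P0 P1 i hg hy0 hy1
        refine this.trans (le_of_eq ?_)
        simp only [hK5, hq, hσ0, hσ1]
        ring
      · have h1 : t.1 ∈ X \ G := ⟨hx, hg⟩
        rw [Set.indicator_of_mem h1, Set.indicator_of_notMem hg]
        have h2 : (t.2.1 i - t.2.2 i) ^ 2 ≤ R ^ 2 := by
          rw [← sq_abs]
          have := hR _ hy0 _ hy1 i
          gcongr
        have h3 : h ^ 2 * (t.2.1 i - t.2.2 i) ^ 2 ≤ h ^ 2 * R ^ 2 := by gcongr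
        have h4 : 0 ≤ K5 * (2 * Ms p R d) * (σ0 t + σ1 t) := by positivity
        linarith
  rw [integral_const_mul, integral_add, integral_add, integral_const_mul, integral_const_mul,
    integral_const_mul, integral_add iσ0 iσ1, eq', eb'] at hmain
  · refine hmain.trans ?_
    have hN0 : 0 ≤ N := le_trans (integral_nonneg fun x => sq_nonneg _) hN
    have hσ0n : 0 ≤ ∫ t, σ0 t ∂Γ := by
      apply integral_nonneg_of_ae
      filter_upwards [hae] with t ht
      exact (slack_bound hp1 hR P0 ht.1 ht.2.1).1
    have hη0 : 0 ≤ η := hσ0n.trans hs0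
    have hH : h ^ 2 * h ≤ h ^ (p + 1) := by
      have : h ^ 2 * h = h ^ (3 : ℝ) := by
        rw [show (3 : ℝ) = ((3 : ℕ) : ℝ) by norm_num, Real.rpow_natCast]; ring
      rw [this]
      exact Real.rpow_le_rpow_of_exponent_ge hh hh1 (by linarith)
    set H := h ^ (p + 1) with hHd
    have hH0 : 0 < H := by positivity
    have t1 : h ^ 2 * R ^ 2 * ρ.real (X \ G) ≤ R ^ 2 * (c * (2 * Cb)) * H := by
      calc _ ≤ h ^ 2 * R ^ 2 * (c * (2 * (Cb * h))) := by gcongr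
        _ = R ^ 2 * (c * (2 * Cb)) * (h ^ 2 * h) := by ring
        _ ≤ _ := by gcongr
    have t2 : K5 * ∫ x in G, q x ∂ρ ≤ K5 * (c * Cq) * (N + H) := by
      calc _ ≤ K5 * (c * (Cq * (N + H))) := by gcongr
        _ = _ := by ring
    have t3 : K5 * (2 * Ms p R d) * (∫ t, σ0 t ∂Γ + ∫ t, σ1 t ∂Γ) ≤
        K5 * (2 * Ms p R d * 2) * η := by
      calc _ ≤ K5 * (2 * Ms p R d) * (η + η) := by gcongr
        _ = _ := by ring
    calc _ ≤ R ^ 2 * (c * (2 * Cb)) * H + K5 * (c * Cq) * (N + H) +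
          K5 * (2 * Ms p R d * 2) * η := add_le_add (add_le_add t1 t2) t3
      _ ≤ R ^ 2 * (c * (2 * Cb)) * (N + H + η) + K5 * (c * Cq) * (N + H + η) +
          K5 * (2 * Ms p R d * 2) * (N + H + η) := by
        refine add_le_add (add_le_add ?_ ?_) ?_ <;>
          refine mul_le_mul_of_nonneg_left (by linarith) (by positivity)
      _ = _ := by ring
  · exact ib'.const_mul _
  · exact iq'.const_mul _
  · exact (ib'.const_mul _).add (iq'.const_mul _)
  · exact (iσ0.add iσ1).const_mul _


/-! ### Part 10: key estimate -/

lemma opt_pot {p R : ℝ} (hp1 : 1 < p) (hR0 : 0 < R) {d : ℕ} {X : Set (Vec d)}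
    (hXc : IsCompact X) (hR : ∀ x ∈ X, ∀ y ∈ X, ∀ i, |x i - y i| ≤ R)
    {μ ρ : Measure (Vec d)} (hμ : ProbOn μ X) (hρ : ProbOn ρ X)
    {γ : Measure (Vec d × Vec d)} (hγ : IsCoupling γ μ ρ)
    (hopt : ∀ γ', IsCoupling γ' μ ρ → ∫ z, cst p 0 z.2 z.1 ∂γ ≤ ∫ z, cst p 0 z.2 z.1 ∂γ')
    {η : ℝ} (hη : 0 < η) : ∃ φ ψ : Vec d → ℝ, Pot p R X φ ψ ∧
      ∫ z, (cst p 0 z.2 z.1 - φ z.2 - ψ z.1) ∂γ ≤ η := by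
  obtain ⟨γ', hγ', H⟩ := exists_opt hp1 hR0 hXc hR hμ hρ
  obtain ⟨φ, ψ, P, h⟩ := H η hη
  refine ⟨φ, ψ, P, ?_⟩
  rw [slack_int hp1 hXc hμ hρ hγ P.cφ P.cψ]
  linarith [hopt γ' hγ']

lemma rpow_interp {p τ t : ℝ} (hp1 : 1 < p) (hp2 : p ≤ 2) (hτ : 0 < τ) :
    |t| ^ p ≤ τ ^ p + τ ^ (p - 2) * t ^ 2 := by
  have h0 : 0 ≤ τ ^ p := by positivity
  have h1 : 0 ≤ τ ^ (p - 2) * t ^ 2 := by positivity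
  rcases le_total |t| τ with h | h
  · have : |t| ^ p ≤ τ ^ p := Real.rpow_le_rpow (abs_nonneg _) h (by linarith)
    linarith
  · have ht : 0 < |t| := lt_of_lt_of_le hτ h
    have e : |t| ^ p = |t| ^ (p - 2) * t ^ 2 := by
      rw [← sq_abs t, ← Real.rpow_natCast, ← Real.rpow_add ht]
      congr 1; push_cast; ring
    rw [e]
    have : |t| ^ (p - 2) ≤ τ ^ (p - 2) := Real.rpow_le_rpow_of_nonpos hτ h (by linarith)
    have := mul_le_mul_of_nonneg_right this (sq_nonneg t)
    linarith

lemma key_gamma {p R θ : ℝ} (hp1 : 1 < p) (hp2 : p ≤ 2) (hR0 : 0 < R) 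
    (hθ0 : 0 < θ) (hθ : θ ≤ (p - 1) ^ 2 / (p * (p + 1))) {d : ℕ} {X : Set (Vec d)}
    (hXc : IsCompact X) (hcv : Convex ℝ X) (hV : 0 < volume.real X)
    (hR : ∀ x ∈ X, ∀ y ∈ X, ∀ i, |x i - y i| ≤ R)
    {ρ : Measure (Vec d)} (hρ : ProbOn ρ X) {c c' : ℝ} (hc : 0 < c) (hc' : 0 ≤ c')
    (hlow : ENNReal.ofReal c • volume.restrict X ≤ ρ)
    (hup : ρ ≤ ENNReal.ofReal c' • volume.restrict X) :
    ∃ C : ℝ, 0 ≤ C ∧ ∀ δ : ℝ, 0 < δ → ∀ μ ν : Measure (Vec d),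
      ProbOn μ X → ProbOn ν X → 
      ∀ Γ : Measure (Vec d × (Vec d × Vec d)), IsProbabilityMeasure Γ → Γ.map Prod.fst = ρ →
      ∀ γ0 γ1 : Measure (Vec d × Vec d), Γ.map (fun t => (t.2.1, t.1)) = γ0 →
      Γ.map (fun t => (t.2.2, t.1)) = γ1 →
      IsCoupling γ0 μ ρ → IsCoupling γ1 ν ρ → 
      (∀ γ', IsCoupling γ' μ ρ → ∫ z, cst p 0 z.2 z.1 ∂γ0 ≤ ∫ z, cst p 0 z.2 z.1 ∂γ') →
      (∀ γ', IsCoupling γ' ν ρ → ∫ z, cst p 0 z.2 z.1 ∂γ1 ≤ ∫ z, cst p 0 z.2 z.1 ∂γ') →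
      ∀ ζ, IsCoupling ζ μ ν → ∫ z, lpDist p z.1 z.2 ∂ζ ≤ δ →
      Γ (X ×ˢ (X ×ˢ X))ᶜ = 0 ∧ ∫ t, cst p 0 t.2.1 t.2.2 ∂Γ ≤ C * δ ^ (θ * p) := by
  have hp : 0 < p := by linarith
  have hXm := hXc.measurableSet
  obtain ⟨C1, hC1, H1⟩ := pot_L2 hp1 hp2 hR0 hXc hcv hV hR hρ hc hlow
  obtain ⟨C2, hC2, H2⟩ := grad_step hp1 hp2 hR0 hXc hcv hV hR hρ hc' hup
  refine ⟨d * (1 + C2 * (C1 + 2)) + d * R ^ p, by positivity, ?_⟩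
  intro δ hδ0 μ ν hμ hν Γ hΓ hΓρ γ0 γ1 e0 e1 hγ0 hγ1 opt0 opt1 ζ hζ hδ
  have m0 : Measurable fun t : Vec d × (Vec d × Vec d) => (t.2.1, t.1) := by fun_prop
  have m1 : Measurable fun t : Vec d × (Vec d × Vec d) => (t.2.2, t.1) := by fun_prop
  have k0 := coupling_conc hγ0 hXm hμ.2 hρ.2
  have k1 := coupling_conc hγ1 hXm hν.2 hρ.2
  have hΓX : Γ (X ×ˢ (X ×ˢ X))ᶜ = 0 := by
    rw [← e0, Measure.map_apply m0 (hXm.prod hXm).compl] at k0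
    rw [← e1, Measure.map_apply m1 (hXm.prod hXm).compl] at k1
    refine measure_mono_null ?_ (measure_union_null k0 k1)
    intro t ht
    by_contra hn
    simp only [Set.mem_union, Set.mem_preimage, Set.mem_compl_iff, Set.mem_prod, not_or,
      not_not] at hn ht
    exact ht ⟨hn.1.2, hn.1.1, hn.2.1⟩
  refine ⟨hΓX, ?_⟩
  have hae : ∀ᵐ t ∂Γ, t ∈ X ×ˢ (X ×ˢ X) := by rw [ae_iff]; exact hΓX
  have hcomp : IsCompact (X ×ˢ (X ×ˢ X)) := hXc.prod (hXc.prod hXc)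
  have hItg : ∀ f : Vec d × (Vec d × Vec d) → ℝ, Continuous f → Integrable f Γ := fun f hf =>
    int_of_cont hcomp hΓX hf.continuousOn
  have hc00 : Continuous fun z : Vec d × Vec d => cst p 0 z.2 z.1 :=
    cst_cont hp 0 continuous_snd continuous_fst
  have hcc : Continuous fun t : Vec d × (Vec d × Vec d) => cst p 0 t.2.1 t.2.2 :=
    cst_cont hp 0 (by fun_prop) (by fun_prop)
  have hRp : 0 ≤ d * R ^ p := by positivity
  rcases le_or_gt δ 1 with hδ1 | hδ1
  · set a := 2 * (p - 1) / (p * (p + 1)) with ha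
    have hp' : 0 < p - 1 := by linarith
    have ha0 : 0 < a := by positivity
    set h := δ ^ a with hh
    have hh0 : 0 < h := by positivity
    have hh1 : h ≤ 1 := Real.rpow_le_one hδ0.le hδ1 ha0.le
    set H := h ^ (p + 1) with hH
    have hH0 : 0 < H := by positivity
    have hH1 : H ≤ 1 := Real.rpow_le_one hh0.le hh1 (by linarith)
    have hHe : δ ^ ((2 * p - 2) / p) = H := by
      rw [hH, hh, ← Real.rpow_mul hδ0.le, ha]
      congr 1; field_simp
    have hη0 : 0 < δ * H := by positivity
    have hηδ : δ * H ≤ δ := by nlinarith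
    obtain ⟨φ0, ψ0, P0, s0⟩ := opt_pot hp1 hR0 hXc hR hμ hρ hγ0 opt0 hη0
    obtain ⟨φ1, ψ1, P1, s1⟩ := opt_pot hp1 hR0 hXc hR hν hρ hγ1 opt1 hη0
    obtain ⟨k, hk⟩ := H1 δ (δ * H) hδ0 hδ1 hη0.le hηδ μ ν hμ hν γ0 γ1 ζ hγ0 hγ1 hζ φ0 ψ0 φ1 ψ1
      P0 P1 s0 s1 hδ
    rw [hHe] at hk
    have cs : ∀ φ ψ : Vec d → ℝ, Continuous φ → Continuous ψ → Continuous
      fun z : Vec d × Vec d => cst p 0 z.2 z.1 - φ z.2 - ψ z.1 := by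
      intro φ ψ _ _; fun_prop
    have t0 : ∫ t, (cst p 0 t.1 t.2.1 - φ0 t.1 - ψ0 t.2.1) ∂Γ ≤ δ * H := by
      rw [← e0, integral_map m0.aemeasurable (cs _ _ P0.cφ P0.cψ).aestronglyMeasurable] at s0
      exact s0
    have t1 : ∫ t, (cst p 0 t.1 t.2.2 - φ1 t.1 - ψ1 t.2.2) ∂Γ ≤ δ * H := by
      rw [← e1, integral_map m1.aemeasurable (cs _ _ P1.cφ P1.cψ).aestronglyMeasurable] at s1
      exact s1
    have HH := H2 h (C1 * H) (δ * H) k hh0 hh1 Γ hΓ hΓρ hΓX φ0 ψ0 φ1 ψ1 P0 P1 t0 t1 hk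
    set τ := δ ^ ((p - 1) ^ 2 / (p * (p + 1))) with hτ
    have hτ0 : 0 < τ := by positivity
    have hτH : h ^ 2 * τ ^ 2 = H := by
      rw [← Real.rpow_natCast h, ← Real.rpow_natCast τ, hτ, hH, hh, ← Real.rpow_mul hδ0.le,
        ← Real.rpow_mul hδ0.le, ← Real.rpow_mul hδ0.le, ← Real.rpow_add hδ0]
      congr 1
      push_cast
      rw [ha]; field_simp; ring
    have hsq : ∀ i, ∫ t, (t.2.1 i - t.2.2 i) ^ 2 ∂Γ ≤ C2 * (C1 + 2) * τ ^ 2 := by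
      intro i
      have h1 := HH i
      have h2 : C2 * (C1 * H + H + δ * H) ≤ h ^ 2 * (C2 * (C1 + 2) * τ ^ 2) := by
        have : h ^ 2 * (C2 * (C1 + 2) * τ ^ 2) = C2 * (C1 + 2) * (h ^ 2 * τ ^ 2) := by ring
        rw [this, hτH]
        calc C2 * (C1 * H + H + δ * H) ≤ C2 * (C1 * H + H + 1 * H) := by gcongr
          _ = _ := by ring
      exact le_of_mul_le_mul_left (h1.trans h2) (by positivity)
    have hτp : τ ^ (p - 2) * τ ^ 2 = τ ^ p := by
      rw [← Real.rpow_natCast, ← Real.rpow_add hτ0]; congr 1; push_cast; ring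
    have hi : ∀ i, ∫ t, |t.2.1 i - t.2.2 i| ^ p ∂Γ ≤ (1 + C2 * (C1 + 2)) * τ ^ p := by
      intro i
      have csq : Continuous fun t : Vec d × (Vec d × Vec d) => (t.2.1 i - t.2.2 i) ^ 2 := by
        fun_prop
      calc ∫ t, |t.2.1 i - t.2.2 i| ^ p ∂Γ
          ≤ ∫ t, (τ ^ p + τ ^ (p - 2) * (t.2.1 i - t.2.2 i) ^ 2) ∂Γ := by
            apply integral_mono
            · apply hItg
              have : Continuous fun t : Vec d × (Vec d × Vec d) => |t.2.1 i - t.2.2 i| := by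
                fun_prop
              exact this.rpow_const fun _ => Or.inr hp.le
            · exact (integrable_const _).add ((hItg _ csq).const_mul _)
            · intro t; exact rpow_interp hp1 hp2 hτ0
        _ = τ ^ p + τ ^ (p - 2) * ∫ t, (t.2.1 i - t.2.2 i) ^ 2 ∂Γ := by
            rw [integral_add (integrable_const _) ((hItg _ csq).const_mul _), integral_const_mul]
            simp
        _ ≤ τ ^ p + τ ^ (p - 2) * (C2 * (C1 + 2) * τ ^ 2) := by gcongr; exact hsq i
        _ = τ ^ p + C2 * (C1 + 2) * (τ ^ (p - 2) * τ ^ 2) := by ring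
        _ = _ := by rw [hτp]; ring
    have hsum : ∫ t, cst p 0 t.2.1 t.2.2 ∂Γ = ∑ i, ∫ t, |t.2.1 i - t.2.2 i| ^ p ∂Γ := by
      unfold cst
      simp only [rg_zero]
      rw [integral_finsetSum]
      intro i _
      apply hItg
      have : Continuous fun t : Vec d × (Vec d × Vec d) => |t.2.1 i - t.2.2 i| := by
        fun_prop
      exact this.rpow_const fun _ => Or.inr hp.le
    have hfin : τ ^ p ≤ δ ^ (θ * p) := by
      rw [hτ, ← Real.rpow_mul hδ0.le]
      apply Real.rpow_le_rpow_of_exponent_ge hδ0 hδ1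
      gcongr
    rw [hsum]
    calc _ ≤ ∑ i : Fin d, (1 + C2 * (C1 + 2)) * τ ^ p := Finset.sum_le_sum fun i _ => hi i
      _ = d * (1 + C2 * (C1 + 2)) * τ ^ p := by simp; ring
      _ ≤ (d * (1 + C2 * (C1 + 2)) + d * R ^ p) * τ ^ p := by
        apply mul_le_mul_of_nonneg_right _ (by positivity)
        linarith
      _ ≤ _ := by gcongr
  · have h1 : ∫ t, cst p 0 t.2.1 t.2.2 ∂Γ ≤ ∫ t, (d * R ^ p) ∂Γ := by
      apply integral_mono_ae (hItg _ hcc) (integrable_const _)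
      filter_upwards [hae] with t ht
      exact cst_le hp hR ht.2.1 ht.2.2
    have h2 : ∫ t : Vec d × (Vec d × Vec d), (d * R ^ p) ∂Γ = d * R ^ p := by simp
    rw [h2] at h1
    have h3 : 1 ≤ δ ^ (θ * p) := Real.one_le_rpow hδ1.le (by positivity)
    have h4 : 0 ≤ d * (1 + C2 * (C1 + 2)) := by positivity
    nlinarith [mul_nonneg h4 (zero_le_one.trans h3)]


/-! ### Part 11: densities of marginals, kernels -/

lemma nice_bounds {E : Type*} [MeasureSpace E] {ρ : Measure E} {X : Set E} (hXm : MeasurableSet X)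
    (hρ : ProbOn ρ X) (h : NiceDensityOn ρ X) :
    ∃ c c' : ℝ, 0 < c ∧ 0 ≤ c' ∧ ENNReal.ofReal c • volume.restrict X ≤ ρ ∧
      ρ ≤ ENNReal.ofReal c' • volume.restrict X := by
  obtain ⟨f, c₁, c₂, h1, h2, h3, h4, h5⟩ := h
  have hP := hρ.1
  have hXn : X.Nonempty := by
    by_contra hne
    rw [Set.not_nonempty_iff_eq_empty] at hne
    have := hρ.2
    rw [hne, Set.compl_empty, measure_univ] at this
    exact one_ne_zero this
  obtain ⟨x0, hx0⟩ := hXn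
  have h6 : c₁ < ∞ := ((h4 x0 hx0).1.trans (h4 x0 hx0).2).trans_lt h2
  refine ⟨c₁.toReal, c₂.toReal, ENNReal.toReal_pos h1.ne' h6.ne, ENNReal.toReal_nonneg, ?_, ?_⟩
  · rw [ENNReal.ofReal_toReal h6.ne, Measure.le_iff]
    intro A hA
    rw [Measure.smul_apply, Measure.restrict_apply hA, smul_eq_mul, h3, withDensity_apply _ hA,
      ← lintegral_indicator hA, ← lintegral_indicator_const (hA.inter hXm)]
    apply lintegral_mono
    intro x
    by_cases hx : x ∈ A ∩ X
    · rw [Set.indicator_of_mem hx, Set.indicator_of_mem hx.1]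
      exact (h4 x hx.2).1
    · rw [Set.indicator_of_notMem hx]; exact zero_le
  · rw [ENNReal.ofReal_toReal h2.ne, Measure.le_iff]
    intro A hA
    rw [Measure.smul_apply, Measure.restrict_apply hA, smul_eq_mul, h3, withDensity_apply _ hA,
      ← lintegral_indicator hA, ← lintegral_indicator_const (hA.inter hXm)]
    apply lintegral_mono
    intro x
    by_cases hx : x ∈ A
    · rw [Set.indicator_of_mem hx]
      by_cases hx' : x ∈ X
      · rw [Set.indicator_of_mem (Set.mem_inter hx hx')]
        exact (h4 x hx').2
      · rw [h5 x hx']; exact zero_le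
    · rw [Set.indicator_of_notMem hx]; exact zero_le

lemma marg_bounds {d₁ d₂ : ℕ} {X₁ : Set (Vec d₁)} {X₂ : Set (Vec d₂)}
    (hX₁c : IsCompact X₁) (hX₂c : IsCompact X₂)
    {ρ : Measure (Vec d₁ × Vec d₂)} (hρ : ProbOn ρ (X₁ ×ˢ X₂))
    (hρd : NiceDensityOn ρ (X₁ ×ˢ X₂)) :
    (0 < volume.real X₁ ∧ 0 < volume.real X₂) ∧
    (ProbOn (ρ.map Prod.fst) X₁ ∧ ∃ c c' : ℝ, 0 < c ∧ 0 ≤ c' ∧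
      ENNReal.ofReal c • volume.restrict X₁ ≤ ρ.map Prod.fst ∧
      ρ.map Prod.fst ≤ ENNReal.ofReal c' • volume.restrict X₁) ∧
    (ProbOn (ρ.map Prod.snd) X₂ ∧ ∃ c c' : ℝ, 0 < c ∧ 0 ≤ c' ∧
      ENNReal.ofReal c • volume.restrict X₂ ≤ ρ.map Prod.snd ∧
      ρ.map Prod.snd ≤ ENNReal.ofReal c' • volume.restrict X₂) := by
  have m1 := hX₁c.measurableSet
  have m2 := hX₂c.measurableSet
  have hP := hρ.1
  obtain ⟨c, c', hc, hc', hl, hu⟩ := nice_bounds (m1.prod m2) hρ hρd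
  have f1 : volume X₁ ≠ ∞ := hX₁c.measure_lt_top.ne
  have f2 : volume X₂ ≠ ∞ := hX₂c.measure_lt_top.ne
  have hpos : volume X₁ * volume X₂ ≠ 0 := by
    intro h0
    have h1 := hu Set.univ
    rw [measure_univ, Measure.smul_apply, Measure.restrict_apply_univ, Measure.volume_eq_prod,
      Measure.prod_prod, h0, smul_zero] at h1
    exact absurd h1 (by simp)
  have p1 : 0 < volume.real X₁ := ENNReal.toReal_pos (left_ne_zero_of_mul hpos) f1
  have p2 : 0 < volume.real X₂ := ENNReal.toReal_pos (right_ne_zero_of_mul hpos) f2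
  have e1 : (volume.restrict (X₁ ×ˢ X₂) : Measure (Vec d₁ × Vec d₂)).map Prod.fst =
      volume X₂ • volume.restrict X₁ := by
    rw [Measure.volume_eq_prod, ← Measure.prod_restrict, Measure.map_fst_prod,
      Measure.restrict_apply_univ]
  have e2 : (volume.restrict (X₁ ×ˢ X₂) : Measure (Vec d₁ × Vec d₂)).map Prod.snd =
      volume X₁ • volume.restrict X₂ := by
    rw [Measure.volume_eq_prod, ← Measure.prod_restrict, Measure.map_snd_prod,
      Measure.restrict_apply_univ]
  have l1 := Measure.map_mono hl measurable_fst
  have l2 := Measure.map_mono hl measurable_snd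
  have u1 := Measure.map_mono hu measurable_fst
  have u2 := Measure.map_mono hu measurable_snd
  rw [Measure.map_smul, e1, smul_smul] at l1 u1
  rw [Measure.map_smul, e2, smul_smul] at l2 u2
  have g1 : ∀ c : ℝ, 0 ≤ c → ENNReal.ofReal c * volume X₂ = ENNReal.ofReal (c * volume.real X₂) := by
    intro c hc
    rw [ENNReal.ofReal_mul hc, measureReal_def, ENNReal.ofReal_toReal f2]
  have g2 : ∀ c : ℝ, 0 ≤ c → ENNReal.ofReal c * volume X₁ = ENNReal.ofReal (c * volume.real X₁) := by
    intro c hc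
    rw [ENNReal.ofReal_mul hc, measureReal_def, ENNReal.ofReal_toReal f1]
  rw [g1 _ hc.le] at l1
  rw [g1 _ hc'] at u1
  rw [g2 _ hc.le] at l2
  rw [g2 _ hc'] at u2
  refine ⟨⟨p1, p2⟩, ⟨⟨Measure.isProbabilityMeasure_map measurable_fst.aemeasurable, ?_⟩, _, _,
    mul_pos hc p2, mul_nonneg hc' p2.le, l1, u1⟩,
    ⟨Measure.isProbabilityMeasure_map measurable_snd.aemeasurable, ?_⟩, _, _,
    mul_pos hc p1, mul_nonneg hc' p1.le, l2, u2⟩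
  · rw [Measure.map_apply measurable_fst m1.compl]
    refine measure_mono_null ?_ hρ.2
    intro x hx hx'
    exact hx hx'.1
  · rw [Measure.map_apply measurable_snd m2.compl]
    refine measure_mono_null ?_ hρ.2
    intro x hx hx'
    exact hx hx'.2

/-- κ is an optimal transport kernel from ρ to μ -/
def OptK (p : ℝ) {d : ℕ} (ρ μ : Measure (Vec d)) (κ : Kernel (Vec d) (Vec d)) : Prop :=
  ∃ γ : Measure (Vec d × Vec d),
      (∀ A, MeasurableSet A → γ A = ∫⁻ y, κ y {x | (x, y) ∈ A} ∂ρ) ∧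
      IsCoupling γ μ ρ ∧
      (∫ z, lpDist p z.1 z.2 ^ p ∂γ) ^ (1 / p) = Wp p (lpDist p) μ ρ

lemma Wp_le {E : Type*} [MeasurableSpace E] {p : ℝ} {c : E → E → ℝ}
    (hc : ∀ x y, 0 ≤ c x y) {α β : Measure E} {γ : Measure (E × E)} (hγ : IsCoupling γ α β) :
    Wp p c α β ≤ (∫ z, c z.1 z.2 ^ p ∂γ) ^ (1 / p) := by
  apply csInf_le
  · refine ⟨0, ?_⟩
    rintro _ ⟨γ', -, rfl⟩
    exact Real.rpow_nonneg (integral_nonneg fun z => Real.rpow_nonneg (hc _ _) _) _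
  · exact ⟨γ, hγ, rfl⟩

lemma opt_iff {p : ℝ} (hp : 0 < p) {d : ℕ} {μ ρ : Measure (Vec d)}
    {γ : Measure (Vec d × Vec d)} (hγ : IsCoupling γ μ ρ) :
    (∫ z, lpDist p z.1 z.2 ^ p ∂γ) ^ (1 / p) = Wp p (lpDist p) μ ρ ↔
    ∀ γ', IsCoupling γ' μ ρ → ∫ z, cst p 0 z.2 z.1 ∂γ ≤ ∫ z, cst p 0 z.2 z.1 ∂γ' := by
  have e : ∀ γ : Measure (Vec d × Vec d), ∫ z, lpDist p z.1 z.2 ^ p ∂γ =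
      ∫ z, cst p 0 z.2 z.1 ∂γ := by
    intro γ
    refine integral_congr_ae (Filter.Eventually.of_forall fun z => ?_)
    show lpDist p z.1 z.2 ^ p = _
    rw [lpDist_rpow hp, cst_comm]
  have hn : ∀ γ : Measure (Vec d × Vec d), 0 ≤ ∫ z, cst p 0 z.2 z.1 ∂γ := fun γ =>
    integral_nonneg fun z => cst_nonneg _ _
  have hip : 0 < 1 / p := by positivity
  constructor
  · intro h γ' hγ'
    have h1 := Wp_le (p := p) (c := lpDist p) (fun x y => lpDist_nonneg _ _) hγ'
    rw [← h, e, e] at h1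
    exact (Real.rpow_le_rpow_iff (hn _) (hn _) hip).1 h1
  · intro h
    apply le_antisymm
    · apply le_csInf
      · exact ⟨_, γ, hγ, rfl⟩
      · rintro _ ⟨γ', hγ', rfl⟩
        show (∫ z, lpDist p z.1 z.2 ^ p ∂γ) ^ (1 / p) ≤ (∫ z, lpDist p z.1 z.2 ^ p ∂γ') ^ (1 / p)
        rw [e, e]
        exact Real.rpow_le_rpow (hn _) (h γ' hγ') hip.le
    · exact Wp_le (fun x y => lpDist_nonneg _ _) hγ

lemma exists_optK {p R : ℝ} (hp1 : 1 < p) (hR0 : 0 < R) {d : ℕ} {X : Set (Vec d)}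
    (hXc : IsCompact X) (hR : ∀ x ∈ X, ∀ y ∈ X, ∀ i, |x i - y i| ≤ R)
    {μ ρ : Measure (Vec d)} (hμ : ProbOn μ X) (hρ : ProbOn ρ X) :
    ∃ κ : Kernel (Vec d) (Vec d), IsMarkovKernel κ ∧ OptK p ρ μ κ := by
  have hp : 0 < p := by linarith
  obtain ⟨γ, hγ, H⟩ := exists_opt hp1 hR0 hXc hR hμ hρ
  have hγP := hγ.1
  have hρP := hρ.1
  have hsP : IsProbabilityMeasure (γ.map Prod.swap) :=
    Measure.isProbabilityMeasure_map measurable_swap.aemeasurable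
  have hfst : (γ.map Prod.swap).fst = ρ := by
    rw [Measure.fst, Measure.map_map measurable_fst measurable_swap]
    exact hγ.2.2
  refine ⟨(γ.map Prod.swap).condKernel, inferInstance, γ, ?_, hγ, ?_⟩
  · intro A hA
    have h1 := (γ.map Prod.swap).disintegrate (γ.map Prod.swap).condKernel
    have hA' : MeasurableSet (Prod.swap ⁻¹' A : Set (Vec d × Vec d)) := measurable_swap hA
    have h2 : γ A = (γ.map Prod.swap) (Prod.swap ⁻¹' A) := by
      rw [Measure.map_apply measurable_swap hA']
      congr 1
    rw [hfst] at h1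
    have h3 := congrArg (fun m => m (Prod.swap ⁻¹' A)) h1
    rw [Measure.compProd_apply hA'] at h3
    rw [h2, ← h3]
    rfl
  · rw [opt_iff hp hγ]
    intro γ' hγ'
    apply le_of_forall_pos_le_add
    intro η hη
    obtain ⟨φ, ψ, P, h⟩ := H η hη
    have := weak_duality hp1 hXc hμ hρ hγ' P.cφ P.cψ P.le
    linarith


/-! ### Part 12: kernel form of the key estimate; W_q and couplings -/

lemma key_kernel {p R θ : ℝ} (hp1 : 1 < p) (hp2 : p ≤ 2) (hR0 : 0 < R) 
    (hθ0 : 0 < θ) (hθ : θ ≤ (p - 1) ^ 2 / (p * (p + 1))) {d : ℕ} {X : Set (Vec d)}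
    (hXc : IsCompact X) (hcv : Convex ℝ X) (hV : 0 < volume.real X)
    (hR : ∀ x ∈ X, ∀ y ∈ X, ∀ i, |x i - y i| ≤ R)
    {ρ : Measure (Vec d)} (hρ : ProbOn ρ X) {c c' : ℝ} (hc : 0 < c) (hc' : 0 ≤ c')
    (hlow : ENNReal.ofReal c • volume.restrict X ≤ ρ)
    (hup : ρ ≤ ENNReal.ofReal c' • volume.restrict X) :
    ∃ C : ℝ, 0 ≤ C ∧ ∀ δ : ℝ, 0 < δ → ∀ μ ν : Measure (Vec d),
      ProbOn μ X → ProbOn ν X → 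
      ∀ κ κ' : Kernel (Vec d) (Vec d), IsMarkovKernel κ → IsMarkovKernel κ' →
      OptK p ρ μ κ → OptK p ρ ν κ' →
      ∀ ζ, IsCoupling ζ μ ν → ∫ z, lpDist p z.1 z.2 ∂ζ ≤ δ →
      ∫⁻ y, ∫⁻ z, ENNReal.ofReal (cst p 0 z.1 z.2) ∂((κ y).prod (κ' y)) ∂ρ ≤
        ENNReal.ofReal (C * δ ^ (θ * p)) := by
  have hp : 0 < p := by linarith
  obtain ⟨C, hC, H⟩ := key_gamma hp1 hp2 hR0 hθ0 hθ hXc hcv hV hR hρ hc hc' hlow hup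
  refine ⟨C, hC, ?_⟩
  intro δ hδ0 μ ν hμ hν κ κ' hκ hκ' ⟨γ0, g0, cp0, o0⟩ ⟨γ1, g1, cp1, o1⟩ ζ hζ hδ
  have hP := hρ.1
  rw [opt_iff hp cp0] at o0
  rw [opt_iff hp cp1] at o1
  set Γ := ρ ⊗ₘ (κ ×ₖ κ') with hΓ
  have m0 : Measurable fun t : Vec d × (Vec d × Vec d) => (t.2.1, t.1) := by fun_prop
  have m1 : Measurable fun t : Vec d × (Vec d × Vec d) => (t.2.2, t.1) := by fun_prop
  have e0 : Γ.map (fun t => (t.2.1, t.1)) = γ0 := by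
    ext A hA
    rw [Measure.map_apply m0 hA, hΓ, Measure.compProd_apply (m0 hA), g0 A hA]
    refine lintegral_congr fun y => ?_
    rw [Kernel.prod_apply]
    have hm : MeasurableSet {x | (x, y) ∈ A} := (measurable_id.prodMk measurable_const) hA
    have : (Prod.mk y ⁻¹' ((fun t : Vec d × (Vec d × Vec d) => (t.2.1, t.1)) ⁻¹' A)) =
        {x | (x, y) ∈ A} ×ˢ Set.univ := by
      ext z
      simp [Set.mem_prod]
    rw [this, Measure.prod_prod, measure_univ, mul_one]
  have e1 : Γ.map (fun t => (t.2.2, t.1)) = γ1 := by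
    ext A hA
    rw [Measure.map_apply m1 hA, hΓ, Measure.compProd_apply (m1 hA), g1 A hA]
    refine lintegral_congr fun y => ?_
    rw [Kernel.prod_apply]
    have hm : MeasurableSet {x | (x, y) ∈ A} := (measurable_id.prodMk measurable_const) hA
    have : (Prod.mk y ⁻¹' ((fun t : Vec d × (Vec d × Vec d) => (t.2.2, t.1)) ⁻¹' A)) =
        Set.univ ×ˢ {x | (x, y) ∈ A} := by
      ext z
      simp [Set.mem_prod]
    rw [this, Measure.prod_prod, measure_univ, one_mul]
  have hfst : Γ.map Prod.fst = ρ := Measure.fst_compProd _ _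
  obtain ⟨hΓX, hI⟩ := H δ hδ0 μ ν hμ hν Γ inferInstance hfst γ0 γ1 e0 e1 cp0 cp1 o0 o1 ζ hζ hδ
  have hcc : Continuous fun t : Vec d × (Vec d × Vec d) => cst p 0 t.2.1 t.2.2 :=
    cst_cont hp 0 (by fun_prop) (by fun_prop)
  have hItg : Integrable (fun t : Vec d × (Vec d × Vec d) => cst p 0 t.2.1 t.2.2) Γ :=
    int_of_cont (hXc.prod (hXc.prod hXc)) hΓX hcc.continuousOn
  have h1 := ofReal_integral_eq_lintegral_ofReal hItg
    (Filter.Eventually.of_forall fun t => cst_nonneg _ _)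
  have h2 := ENNReal.ofReal_le_ofReal hI
  rw [h1, hΓ, Measure.lintegral_compProd hcc.measurable.ennreal_ofReal] at h2
  refine le_trans (le_of_eq ?_) h2
  refine lintegral_congr fun y => ?_
  rw [Kernel.prod_apply]

lemma prod_coupling {E : Type*} [MeasurableSpace E] {μ ν : Measure E} [IsProbabilityMeasure μ]
    [IsProbabilityMeasure ν] : IsCoupling (μ.prod ν) μ ν := by
  refine ⟨inferInstance, ?_, ?_⟩
  · rw [Measure.map_fst_prod]; simp
  · rw [Measure.map_snd_prod]; simp

lemma lpDist_cont {p : ℝ} (hp : 0 < p) {d : ℕ} :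
    Continuous fun z : Vec d × Vec d => lpDist p z.1 z.2 := by
  simp only [lpDist_eq]
  exact (cst_cont hp 0 continuous_fst continuous_snd).rpow_const fun _ => Or.inr (by positivity)

lemma int_le_q {p : ℝ} (hp : 0 < p) {d : ℕ} {X : Set (Vec d)} (hXc : IsCompact X)
    {μ ν : Measure (Vec d)} (hμ : ProbOn μ X) (hν : ProbOn ν X) {ζ : Measure (Vec d × Vec d)}
    (hζ : IsCoupling ζ μ ν) {q : ℝ} (hq : 1 ≤ q) :
    ∫ z, lpDist p z.1 z.2 ∂ζ ≤ (∫ z, lpDist p z.1 z.2 ^ q ∂ζ) ^ (1 / q) := by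
  have hP := hζ.1
  have hconc := coupling_conc hζ hXc.measurableSet hμ.2 hν.2
  have hq0 : 0 < q := by linarith
  have c1 := lpDist_cont hp (d := d)
  have c2 : Continuous fun z : Vec d × Vec d => lpDist p z.1 z.2 ^ q :=
    c1.rpow_const fun _ => Or.inr hq0.le
  have i1 := int_of_cont (hXc.prod hXc) hconc c1.continuousOn
  have i2 := int_of_cont (hXc.prod hXc) hconc c2.continuousOn
  have h1 := (convexOn_rpow hq).map_integral_le (μ := ζ) (f := fun z => lpDist p z.1 z.2)
    (continuousOn_id.rpow_const fun _ _ => Or.inr hq0.le) isClosed_Ici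
    (Filter.Eventually.of_forall fun z => lpDist_nonneg _ _) i1 i2
  have h0 : 0 ≤ ∫ z, lpDist p z.1 z.2 ∂ζ := integral_nonneg fun z => lpDist_nonneg _ _
  calc ∫ z, lpDist p z.1 z.2 ∂ζ = ((∫ z, lpDist p z.1 z.2 ∂ζ) ^ q) ^ (1 / q) := by
        rw [← Real.rpow_mul h0, mul_one_div_cancel hq0.ne', Real.rpow_one]
    _ ≤ _ := Real.rpow_le_rpow (by positivity) h1 (by positivity)

lemma int_le_inf {p : ℝ} (hp : 0 < p) {d : ℕ} {X : Set (Vec d)} (hXc : IsCompact X)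
    {μ ν : Measure (Vec d)} (hμ : ProbOn μ X) (hν : ProbOn ν X) {ζ : Measure (Vec d × Vec d)}
    (hζ : IsCoupling ζ μ ν) :
    ∫ z, lpDist p z.1 z.2 ∂ζ ≤ essSup (fun z => lpDist p z.1 z.2) ζ := by
  have hP := hζ.1
  have hconc := coupling_conc hζ hXc.measurableSet hμ.2 hν.2
  have c1 := lpDist_cont hp (d := d)
  have i1 := int_of_cont (hXc.prod hXc) hconc c1.continuousOn
  have hae : ∀ᵐ z ∂ζ, z ∈ X ×ˢ X := by rw [ae_iff]; exact hconc
  obtain ⟨B, hB⟩ := (hXc.prod hXc).bddAbove_image c1.continuousOn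
  have hbd : Filter.IsBoundedUnder (· ≤ ·) (ae ζ) fun z => lpDist p z.1 z.2 := by
    refine ⟨B, ?_⟩
    rw [Filter.eventually_map]
    filter_upwards [hae] with z hz
    exact hB ⟨z, hz, rfl⟩
  have h1 : ∀ᵐ z ∂ζ, lpDist p z.1 z.2 ≤ essSup (fun z => lpDist p z.1 z.2) ζ := ae_le_essSup hbd
  calc _ ≤ ∫ z, essSup (fun z => lpDist p z.1 z.2) ζ ∂ζ :=
        integral_mono_ae i1 (integrable_const _) h1
    _ = _ := by simp

lemma Wq_spec {p : ℝ} (hp : 0 < p) {d : ℕ} {X : Set (Vec d)} (hXc : IsCompact X)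
    {μ ν : Measure (Vec d)} (hμ : ProbOn μ X) (hν : ProbOn ν X) {q : ℝ≥0∞} (hq : 1 ≤ q) :
    0 ≤ Wq q (lpDist p) μ ν ∧ ∀ δ, Wq q (lpDist p) μ ν < δ →
      ∃ ζ, IsCoupling ζ μ ν ∧ ∫ z, lpDist p z.1 z.2 ∂ζ ≤ δ := by
  have hP1 := hμ.1
  have hP2 := hν.1
  have h0 : ∀ ζ : Measure (Vec d × Vec d), 0 ≤ ∫ z, lpDist p z.1 z.2 ∂ζ := fun ζ =>
    integral_nonneg fun z => lpDist_nonneg _ _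
  unfold Wq
  split_ifs with hqt
  · unfold Winf
    constructor
    · apply Real.sInf_nonneg
      rintro _ ⟨ζ, hζ, rfl⟩
      exact (h0 ζ).trans (int_le_inf hp hXc hμ hν hζ)
    · intro δ hδ
      obtain ⟨_, ⟨ζ, hζ, rfl⟩, h⟩ := exists_lt_of_csInf_lt
        (Set.Nonempty.image _ ⟨μ.prod ν, prod_coupling⟩) hδ
      exact ⟨ζ, hζ, (int_le_inf hp hXc hμ hν hζ).trans h.le⟩
  · have hq1 : 1 ≤ q.toReal := by
      rw [← ENNReal.toReal_one]
      exact ENNReal.toReal_mono hqt hq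
    unfold Wp
    constructor
    · apply Real.sInf_nonneg
      rintro _ ⟨ζ, hζ, rfl⟩
      exact (h0 ζ).trans (int_le_q hp hXc hμ hν hζ hq1)
    · intro δ hδ
      obtain ⟨_, ⟨ζ, hζ, rfl⟩, h⟩ := exists_lt_of_csInf_lt
        (Set.Nonempty.image _ ⟨μ.prod ν, prod_coupling⟩) hδ
      exact ⟨ζ, hζ, (int_le_q hp hXc hμ hν hζ hq1).trans h.le⟩

lemma shadow_coupling {p : ℝ} (hp : 0 < p) {d₁ d₂ : ℕ} {ρ : Measure (Vec d₁ × Vec d₂)}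
    [IsProbabilityMeasure ρ]
    (κ₁ κ₁' : Kernel (Vec d₁) (Vec d₁)) (κ₂ κ₂' : Kernel (Vec d₂) (Vec d₂))
    [IsMarkovKernel κ₁] [IsMarkovKernel κ₁'] [IsMarkovKernel κ₂] [IsMarkovKernel κ₂']
    {S S' : Measure (Vec d₁ × Vec d₂)}
    (hS : ∀ A, MeasurableSet A → S A = ∫⁻ y, ((κ₁ y.1).prod (κ₂ y.2)) A ∂ρ)
    (hS' : ∀ A, MeasurableSet A → S' A = ∫⁻ y, ((κ₁' y.1).prod (κ₂' y.2)) A ∂ρ) :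
    ∃ Δ, IsCoupling Δ S S' ∧
      ∫⁻ z, ENNReal.ofReal (cst p 0 z.1.1 z.2.1) ∂Δ =
        ∫⁻ y, ∫⁻ z, ENNReal.ofReal (cst p 0 z.1 z.2) ∂((κ₁ y).prod (κ₁' y)) ∂(ρ.map Prod.fst) ∧
      ∫⁻ z, ENNReal.ofReal (cst p 0 z.1.2 z.2.2) ∂Δ =
        ∫⁻ y, ∫⁻ z, ENNReal.ofReal (cst p 0 z.1 z.2) ∂((κ₂ y).prod (κ₂' y)) ∂(ρ.map Prod.snd) := by
  set K1 : Kernel (Vec d₁ × Vec d₂) (Vec d₁ × Vec d₂) :=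
    (κ₁.comap Prod.fst measurable_fst) ×ₖ (κ₂.comap Prod.snd measurable_snd) with hK1
  set K2 : Kernel (Vec d₁ × Vec d₂) (Vec d₁ × Vec d₂) :=
    (κ₁'.comap Prod.fst measurable_fst) ×ₖ (κ₂'.comap Prod.snd measurable_snd) with hK2
  have k1 : ∀ y, K1 y = (κ₁ y.1).prod (κ₂ y.2) := fun y => by
    rw [hK1, Kernel.prod_apply, Kernel.comap_apply, Kernel.comap_apply]
  have k2 : ∀ y, K2 y = (κ₁' y.1).prod (κ₂' y.2) := fun y => by
    rw [hK2, Kernel.prod_apply, Kernel.comap_apply, Kernel.comap_apply]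
  have hc : ∀ d : ℕ, Measurable fun z : Vec d × Vec d => ENNReal.ofReal (cst p 0 z.1 z.2) :=
    fun d => (cst_cont hp 0 continuous_fst continuous_snd).measurable.ennreal_ofReal
  have mf : Measurable (fun z : (Vec d₁ × Vec d₂) × (Vec d₁ × Vec d₂) => (z.1.1, z.2.1)) := by
    fun_prop
  have ms : Measurable (fun z : (Vec d₁ × Vec d₂) × (Vec d₁ × Vec d₂) => (z.1.2, z.2.2)) := by
    fun_prop
  have mf' : Measurable (fun z : (Vec d₁ × Vec d₂) × (Vec d₁ × Vec d₂) =>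
      ENNReal.ofReal (cst p 0 z.1.1 z.2.1)) := (hc d₁).comp mf
  have ms' : Measurable (fun z : (Vec d₁ × Vec d₂) × (Vec d₁ × Vec d₂) =>
      ENNReal.ofReal (cst p 0 z.1.2 z.2.2)) := (hc d₂).comp ms
  refine ⟨ρ.bind (K1 ×ₖ K2), ⟨?_, ?_, ?_⟩, ?_, ?_⟩
  · infer_instance
  · ext A hA
    rw [Measure.map_apply measurable_fst hA, Measure.bind_apply (measurable_fst hA)
      (Kernel.aemeasurable _), hS A hA]
    refine lintegral_congr fun y => ?_
    rw [Kernel.prod_apply, ← Measure.map_apply measurable_fst hA, Measure.map_fst_prod,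
      measure_univ, one_smul, k1]
  · ext A hA
    rw [Measure.map_apply measurable_snd hA, Measure.bind_apply (measurable_snd hA)
      (Kernel.aemeasurable _), hS' A hA]
    refine lintegral_congr fun y => ?_
    rw [Kernel.prod_apply, ← Measure.map_apply measurable_snd hA, Measure.map_snd_prod,
      measure_univ, one_smul, k2]
  · rw [Measure.lintegral_bind (Kernel.aemeasurable _) mf'.aemeasurable,
      lintegral_map ?_ measurable_fst]
    · refine lintegral_congr fun y => ?_
      have h1 : ((K1 ×ₖ K2) y).map (Prod.map Prod.fst Prod.fst) = (κ₁ y.1).prod (κ₁' y.1) := by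
        rw [Kernel.prod_apply, ← Measure.map_prod_map _ _ measurable_fst measurable_fst, k1, k2,
          Measure.map_fst_prod, Measure.map_fst_prod, measure_univ, measure_univ, one_smul, one_smul]
      rw [← h1, lintegral_map (hc d₁) (measurable_fst.prodMap measurable_fst)]
      rfl
    · have := Measurable.lintegral_kernel (κ := κ₁ ×ₖ κ₁') (hc d₁)
      simpa only [Kernel.prod_apply] using this
  · rw [Measure.lintegral_bind (Kernel.aemeasurable _) ms'.aemeasurable,
      lintegral_map ?_ measurable_snd]
    · refine lintegral_congr fun y => ?_
      have h1 : ((K1 ×ₖ K2) y).map (Prod.map Prod.snd Prod.snd) = (κ₂ y.2).prod (κ₂' y.2) := by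
        rw [Kernel.prod_apply, ← Measure.map_prod_map _ _ measurable_snd measurable_snd, k1, k2,
          Measure.map_snd_prod, Measure.map_snd_prod, measure_univ, measure_univ, one_smul, one_smul]
      rw [← h1, lintegral_map (hc d₂) (measurable_snd.prodMap measurable_snd)]
      rfl
    · have := Measurable.lintegral_kernel (κ := κ₂ ×ₖ κ₂') (hc d₂)
      simpa only [Kernel.prod_apply] using this


/-! ### Part 13: final assembly -/

lemma exists_R {d : ℕ} {X : Set (Vec d)} (hX : IsCompact X) :
    ∃ R : ℝ, 0 < R ∧ ∀ x ∈ X, ∀ y ∈ X, ∀ i, |x i - y i| ≤ R := by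
  obtain ⟨R, hR⟩ := Metric.isBounded_iff.1 hX.isBounded
  refine ⟨max R 1, by positivity, fun x hx y hy i => ?_⟩
  have h1 := hR hx hy
  have h2 := dist_le_pi_dist x y i
  rw [Real.dist_eq] at h2
  exact (h2.trans h1).trans (le_max_left _ _)

/-- the estimate for one marginal -/
def KeyEst (p θ : ℝ) {d : ℕ} (X : Set (Vec d)) (ρ : Measure (Vec d)) (C : ℝ) : Prop :=
  ∀ δ : ℝ, 0 < δ → ∀ μ ν : Measure (Vec d),
      ProbOn μ X → ProbOn ν X →
      ∀ κ κ' : Kernel (Vec d) (Vec d), IsMarkovKernel κ → IsMarkovKernel κ' →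
      OptK p ρ μ κ → OptK p ρ ν κ' →
      ∀ ζ, IsCoupling ζ μ ν → ∫ z, lpDist p z.1 z.2 ∂ζ ≤ δ →
      ∫⁻ y, ∫⁻ z, ENNReal.ofReal (cst p 0 z.1 z.2) ∂((κ y).prod (κ' y)) ∂ρ ≤
        ENNReal.ofReal (C * δ ^ (θ * p))

lemma shadow_bound {p θ C₁ C₂ : ℝ} (hp : 1 ≤ p) (hC₁ : 0 ≤ C₁) (hC₂ : 0 ≤ C₂)
    {d₁ d₂ : ℕ} {X₁ : Set (Vec d₁)} {X₂ : Set (Vec d₂)} {ρ : Measure (Vec d₁ × Vec d₂)}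
    [IsProbabilityMeasure ρ]
    (H₁ : KeyEst p θ X₁ (ρ.map Prod.fst) C₁) (H₂ : KeyEst p θ X₂ (ρ.map Prod.snd) C₂)
    {μ₁ ν₁ : Measure (Vec d₁)} {μ₂ ν₂ : Measure (Vec d₂)}
    (hμ₁ : ProbOn μ₁ X₁) (hν₁ : ProbOn ν₁ X₁) (hμ₂ : ProbOn μ₂ X₂) (hν₂ : ProbOn ν₂ X₂)
    {S S' : Measure (Vec d₁ × Vec d₂)}
    (hS : IsShadow2 p ρ μ₁ μ₂ S) (hS' : IsShadow2 p ρ ν₁ ν₂ S')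
    {δ₁ δ₂ : ℝ} (hδ₁ : 0 < δ₁) (hδ₂ : 0 < δ₂)
    (hζ₁ : ∃ ζ, IsCoupling ζ μ₁ ν₁ ∧ ∫ z, lpDist p z.1 z.2 ∂ζ ≤ δ₁)
    (hζ₂ : ∃ ζ, IsCoupling ζ μ₂ ν₂ ∧ ∫ z, lpDist p z.1 z.2 ∂ζ ≤ δ₂) :
    Wp p (prodDist p) S S' ≤ C₁ ^ (1 / p) * δ₁ ^ θ + C₂ ^ (1 / p) * δ₂ ^ θ := by
  have hp0 : 0 < p := by linarith
  obtain ⟨κ₁, κ₂, hκ₁, hκ₂, o₁, o₂, hSA⟩ := hS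
  obtain ⟨κ₁', κ₂', hκ₁', hκ₂', o₁', o₂', hSA'⟩ := hS'
  obtain ⟨ζ₁, hζ₁, b₁⟩ := hζ₁
  obtain ⟨ζ₂, hζ₂, b₂⟩ := hζ₂
  obtain ⟨Δ, hΔ, e₁, e₂⟩ := shadow_coupling hp0 κ₁ κ₁' κ₂ κ₂' hSA hSA'
  have k₁ := H₁ δ₁ hδ₁ μ₁ ν₁ hμ₁ hν₁ κ₁ κ₁' hκ₁ hκ₁' o₁ o₁' ζ₁ hζ₁ b₁
  have k₂ := H₂ δ₂ hδ₂ μ₂ ν₂ hμ₂ hν₂ κ₂ κ₂' hκ₂ hκ₂' o₂ o₂' ζ₂ hζ₂ b₂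
  rw [← e₁] at k₁
  rw [← e₂] at k₂
  have hA₁ : 0 ≤ C₁ * δ₁ ^ (θ * p) := by positivity
  have hA₂ : 0 ≤ C₂ * δ₂ ^ (θ * p) := by positivity
  have pd : ∀ z : (Vec d₁ × Vec d₂) × (Vec d₁ × Vec d₂),
      prodDist p z.1 z.2 ^ p = cst p 0 z.1.1 z.2.1 + cst p 0 z.1.2 z.2.2 := by
    intro z
    unfold prodDist
    rw [lpDist_rpow hp0, lpDist_rpow hp0,
      ← Real.rpow_mul (add_nonneg (cst_nonneg _ _) (cst_nonneg _ _)), one_div,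
      inv_mul_cancel₀ hp0.ne', Real.rpow_one]
  have pn : ∀ x y : Vec d₁ × Vec d₂, 0 ≤ prodDist p x y := by
    intro x y
    unfold prodDist
    rw [lpDist_rpow hp0, lpDist_rpow hp0]
    exact Real.rpow_nonneg (add_nonneg (cst_nonneg _ _) (cst_nonneg _ _)) _
  have c1 : Continuous fun z : (Vec d₁ × Vec d₂) × (Vec d₁ × Vec d₂) => cst p 0 z.1.1 z.2.1 :=
    cst_cont hp0 0 (by fun_prop) (by fun_prop)
  have c2 : Continuous fun z : (Vec d₁ × Vec d₂) × (Vec d₁ × Vec d₂) => cst p 0 z.1.2 z.2.2 :=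
    cst_cont hp0 0 (by fun_prop) (by fun_prop)
  have hI : ∫ z, prodDist p z.1 z.2 ^ p ∂Δ ≤ C₁ * δ₁ ^ (θ * p) + C₂ * δ₂ ^ (θ * p) := by
    simp only [pd]
    rw [integral_eq_lintegral_of_nonneg_ae
      (Filter.Eventually.of_forall fun z => add_nonneg (cst_nonneg _ _) (cst_nonneg _ _))
      (c1.add c2).aestronglyMeasurable]
    apply ENNReal.toReal_le_of_le_ofReal (by positivity)
    rw [ENNReal.ofReal_add hA₁ hA₂]
    refine le_trans (le_of_eq ?_) (add_le_add k₁ k₂)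
    rw [← lintegral_add_left c1.measurable.ennreal_ofReal]
    exact lintegral_congr fun z => ENNReal.ofReal_add (cst_nonneg _ _) (cst_nonneg _ _)
  have hr : ∀ C δ : ℝ, 0 ≤ C → 0 < δ → (C * δ ^ (θ * p)) ^ (1 / p) = C ^ (1 / p) * δ ^ θ := by
    intro C δ hC hδ
    rw [Real.mul_rpow hC (by positivity), ← Real.rpow_mul hδ.le, mul_assoc,
      mul_one_div_cancel hp0.ne', mul_one]
  calc Wp p (prodDist p) S S' ≤ (∫ z, prodDist p z.1 z.2 ^ p ∂Δ) ^ (1 / p) := Wp_le pn hΔ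
    _ ≤ (C₁ * δ₁ ^ (θ * p) + C₂ * δ₂ ^ (θ * p)) ^ (1 / p) :=
      Real.rpow_le_rpow (integral_nonneg fun z => Real.rpow_nonneg (pn _ _) _) hI (by positivity)
    _ ≤ (C₁ * δ₁ ^ (θ * p)) ^ (1 / p) + (C₂ * δ₂ ^ (θ * p)) ^ (1 / p) :=
      Real.rpow_add_le_add_rpow hA₁ hA₂ (by positivity) ((div_le_one hp0).2 hp)
    _ = _ := by rw [hr _ _ hC₁ hδ₁, hr _ _ hC₂ hδ₂]

lemma diag_coupling {p : ℝ} (hp : 0 < p) {d : ℕ} (μ : Measure (Vec d)) [IsProbabilityMeasure μ]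
    (δ : ℝ) (hδ : 0 < δ) : ∃ ζ, IsCoupling ζ μ μ ∧ ∫ z, lpDist p z.1 z.2 ∂ζ ≤ δ := by
  have m : Measurable fun x : Vec d => (x, x) := by fun_prop
  refine ⟨μ.map fun x => (x, x), ⟨Measure.isProbabilityMeasure_map m.aemeasurable, ?_, ?_⟩, ?_⟩
  · rw [Measure.map_map measurable_fst m]
    exact Measure.map_id
  · rw [Measure.map_map measurable_snd m]
    exact Measure.map_id
  · rw [integral_map m.aemeasurable (lpDist_cont hp).aestronglyMeasurable]
    have : ∀ x : Vec d, lpDist p x x = 0 := by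
      intro x
      unfold lpDist
      simp [Real.zero_rpow hp.ne', Real.zero_rpow (inv_pos.2 hp).ne']
    simp only [this, integral_zero]
    exact hδ.le

lemma eq_of_cst {p : ℝ} (hp : 0 < p) {d : ℕ} {x y : Vec d} (h : cst p 0 x y = 0) : x = y := by
  ext i
  have h1 := abs_le_lpDist hp x y i
  rw [lpDist_eq, h, Real.zero_rpow (by positivity)] at h1
  exact sub_eq_zero.1 (abs_eq_zero.1 (le_antisymm h1 (abs_nonneg _)))

lemma zero_of_bounds {a : ℝ≥0∞} {C s : ℝ} (hs : 0 < s)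
    (h : ∀ δ : ℝ, 0 < δ → a ≤ ENNReal.ofReal (C * δ ^ s)) : a = 0 := by
  have h1 : Filter.Tendsto (fun δ : ℝ => ENNReal.ofReal (C * δ ^ s)) (nhdsWithin 0 (Set.Ioi 0))
      (nhds 0) := by
    have : Continuous fun δ : ℝ => ENNReal.ofReal (C * δ ^ s) :=
      ENNReal.continuous_ofReal.comp
        (continuous_const.mul (continuous_id.rpow_const fun _ => Or.inr hs.le))
    have h2 := this.tendsto 0
    rw [Real.zero_rpow hs.ne', mul_zero, ENNReal.ofReal_zero] at h2
    exact h2.mono_left nhdsWithin_le_nhds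
  have := ge_of_tendsto h1 (Filter.eventually_of_mem self_mem_nhdsWithin fun δ hδ => h δ hδ)
  exact le_antisymm this bot_le

lemma shadow_unique {p θ C₁ C₂ : ℝ} (hp : 1 ≤ p) (hθ : 0 < θ)
    {d₁ d₂ : ℕ} {X₁ : Set (Vec d₁)} {X₂ : Set (Vec d₂)} {ρ : Measure (Vec d₁ × Vec d₂)}
    [IsProbabilityMeasure ρ]
    (H₁ : KeyEst p θ X₁ (ρ.map Prod.fst) C₁) (H₂ : KeyEst p θ X₂ (ρ.map Prod.snd) C₂)
    {μ₁ : Measure (Vec d₁)} {μ₂ : Measure (Vec d₂)}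
    (hμ₁ : ProbOn μ₁ X₁) (hμ₂ : ProbOn μ₂ X₂)
    {S S' : Measure (Vec d₁ × Vec d₂)}
    (hS : IsShadow2 p ρ μ₁ μ₂ S) (hS' : IsShadow2 p ρ μ₁ μ₂ S') : S = S' := by
  have hp0 : 0 < p := by linarith
  obtain ⟨κ₁, κ₂, hκ₁, hκ₂, o₁, o₂, hSA⟩ := hS
  obtain ⟨κ₁', κ₂', hκ₁', hκ₂', o₁', o₂', hSA'⟩ := hS'
  obtain ⟨Δ, hΔ, e₁, e₂⟩ := shadow_coupling hp0 κ₁ κ₁' κ₂ κ₂' hSA hSA'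
  have hP1 := hμ₁.1
  have hP2 := hμ₂.1
  have hs : 0 < θ * p := by positivity
  have z₁ := zero_of_bounds hs fun δ hδ => by
    obtain ⟨ζ, hζ, b⟩ := diag_coupling hp0 μ₁ δ hδ
    exact H₁ δ hδ μ₁ μ₁ hμ₁ hμ₁ κ₁ κ₁' hκ₁ hκ₁' o₁ o₁' ζ hζ b
  have z₂ := zero_of_bounds hs fun δ hδ => by
    obtain ⟨ζ, hζ, b⟩ := diag_coupling hp0 μ₂ δ hδ
    exact H₂ δ hδ μ₂ μ₂ hμ₂ hμ₂ κ₂ κ₂' hκ₂ hκ₂' o₂ o₂' ζ hζ b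
  rw [← e₁] at z₁
  rw [← e₂] at z₂
  have c1 : Continuous fun z : (Vec d₁ × Vec d₂) × (Vec d₁ × Vec d₂) => cst p 0 z.1.1 z.2.1 :=
    cst_cont hp0 0 (by fun_prop) (by fun_prop)
  have c2 : Continuous fun z : (Vec d₁ × Vec d₂) × (Vec d₁ × Vec d₂) => cst p 0 z.1.2 z.2.2 :=
    cst_cont hp0 0 (by fun_prop) (by fun_prop)
  rw [lintegral_eq_zero_iff c1.measurable.ennreal_ofReal] at z₁
  rw [lintegral_eq_zero_iff c2.measurable.ennreal_ofReal] at z₂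
  have hae : (Prod.fst : (Vec d₁ × Vec d₂) × (Vec d₁ × Vec d₂) → _) =ᵐ[Δ] Prod.snd := by
    filter_upwards [z₁, z₂] with z h1 h2
    have h1' := le_antisymm (ENNReal.ofReal_eq_zero.1 h1) (cst_nonneg _ _)
    have h2' := le_antisymm (ENNReal.ofReal_eq_zero.1 h2) (cst_nonneg _ _)
    exact Prod.ext (eq_of_cst hp0 h1') (eq_of_cst hp0 h2')
  rw [← hΔ.2.1, ← hΔ.2.2]
  exact Measure.map_congr hae

lemma shadow_exists {p R₁ R₂ : ℝ} (hp1 : 1 < p) (hR₁ : 0 < R₁) (hR₂ : 0 < R₂)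
    {d₁ d₂ : ℕ} {X₁ : Set (Vec d₁)} {X₂ : Set (Vec d₂)} {ρ : Measure (Vec d₁ × Vec d₂)}
    (hX₁c : IsCompact X₁) (hX₂c : IsCompact X₂)
    (h₁ : ∀ x ∈ X₁, ∀ y ∈ X₁, ∀ i, |x i - y i| ≤ R₁)
    (h₂ : ∀ x ∈ X₂, ∀ y ∈ X₂, ∀ i, |x i - y i| ≤ R₂)
    (hρ₁ : ProbOn (ρ.map Prod.fst) X₁) (hρ₂ : ProbOn (ρ.map Prod.snd) X₂)
    {μ₁ : Measure (Vec d₁)} {μ₂ : Measure (Vec d₂)}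
    (hμ₁ : ProbOn μ₁ X₁) (hμ₂ : ProbOn μ₂ X₂) : ∃ S, IsShadow2 p ρ μ₁ μ₂ S := by
  obtain ⟨κ₁, hκ₁, o₁⟩ := exists_optK hp1 hR₁ hX₁c h₁ hμ₁ hρ₁
  obtain ⟨κ₂, hκ₂, o₂⟩ := exists_optK hp1 hR₂ hX₂c h₂ hμ₂ hρ₂
  refine ⟨ρ.bind ((κ₁.comap Prod.fst measurable_fst) ×ₖ (κ₂.comap Prod.snd measurable_snd)),
    κ₁, κ₂, hκ₁, hκ₂, o₁, o₂, ?_⟩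
  intro A hA
  rw [Measure.bind_apply hA (Kernel.aemeasurable _)]
  refine lintegral_congr fun y => ?_
  rw [Kernel.prod_apply, Kernel.comap_apply, Kernel.comap_apply]

/-- Hölder stability of the shadow in the marginals: for ρ with nice density,
W_p(S(ρ;μ₁,μ₂), S(ρ;ν₁,ν₂)) ≤ C (W_q(μ₁,ν₁)^θ + W_q(μ₂,ν₂)^θ), with C independent of the
marginals, for every q ∈ [1,∞]. -/
theorem shadow_holder_stability_in_marginals
    (d₁ d₂ : ℕ) (X₁ : Set (Vec d₁)) (X₂ : Set (Vec d₂))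
    (hX₁c : IsCompact X₁) (hX₂c : IsCompact X₂)
    (hconv : Convex ℝ (X₁ ×ˢ X₂)) (hbd : volume (frontier (X₁ ×ˢ X₂)) = 0)
    (p θ : ℝ) (hp1 : 1 < p) (hp2 : p ≤ 2)
    (hθ : (p < 2 → 0 < θ ∧ θ < (p - 1) ^ 2 / (p * (p + 1))) ∧ (p = 2 → θ = 1 / 6))
    (ρ : Measure (Vec d₁ × Vec d₂)) (hρ : ProbOn ρ (X₁ ×ˢ X₂))
    (hρd : NiceDensityOn ρ (X₁ ×ˢ X₂)) :
    -- shadows of ρ are unique …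
    (∀ μ₁ μ₂, ProbOn μ₁ X₁ → ProbOn μ₂ X₂ → ∃! S, IsShadow2 p ρ μ₁ μ₂ S) ∧
    -- … and there is C = C(ρ, X₁×X₂, p, θ) < ∞, independent of the marginals, with the bound
    ∃ C : ℝ, 0 ≤ C ∧
      ∀ μ₁ ν₁ : Measure (Vec d₁), ∀ μ₂ ν₂ : Measure (Vec d₂),
        ProbOn μ₁ X₁ → ProbOn ν₁ X₁ → ProbOn μ₂ X₂ → ProbOn ν₂ X₂ →
        ∀ q : ℝ≥0∞, 1 ≤ q →
        ∀ Sμ Sν, IsShadow2 p ρ μ₁ μ₂ Sμ → IsShadow2 p ρ ν₁ ν₂ Sν →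
          Wp p (prodDist p) Sμ Sν ≤
            C * (Wq q (lpDist p) μ₁ ν₁ ^ θ + Wq q (lpDist p) μ₂ ν₂ ^ θ) := by
  have hP := hρ.1
  have hp0 : 0 < p := by linarith
  obtain ⟨hθ0, hθ1⟩ : 0 < θ ∧ θ ≤ (p - 1) ^ 2 / (p * (p + 1)) := by
    rcases hp2.lt_or_eq with h | h
    · exact ⟨(hθ.1 h).1, (hθ.1 h).2.le⟩
    · rw [hθ.2 h, h]
      norm_num
  obtain ⟨R₁, hR₁, h₁⟩ := exists_R hX₁c
  obtain ⟨R₂, hR₂, h₂⟩ := exists_R hX₂c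
  obtain ⟨⟨v₁, v₂⟩, ⟨hρ₁, a₁, b₁, ha₁, hb₁, lo₁, up₁⟩, ⟨hρ₂, a₂, b₂, ha₂, hb₂, lo₂, up₂⟩⟩ :=
    marg_bounds hX₁c hX₂c hρ hρd
  have hne₁ : X₁.Nonempty := by
    rw [Set.nonempty_iff_ne_empty]
    rintro rfl
    simp at v₁
  have hne₂ : X₂.Nonempty := by
    rw [Set.nonempty_iff_ne_empty]
    rintro rfl
    simp at v₂
  have cv₁ : Convex ℝ X₁ := by
    have := hconv.linear_image (LinearMap.fst ℝ (Vec d₁) (Vec d₂))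
    rwa [show (⇑(LinearMap.fst ℝ (Vec d₁) (Vec d₂)) : _ → _) = Prod.fst from rfl,
      Set.fst_image_prod _ hne₂] at this
  have cv₂ : Convex ℝ X₂ := by
    have := hconv.linear_image (LinearMap.snd ℝ (Vec d₁) (Vec d₂))
    rwa [show (⇑(LinearMap.snd ℝ (Vec d₁) (Vec d₂)) : _ → _) = Prod.snd from rfl,
      Set.snd_image_prod hne₁] at this
  obtain ⟨C₁, hC₁, H₁⟩ := key_kernel hp1 hp2 hR₁ hθ0 hθ1 hX₁c cv₁ v₁ h₁ hρ₁ ha₁ hb₁ lo₁ up₁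
  obtain ⟨C₂, hC₂, H₂⟩ := key_kernel hp1 hp2 hR₂ hθ0 hθ1 hX₂c cv₂ v₂ h₂ hρ₂ ha₂ hb₂ lo₂ up₂
  refine ⟨?_, C₁ ^ (1 / p) + C₂ ^ (1 / p), by positivity, ?_⟩
  · intro μ₁ μ₂ hμ₁ hμ₂
    obtain ⟨S, hS⟩ := shadow_exists hp1 hR₁ hR₂ hX₁c hX₂c h₁ h₂ hρ₁ hρ₂ hμ₁ hμ₂
    exact ⟨S, hS, fun S' hS' => shadow_unique hp1.le hθ0 H₁ H₂ hμ₁ hμ₂ hS' hS⟩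
  · intro μ₁ ν₁ μ₂ ν₂ hμ₁ hν₁ hμ₂ hν₂ q hq S S' hS hS'
    obtain ⟨w₁, s₁⟩ := Wq_spec hp0 hX₁c hμ₁ hν₁ hq
    obtain ⟨w₂, s₂⟩ := Wq_spec hp0 hX₂c hμ₂ hν₂ hq
    set W₁ := Wq q (lpDist p) μ₁ ν₁
    set W₂ := Wq q (lpDist p) μ₂ ν₂
    have hb : ∀ ε : ℝ, 0 < ε → Wp p (prodDist p) S S' ≤
        C₁ ^ (1 / p) * (W₁ + ε) ^ θ + C₂ ^ (1 / p) * (W₂ + ε) ^ θ := by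
      intro ε hε
      exact shadow_bound hp1.le hC₁ hC₂ H₁ H₂ hμ₁ hν₁ hμ₂ hν₂ hS hS' (by linarith) (by linarith)
        (s₁ _ (by linarith)) (s₂ _ (by linarith))
    have hcont : Continuous fun ε : ℝ =>
        C₁ ^ (1 / p) * (W₁ + ε) ^ θ + C₂ ^ (1 / p) * (W₂ + ε) ^ θ :=
      (continuous_const.mul ((continuous_const.add continuous_id).rpow_const
        fun _ => Or.inr hθ0.le)).add
      (continuous_const.mul ((continuous_const.add continuous_id).rpow_const
        fun _ => Or.inr hθ0.le))
    have ht := (hcont.tendsto 0).mono_left (nhdsWithin_le_nhds (s := Set.Ioi 0))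
    have hlim := ge_of_tendsto ht
      (Filter.eventually_of_mem self_mem_nhdsWithin fun ε hε => hb ε hε)
    simp only [add_zero] at hlim
    have p1 : 0 ≤ C₁ ^ (1 / p) := by positivity
    have p2 : 0 ≤ C₂ ^ (1 / p) := by positivity
    have p3 : 0 ≤ W₁ ^ θ := by positivity
    have p4 : 0 ≤ W₂ ^ θ := by positivity
    nlinarith [mul_nonneg p1 p4, mul_nonneg p2 p3]

end
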